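/- For every integer n ≥ 54, the minimum number of edges of a maximal nontraceable graph of order n equals ⌈(3n − 2)/2⌉; that is, every maximal nontraceable graph of order n has at least ⌈(3n − 2)/2⌉ edges, and there exists a maximal nontraceable graph of order n with exactly ⌈(3n − 2)/2⌉ edges. -/

import Mathlib

open SimpleGraph

/-- A graph is traceable if it has a Hamiltonian path, i.e. a path containing
all the vertices of the graph. -/
def Traceable {V : Type*} (G : SimpleGraph V) : Prop :=
  ∃ (u v : V) (p : G.Walk u v), p.IsPath ∧ ∀ w, w ∈ p.support

/-- A graph is maximal nontraceable if it is not traceable, but adding any edge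
of the complement produces a traceable graph. -/
def MaxNontraceable {V : Type*} (G : SimpleGraph V) : Prop :=
  ¬ Traceable G ∧ ∀ u v : V, u ≠ v → ¬ G.Adj u v → Traceable (G ⊔ SimpleGraph.edge u v)

theorem traceable_iff_exists_list {V : Type*} [Nonempty V] {G : SimpleGraph V} :
    Traceable G ↔ ∃ l : List V, l.IsChain G.Adj ∧ l.Nodup ∧ ∀ v, v ∈ l := by
  constructor
  · rintro ⟨u, v, p, hp, h⟩
    exact ⟨p.support, p.isChain_adj_support, hp.support_nodup, h⟩
  · rintro ⟨l, hc, hn, h⟩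
    have hne : l ≠ [] := List.ne_nil_of_mem (h (Classical.arbitrary V))
    refine ⟨_, _, Walk.ofSupport l hne hc, ?_, ?_⟩
    · rw [Walk.isPath_def, Walk.support_ofSupport]; exact hn
    · rw [Walk.support_ofSupport]; exact h

/-- The lists `u :: A` and `v :: B` are disjoint paths of `G` that together cover all vertices. -/
def IsPathPair {V : Type*} (G : SimpleGraph V) (u v : V) (A B : List V) : Prop :=
  (u :: A).IsChain G.Adj ∧ (v :: B).IsChain G.Adj ∧ (u :: A ++ v :: B).Nodup ∧
    ∀ w, w ∈ u :: A ++ v :: B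

theorem isChain_or_exists_of_imp_or {α : Type*} {R R' S : α → α → Prop}
    (h : ∀ a b, R' a b → R a b ∨ S a b) {l : List α} (hl : l.IsChain R') :
    l.IsChain R ∨ ∃ P a b Q, l = P ++ a :: b :: Q ∧ S a b := by
  induction hl with
  | nil => simp
  | singleton => simp
  | @cons_cons a b l hab _ ih =>
    rcases h a b hab with h1 | h1
    · rcases ih with ih | ⟨P, c, d, Q, h2, h3⟩
      · left; simp [h1, ih]
      · exact .inr ⟨a :: P, c, d, Q, by simp [h2], h3⟩
    · exact .inr ⟨[], a, b, l, by simp, h1⟩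

theorem IsPathPair.symm {V : Type*} {G : SimpleGraph V} {u v : V} {A B : List V}
    (h : IsPathPair G u v A B) : IsPathPair G v u B A := by
  obtain ⟨h1, h2, h3, h4⟩ := h
  refine ⟨h2, h1, ?_, fun w => ?_⟩
  · exact List.perm_append_comm.nodup_iff.1 h3
  · exact List.perm_append_comm.mem_iff.1 (h4 w)

theorem isChain_reverse_of_symm {α : Type*} {R : α → α → Prop} (hR : ∀ a b, R a b → R b a)
    {l : List α} (h : l.IsChain R) : l.reverse.IsChain R :=
  List.isChain_reverse.2 (h.imp fun a b => hR a b)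

theorem SimpleGraph.isChain_reverse {V : Type*} {G : SimpleGraph V} {l : List V} :
    l.reverse.IsChain G.Adj ↔ l.IsChain G.Adj :=
  ⟨fun h => by simpa using isChain_reverse_of_symm (fun _ _ h => G.adj_symm h) h,
    isChain_reverse_of_symm (fun _ _ h => G.adj_symm h)⟩

theorem MaxNontraceable.not_hamiltonian {V : Type*} {G : SimpleGraph V} (hG : MaxNontraceable G)
    {l : List V} (hne : l ≠ []) (hc : l.IsChain G.Adj) (hn : l.Nodup) (h : ∀ v, v ∈ l) : False :=
  have : Nonempty V := ⟨l.head hne⟩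
  hG.1 (traceable_iff_exists_list.2 ⟨l, hc, hn, h⟩)

theorem MaxNontraceable.exists_isPathPair {V : Type*} {G : SimpleGraph V}
    (hG : MaxNontraceable G) {u v : V} (huv : u ≠ v) (h : ¬ G.Adj u v) :
    ∃ A B, IsPathPair G u v A B := by
  have : Nonempty V := ⟨u⟩
  obtain ⟨l, hc, hn, hm⟩ := traceable_iff_exists_list.1 (hG.2 u v huv h)
  have key : ∀ a b, (G ⊔ edge u v).Adj a b → G.Adj a b ∨ (a = u ∧ b = v ∨ a = v ∧ b = u) := by
    intro a b hab
    rw [sup_adj, edge_adj] at hab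
    tauto
  rcases isChain_or_exists_of_imp_or key hc with h1 | ⟨P, a, b, Q, rfl, hab⟩
  · exact (hG.not_hamiltonian (List.ne_nil_of_mem (hm u)) h1 hn hm).elim
  have h1 : (P ++ [a]).IsChain G.Adj := by
    have h0 : (P ++ [a]).IsChain (G ⊔ edge u v).Adj := by
      exact List.IsChain.left_of_append (l₂ := b :: Q) (by simpa using hc)
    rcases isChain_or_exists_of_imp_or key h0 with h1 | ⟨P', c, d, Q', h2, h3⟩
    · exact h1
    · have hb : b ∉ P ++ [a] := by
        intro hb
        rw [List.append_cons P, List.nodup_append] at hn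
        exact hn.2.2 _ hb b (by simp) rfl
      rw [h2] at hb
      rcases hab with ⟨rfl, rfl⟩ | ⟨rfl, rfl⟩ <;> rcases h3 with ⟨rfl, rfl⟩ | ⟨rfl, rfl⟩ <;>
        simp at hb
  have h2 : (b :: Q).IsChain G.Adj := by
    have h0 : (b :: Q).IsChain (G ⊔ edge u v).Adj := by
      apply hc.suffix; exact ⟨P ++ [a], by simp⟩
    rcases isChain_or_exists_of_imp_or key h0 with h1 | ⟨P', c, d, Q', h2, h3⟩
    · exact h1
    · have hb : a ∉ b :: Q := by
        intro hb
        rw [List.append_cons P, List.nodup_append] at hn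
        exact hn.2.2 a (by simp) _ hb rfl
      rw [h2] at hb
      rcases hab with ⟨rfl, rfl⟩ | ⟨rfl, rfl⟩ <;> rcases h3 with ⟨rfl, rfl⟩ | ⟨rfl, rfl⟩ <;>
        simp at hb
  have h3 : IsPathPair G a b P.reverse Q := by
    have hp : (a :: P.reverse ++ b :: Q).Perm (P ++ a :: b :: Q) := by
      rw [List.append_cons P a]
      refine List.Perm.append_right _ ?_
      simpa using (List.reverse_perm (P ++ [a]))
    refine ⟨?_, h2, hp.nodup_iff.2 hn, fun w => hp.mem_iff.2 (hm w)⟩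
    simpa using SimpleGraph.isChain_reverse.2 h1
  rcases hab with ⟨rfl, rfl⟩ | ⟨rfl, rfl⟩
  · exact ⟨_, _, h3⟩
  · exact ⟨_, _, h3.symm⟩

theorem IsPathPair.traceable {V : Type*} {G : SimpleGraph V} {u v : V} {A B : List V}
    (h : IsPathPair G u v A B) : Traceable (G ⊔ edge u v) := by
  obtain ⟨h1, h2, h3, h4⟩ := h
  have : Nonempty V := ⟨u⟩
  have huv : u ≠ v := by rintro rfl; simp at h3
  have hle : ∀ a b, G.Adj a b → (G ⊔ edge u v).Adj a b := fun a b hab => Or.inl hab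
  have hp : ((u :: A).reverse ++ v :: B).Perm (u :: A ++ v :: B) :=
    List.Perm.append_right _ (List.reverse_perm _)
  refine traceable_iff_exists_list.2 ⟨(u :: A).reverse ++ v :: B, ?_, hp.nodup_iff.2 h3,
    fun w => hp.mem_iff.2 (h4 w)⟩
  refine List.IsChain.append ((SimpleGraph.isChain_reverse.2 h1).imp hle) (h2.imp hle) ?_
  simp [edge_adj, huv]

section Merge

/-- `l` is a path for the relation `E` whose first and last element carry the end labels `x.1` and
`x.2`; the meaning of the labels is given by `H`. -/
def IsFragment {V : Type*} (E : V → V → Prop) (H : ℕ → V → Prop) (x : ℕ × ℕ) (l : List V) : Prop :=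
  l.IsChain E ∧ (∃ a ∈ l.head?, H x.1 a) ∧ ∃ b ∈ l.getLast?, H x.2 b

/-- The end labels of a piece: `2 * m` stands for the fragment number `m`, and `2 * m + 1` for the
same fragment traversed backwards. -/
def pieceEnds (s : List (ℕ × ℕ)) (p : ℕ) : ℕ × ℕ :=
  if p % 2 = 0 then s.getD (p / 2) (0, 0) else (s.getD (p / 2) (0, 0)).swap

/-- The vertices of a piece, in the order of traversal. -/
def pieceList {V : Type*} (F : List (List V)) (p : ℕ) : List V :=
  if p % 2 = 0 then F.getD (p / 2) [] else (F.getD (p / 2) []).reverse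

/-- The pieces `p :: q` can be concatenated, and the last end label can be replaced by `y`. -/
def tailOk (c le : ℕ → ℕ → Bool) (s : List (ℕ × ℕ)) (y : ℕ) : ℕ → List ℕ → Bool
  | p, [] => le (pieceEnds s p).2 y
  | p, q :: r => c (pieceEnds s p).2 (pieceEnds s q).1 && tailOk c le s y q r

/-- The pieces can be concatenated to a fragment with end labels `x`. -/
def concatOk (c le : ℕ → ℕ → Bool) (s : List (ℕ × ℕ)) : List ℕ → ℕ × ℕ → Bool
  | [], _ => false
  | p :: r, x => le (pieceEnds s p).1 x.1 && tailOk c le s x.2 p r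

/-- The recipe `r` uses each fragment of the configuration `s` once, and produces `s'`. -/
def recipeOk (c le : ℕ → ℕ → Bool) (s s' : List (ℕ × ℕ)) (r : List (List ℕ)) : Bool :=
  r.length == s'.length && ((r.zip s').all fun q => concatOk c le s q.1 q.2) &&
    (r.flatten.map (· / 2)).isPerm (List.range s.length)

variable {V : Type*} {E : V → V → Prop} {H H' : ℕ → V → Prop}

theorem IsFragment.reverse (hE : ∀ a b, E a b → E b a) {x : ℕ × ℕ} {l : List V}
    (h : IsFragment E H x l) : IsFragment E H x.swap l.reverse := by
  obtain ⟨h1, h2, h3⟩ := h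
  exact ⟨isChain_reverse_of_symm hE h1, by simpa using h3, by simpa using h2⟩

theorem IsFragment.piece (hE : ∀ a b, E a b → E b a) {s : List (ℕ × ℕ)} {F : List (List V)}
    (hF : List.Forall₂ (IsFragment E H) s F) {p : ℕ} (hp : p / 2 < s.length) :
    IsFragment E H (pieceEnds s p) (pieceList F p) := by
  have hl : p / 2 < F.length := hF.length_eq ▸ hp
  have h : IsFragment E H (s.getD (p / 2) (0, 0)) (F.getD (p / 2) []) := by
    rw [List.getD_eq_getElem _ _ hp, List.getD_eq_getElem _ _ hl]
    exact List.Forall₂.get hF hp hl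
  unfold pieceEnds pieceList
  split
  · exact h
  · exact h.reverse hE

theorem tail_isFragment (hE : ∀ a b, E a b → E b a) {c le : ℕ → ℕ → Bool}
    (hc : ∀ x y a b, c x y = true → H x a → H y b → E a b)
    (hle : ∀ x y a, le x y = true → H x a → H' y a)
    {s : List (ℕ × ℕ)} {F : List (List V)} (hF : List.Forall₂ (IsFragment E H) s F) (y : ℕ)
    (r : List ℕ) (p : ℕ) (hr : ∀ q ∈ p :: r, q / 2 < s.length) (h : tailOk c le s y p r = true) :
    ((p :: r).flatMap (pieceList F)).IsChain E ∧
      (∃ a ∈ ((p :: r).flatMap (pieceList F)).head?, H (pieceEnds s p).1 a) ∧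
      ∃ b ∈ ((p :: r).flatMap (pieceList F)).getLast?, H' y b := by
  induction r generalizing p with
  | nil =>
    obtain ⟨h1, h2, b, hb, hb'⟩ := IsFragment.piece hE hF (hr p (by simp))
    simp only [List.flatMap_cons, List.flatMap_nil, List.append_nil]
    exact ⟨h1, h2, b, hb, hle _ _ _ h hb'⟩
  | cons q r ih =>
    simp only [tailOk, Bool.and_eq_true] at h
    obtain ⟨h1, ⟨a, ha, ha'⟩, b, hb, hb'⟩ := IsFragment.piece hE hF (hr p (by simp))
    obtain ⟨h4, ⟨d, hd, hd'⟩, e, he, he'⟩ := ih q (fun z hz => hr z (by simp_all)) h.2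
    rw [List.flatMap_cons]
    refine ⟨h1.append h4 ?_, ⟨a, ?_, ha'⟩, e, ?_, he'⟩
    · intro x' hx' y' hy'
      obtain rfl := Option.mem_unique hx' hb
      obtain rfl := Option.mem_unique hy' hd
      exact hc _ _ _ _ h.1 hb' hd'
    · rw [List.head?_append, Option.mem_def.1 ha]; rfl
    · rw [List.getLast?_append, Option.mem_def.1 he]; rfl

theorem exists_merge (hE : ∀ a b, E a b → E b a) {c le : ℕ → ℕ → Bool}
    (hc : ∀ x y a b, c x y = true → H x a → H y b → E a b)
    (hle : ∀ x y a, le x y = true → H x a → H' y a)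
    {s s' : List (ℕ × ℕ)} {F : List (List V)} (hF : List.Forall₂ (IsFragment E H) s F)
    {r : List (List ℕ)} (hr : recipeOk c le s s' r = true) :
    ∃ F', List.Forall₂ (IsFragment E H') s' F' ∧ F'.flatten.Perm F.flatten := by
  simp only [recipeOk, Bool.and_eq_true, beq_iff_eq, List.all_eq_true, List.isPerm_iff] at hr
  obtain ⟨⟨h1, h2⟩, h3⟩ := hr
  refine ⟨r.map fun q => q.flatMap (pieceList F), ?_, ?_⟩
  · rw [List.forall₂_map_right_iff, List.forall₂_iff_zip]
    refine ⟨h1.symm, fun {x q} hx => ?_⟩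
    have hx' : (q, x) ∈ r.zip s' := by
      rw [← List.zip_swap]; exact List.mem_map.2 ⟨_, hx, rfl⟩
    have h4 := h2 _ hx'
    have hq : ∀ p ∈ q, p / 2 < s.length := fun p hp =>
      List.mem_range.1 (h3.mem_iff.1 (List.mem_map.2
        ⟨p, List.mem_flatten.2 ⟨q, (List.of_mem_zip hx').1, hp⟩, rfl⟩))
    match q, h4, hq with
    | p :: l, h4, hq =>
      simp only [concatOk, Bool.and_eq_true] at h4
      obtain ⟨h5, ⟨a, ha, ha'⟩, h6⟩ := tail_isFragment hE hc hle hF _ l p hq h4.2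
      exact ⟨h5, ⟨a, ha, hle _ _ _ h4.1 ha'⟩, h6⟩
  · have e1 : (r.map fun q => q.flatMap (pieceList F)).flatten =
        r.flatten.flatMap (pieceList F) := by
      clear h1 h2 h3
      induction r with
      | nil => rfl
      | cons q r ih => simp [ih]
    have e2 : (r.flatten.flatMap (pieceList F)).Perm
        (r.flatten.flatMap fun p => F.getD (p / 2) []) := by
      refine List.Perm.flatMap_left _ fun p _ => ?_
      unfold pieceList
      split
      · exact List.Perm.refl _
      · exact List.reverse_perm _
    have e3 : (r.flatten.flatMap fun p => F.getD (p / 2) []) =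
        (r.flatten.map (· / 2)).flatMap fun m => F.getD m [] := by
      rw [List.flatMap_map]
    have e4 : (List.range s.length).flatMap (fun m => F.getD m []) = F.flatten := by
      rw [hF.length_eq, List.flatMap_def]
      congr 1
      apply List.ext_getElem <;> simp +contextual
    rw [e1, ← e4]
    refine e2.trans ?_
    rw [e3]
    exact h3.flatMap_right _

end Merge

section Slices

/-- The edges inside a slice; `0` is the slice carrying the two leaves, `1` is a claw, and `2` is a
claw whose centre has been replaced by a triangle. -/
def innerEdges : ℕ → List (ℕ × ℕ)
  | 0 => [(0, 3), (1, 3), (2, 3), (0, 4), (3, 5)]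
  | 1 => [(0, 3), (1, 3), (2, 3)]
  | _ => [(0, 3), (1, 4), (2, 5), (3, 4), (4, 5), (3, 5)]

/-- The number of vertices of a slice. -/
def sliceSize : ℕ → ℕ
  | 1 => 4
  | _ => 6

/-- The twist used where the cyclic arrangement of slices is closed. -/
def twist : ℕ → ℕ
  | 1 => 2
  | 2 => 1
  | j => j

/-- The edges of the cyclic arrangement of `k` slices of types `τ 0, …, τ (k - 1)`; the vertex
`(i, j)` is the vertex number `j` of slice number `i`. -/
def Link (τ : ℕ → ℕ) (k : ℕ) (p q : ℕ × ℕ) : Prop :=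
  (p.1 = q.1 ∧ (p.2, q.2) ∈ innerEdges (τ p.1)) ∨
    (q.1 = p.1 + 1 ∧ p.2 < 3 ∧ q.2 = p.2) ∨
    (p.1 + 1 = k ∧ q.1 = 0 ∧ p.2 < 3 ∧ q.2 = twist p.2)

/-- The vertices of a slice. -/
def sliceVerts (τ : ℕ → ℕ) (i : ℕ) : List (ℕ × ℕ) :=
  (List.range (sliceSize (τ i))).map (Prod.mk i)

/-- The vertices of the first `k` slices. -/
def verts (τ : ℕ → ℕ) (k : ℕ) : List (ℕ × ℕ) :=
  (List.range k).flatMap (sliceVerts τ)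

theorem verts_succ (τ : ℕ → ℕ) (k : ℕ) : verts τ (k + 1) = verts τ k ++ sliceVerts τ k := by
  simp [verts, List.range_succ]

theorem mem_verts {τ : ℕ → ℕ} {k : ℕ} {p : ℕ × ℕ} :
    p ∈ verts τ k ↔ p.1 < k ∧ p.2 < sliceSize (τ p.1) := by
  obtain ⟨i, j⟩ := p
  simp only [verts, sliceVerts, List.mem_flatMap, List.mem_range, List.mem_map, Prod.mk.injEq]
  constructor
  · rintro ⟨i', h1, j', h2, rfl, rfl⟩
    exact ⟨h1, h2⟩
  · rintro ⟨h1, h2⟩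
    exact ⟨i, h1, j, h2, rfl, rfl⟩

/-- The meaning of the end labels in front of slice number `i`: `0` is no condition, `1` is the
vertex `u`, `2, 3, 4` are the vertices `0, 1, 2` of the first slice, `5, 6, 7` those of the slice
`i - 1`, and `8 + j` is the vertex `j` of the slice `i`. -/
def HasLabel (u : ℕ × ℕ) (i x : ℕ) (p : ℕ × ℕ) : Prop :=
  x = 0 ∨ (x = 1 ∧ p = u) ∨ (2 ≤ x ∧ x ≤ 4 ∧ p = (0, x - 2)) ∨
    (5 ≤ x ∧ x ≤ 7 ∧ p.1 + 1 = i ∧ p.2 = x - 5) ∨ (8 ≤ x ∧ p = (i, x - 8))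

/-- Ends with labels `x` and `y` are adjacent when a slice of type `τ` is added; the vertex `a` of
the slice is `u` and the vertex `b` is `v`, where `9` stands for no vertex. -/
def compatible (τ a b x y : ℕ) : Bool :=
  (decide (5 ≤ x) && decide (x ≤ 7) && y == x + 3) ||
  (decide (8 ≤ x) && decide (8 ≤ y) && (innerEdges τ).contains (x - 8, y - 8)) ||
  (x == 1 && b != 9 && y == 8 + b) ||
  (a != 9 && b != 9 && x == 8 + a && y == 8 + b)

/-- The label `x` in front of a slice of type `τ` may be replaced by the label `y` behind it. -/
def replaces (τ a x y : ℕ) : Bool :=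
  y == 0 || (decide (x ≤ 4) && y == x) ||
  (decide (8 ≤ x) && decide (x ≤ 10) && (y == x - 3 || (τ == 0 && y == x - 6))) ||
  (a != 9 && x == 8 + a && y == 1)

/-- Ends with labels `x` and `y` are adjacent by the edges closing the arrangement. -/
def closeCompatible (x y : ℕ) : Bool :=
  decide (5 ≤ x) && decide (x ≤ 7) && y == 2 + twist (x - 5)

/-- The one-vertex fragments of a new slice of type `τ`. -/
def newFragments (τ : ℕ) : List (ℕ × ℕ) :=
  (List.range (sliceSize τ)).map fun j => (8 + j, 8 + j)

/-- A recipe for a slice with code `c = 100 * τ + 10 * a + b`. -/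
def stepOk (c : ℕ) (s t : List (ℕ × ℕ)) (r : List (List ℕ)) : Bool :=
  recipeOk (fun x y => compatible (c / 100) (c / 10 % 10) (c % 10) x y ||
      compatible (c / 100) (c / 10 % 10) (c % 10) y x)
    (replaces (c / 100) (c / 10 % 10)) (s ++ newFragments (c / 100)) t r

/-- The configuration `s` describes a partition of the vertices of the first `i` slices into
paths. -/
def Realized (E : ℕ × ℕ → ℕ × ℕ → Prop) (τ : ℕ → ℕ) (u : ℕ × ℕ) (i : ℕ) (s : List (ℕ × ℕ)) : Prop :=
  ∃ F, List.Forall₂ (IsFragment E (HasLabel u i)) s F ∧ F.flatten.Perm (verts τ i)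

theorem HasLabel.eq_of_new {u : ℕ × ℕ} {i x : ℕ} {p : ℕ × ℕ} (h : HasLabel u i x p) (hx : 8 ≤ x) :
    p = (i, x - 8) := by
  rcases h with h | h | h | h | h
  · omega
  · omega
  · omega
  · omega
  · exact h.2

theorem HasLabel.eq_of_right {u : ℕ × ℕ} {i x : ℕ} {p : ℕ × ℕ} (h : HasLabel u i x p) (hx : 5 ≤ x)
    (hx' : x ≤ 7) : p.1 + 1 = i ∧ p.2 = x - 5 := by
  rcases h with h | h | h | h | h
  · omega
  · omega
  · omega
  · exact h.2.2
  · omega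

theorem HasLabel.eq_of_left {u : ℕ × ℕ} {i x : ℕ} {p : ℕ × ℕ} (h : HasLabel u i x p) (hx : 2 ≤ x)
    (hx' : x ≤ 4) : p = (0, x - 2) := by
  rcases h with h | h | h | h | h
  · omega
  · omega
  · exact h.2.2
  · omega
  · omega

theorem HasLabel.eq_of_one {u : ℕ × ℕ} {i : ℕ} {p : ℕ × ℕ} (h : HasLabel u i 1 p) : p = u := by
  rcases h with h | h | h | h | h
  · omega
  · exact h.2
  · omega
  · omega
  · omega

variable {E : ℕ × ℕ → ℕ × ℕ → Prop} {τ : ℕ → ℕ} {k : ℕ} {u v : ℕ × ℕ}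

theorem Realized.step_of_type (hE : ∀ p q, E p q → E q p) (hL : ∀ p q, Link τ k p q → E p q)
    (huv : E u v) (h0 : ∀ i, τ i = 0 → i = 0) {i c : ℕ} {s s' : List (ℕ × ℕ)} {r : List (List ℕ)}
    (hc : c / 100 = τ i) (hu : c / 10 % 10 ≠ 9 → u = (i, c / 10 % 10))
    (hv : c % 10 ≠ 9 → v = (i, c % 10))
    (hr : stepOk c s s' r = true) (hs : Realized E τ u i s) : Realized E τ u (i + 1) s' := by
  obtain ⟨F, hF, hp⟩ := hs
  rw [stepOk, hc] at hr
  have key : ∀ x y p q, compatible (τ i) (c / 10 % 10) (c % 10) x y = true → HasLabel u i x p →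
      HasLabel u i y q → E p q := by
    intro x y p q hxy hx hy
    simp only [compatible, Bool.or_eq_true, Bool.and_eq_true, decide_eq_true_eq, beq_iff_eq,
      bne_iff_ne, List.contains_iff_mem] at hxy
    rcases hxy with ((⟨⟨h1, h2⟩, h3⟩ | ⟨⟨h1, h2⟩, h3⟩) | ⟨⟨h1, h2⟩, h3⟩) | ⟨⟨⟨h1, h2⟩, h3⟩, h4⟩
    · obtain ⟨h4, h5⟩ := hx.eq_of_right h1 h2
      rw [hy.eq_of_new (by omega)]
      exact hL _ _ (.inr (.inl ⟨h4.symm, by omega, by simp only; omega⟩))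
    · rw [hy.eq_of_new h2, hx.eq_of_new h1]
      exact hL _ _ (.inl ⟨rfl, h3⟩)
    · subst h1
      rw [hx.eq_of_one, hy.eq_of_new (by omega), h3, Nat.add_sub_cancel_left, ← hv h2]
      exact huv
    · rw [hy.eq_of_new (by omega), hx.eq_of_new (by omega), h3, h4, Nat.add_sub_cancel_left,
        Nat.add_sub_cancel_left, ← hv h2, ← hu h1]
      exact huv
  have hF' : List.Forall₂ (IsFragment E (HasLabel u i)) (s ++ newFragments (τ i))
      (F ++ (sliceVerts τ i).map fun p => [p]) := by
    refine List.rel_append hF ?_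
    rw [newFragments, sliceVerts, List.map_map, List.forall₂_map_left_iff,
      List.forall₂_map_right_iff, List.forall₂_same]
    intro j _
    refine ⟨by simp, ⟨(i, j), by simp, ?_⟩, (i, j), by simp, ?_⟩ <;>
      exact .inr (.inr (.inr (.inr ⟨by simp, by simp⟩)))
  have hc : ∀ x y p q, (compatible (τ i) (c / 10 % 10) (c % 10) x y ||
      compatible (τ i) (c / 10 % 10) (c % 10) y x) = true → HasLabel u i x p →
      HasLabel u i y q → E p q := by
    intro x y p q hxy hx hy
    rw [Bool.or_eq_true] at hxy
    exact hxy.elim (fun h => key _ _ _ _ h hx hy) fun h => hE _ _ (key _ _ _ _ h hy hx)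
  have hle : ∀ x y a, replaces (τ i) (c / 10 % 10) x y = true → HasLabel u i x a →
      HasLabel u (i + 1) y a := by
    intro x y a hxy hx
    simp only [replaces, Bool.or_eq_true, Bool.and_eq_true, decide_eq_true_eq, beq_iff_eq,
      bne_iff_ne] at hxy
    rcases hxy with ((h1 | ⟨h1, h2⟩) | ⟨⟨h1, h2⟩, h3 | ⟨h3, h4⟩⟩) | ⟨⟨h1, h2⟩, h3⟩
    · exact .inl h1
    · rcases hx with h | h | h | h | h
      · exact .inl (h2.trans h)
      · exact .inr (.inl ⟨h2.trans h.1, h.2⟩)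
      · subst h2
        exact .inr (.inr (.inl h))
      · omega
      · omega
    · have ha := hx.eq_of_new (by omega)
      refine .inr (.inr (.inr (.inl ⟨by omega, by omega, by simp [ha], ?_⟩)))
      simp only [ha]
      omega
    · have ha := hx.eq_of_new (by omega)
      refine .inr (.inr (.inl ⟨by omega, by omega, ?_⟩))
      rw [ha, h0 i h3, h4]
      congr 1
    · have ha := hx.eq_of_new (by omega)
      refine .inr (.inl ⟨h3, ?_⟩)
      rw [ha, h2, Nat.add_sub_cancel_left, hu h1]
  obtain ⟨F', h1, h2⟩ := exists_merge hE hc hle hF' hr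
  refine ⟨F', h1, h2.trans ?_⟩
  rw [verts_succ, List.flatten_append]
  refine hp.append ?_
  rw [← List.flatMap_def]
  simp

theorem Realized.close (hE : ∀ p q, E p q → E q p) (hL : ∀ p q, Link τ k p q → E p q)
    {s : List (ℕ × ℕ)} {r : List ℕ}
    (hr : recipeOk (fun x y => closeCompatible x y || closeCompatible y x) (fun _ y => y == 0)
      s [(0, 0)] [r] = true) (hs : Realized E τ u k s) :
    ∃ l : List (ℕ × ℕ), l.IsChain E ∧ l.Perm (verts τ k) := by
  obtain ⟨F, hF, hp⟩ := hs
  have key : ∀ x y p q, closeCompatible x y = true → HasLabel u k x p →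
      HasLabel u k y q → E p q := by
    intro x y p q hxy hx hy
    simp only [closeCompatible, Bool.and_eq_true, decide_eq_true_eq, beq_iff_eq] at hxy
    obtain ⟨⟨h1, h2⟩, h3⟩ := hxy
    refine hL _ _ (.inr (.inr ?_))
    obtain ⟨h4, h5⟩ := hx.eq_of_right h1 h2
    have ht : twist (x - 5) < 3 := by interval_cases x <;> decide
    rw [hy.eq_of_left (by omega) (by omega), h3, h5]
    exact ⟨h4, rfl, by omega, by simp⟩
  obtain ⟨F', h1, h2⟩ := exists_merge (H' := fun _ _ => True) hE
    (fun x y a b hxy hx hy => by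
      rw [Bool.or_eq_true] at hxy
      exact hxy.elim (fun h => key _ _ _ _ h hx hy) fun h => hE _ _ (key _ _ _ _ h hy hx))
    (fun _ _ _ _ _ => trivial) hF hr
  cases h1 with
  | cons h3 h4 =>
    cases h4
    exact ⟨_, h3.1, by simpa using h2.trans hp⟩

end Slices

section Transfers

/-- The configurations that occur in the transfer table. -/
def configs : List (List (ℕ × ℕ)) := [
  [], [(2,0),(3,5),(4,7),(6,0)], [(2,0),(3,5),(4,7),(1,0)], [(2,0),(3,5),(4,0)],
  [(2,0),(3,5),(4,0),(6,7)], [(2,0),(3,5),(4,0),(6,1)], [(2,0),(3,5),(4,0),(7,1)],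
  [(2,0),(3,5),(6,7),(1,0)], [(2,0),(3,5),(6,1),(7,0)], [(2,0),(3,5),(6,0)], [(2,0),(3,5),(7,0)],
  [(2,0),(3,5),(1,0)], [(2,0),(3,6)], [(2,0),(3,6),(4,7)], [(2,0),(3,6),(4,7),(1,0)],
  [(2,0),(3,6),(4,0)], [(2,0),(3,6),(4,0),(5,7)], [(2,0),(3,6),(4,0),(5,1)],
  [(2,0),(3,6),(4,0),(7,1)], [(2,0),(3,6),(5,7),(1,0)], [(2,0),(3,6),(5,1),(7,0)],
  [(2,0),(3,6),(5,0)], [(2,0),(3,6),(7,1)], [(2,0),(3,6),(7,0)], [(2,0),(3,6),(1,0)],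
  [(2,0),(3,7),(4,0)], [(2,0),(3,7),(4,0),(5,6)], [(2,0),(3,7),(4,0),(5,1)],
  [(2,0),(3,7),(5,6),(1,0)], [(2,0),(3,7),(6,0)], [(2,0),(3,7),(1,0)], [(2,0),(3,1),(4,7)],
  [(2,0),(3,1),(4,0),(5,7)], [(2,0),(3,1),(4,0),(6,7)], [(2,0),(3,1),(5,6),(7,0)],
  [(2,0),(3,1),(5,7),(6,0)], [(2,0),(3,1),(5,0)], [(2,0),(3,1),(5,0),(6,7)], [(2,0),(3,1),(6,0)],
  [(2,0),(3,1),(7,0)], [(2,0),(3,0),(4,5)], [(2,0),(3,0),(4,5),(6,7)], [(2,0),(3,0),(4,5),(6,1)],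
  [(2,0),(3,0),(4,6)], [(2,0),(3,0),(4,6),(5,7)], [(2,0),(3,0),(4,7)], [(2,0),(3,0),(4,7),(5,6)],
  [(2,0),(3,0),(5,6)], [(2,0),(3,0),(5,6),(7,1)], [(2,0),(3,0),(5,7)], [(2,0),(3,0),(5,7),(6,1)],
  [(2,0),(3,0),(5,1)], [(2,0),(3,0),(5,1),(6,7)], [(2,0),(3,0),(6,7)], [(2,0),(3,0),(6,1)],
  [(2,0),(3,0),(7,1)], [(3,5),(4,0),(6,7),(1,0)], [(3,5),(4,0),(1,0)], [(3,6),(4,7),(5,0),(1,0)],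
  [(3,6),(4,0),(5,7),(1,0)], [(3,6),(4,0),(7,0)], [(3,6),(4,0),(1,0)], [(3,7),(4,0),(5,6),(1,0)],
  [(3,7),(4,0),(1,0)], [(3,0),(4,5),(6,7),(1,0)], [(3,0),(4,5),(6,0)], [(3,0),(4,5),(1,0)],
  [(3,0),(4,6),(5,7),(1,0)], [(3,0),(4,6),(5,0)], [(3,0),(4,6),(1,0)], [(3,0),(4,7)],
  [(3,0),(4,7),(5,6),(1,0)], [(3,0),(4,7),(5,0)], [(3,0),(4,7),(6,0)], [(3,0),(4,7),(1,0)],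
  [(3,0),(4,1),(5,6),(7,0)], [(3,0),(4,1),(5,7),(6,0)], [(3,0),(4,1),(5,0)],
  [(3,0),(4,1),(5,0),(6,7)], [(3,0),(4,1),(6,0)], [(3,0),(4,1),(7,0)], [(3,0),(4,0),(5,6)],
  [(3,0),(4,0),(5,7)], [(3,0),(4,0),(6,7)], [(4,5),(6,0),(1,0)], [(4,7),(5,0),(6,0)],
  [(4,7),(5,0),(1,0)], [(4,7),(6,0),(1,0)], [(4,1),(5,0),(6,0)], [(4,1),(5,0),(7,0)],
  [(4,1),(6,0),(7,0)], [(4,0),(5,6),(7,0)], [(4,0),(5,7),(6,0)], [(4,0),(5,7),(1,0)],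
  [(4,0),(5,1),(6,0)], [(4,0),(5,1),(7,0)], [(4,0),(5,0)], [(4,0),(5,0),(6,7)],
  [(4,0),(5,0),(6,1)], [(4,0),(5,0),(7,1)], [(4,0),(6,7),(1,0)], [(4,0),(6,1),(7,0)],
  [(4,0),(6,0)], [(4,0),(6,0),(7,1)], [(4,0),(7,0)]]

/-- The transfer table: a row `(c, s, t, r)` says that the recipe `r` extends the configuration
number `s` by a slice with code `c` to the configuration number `t`. -/
def transfers : List (ℕ × ℕ × ℕ × List (List ℕ)) := [
  (1,0,102,[[4,6,10],[2,0,8]]), (2,0,102,[[4,0,8],[2,6,10]]), (5,0,70,[[2,6,10,0,8],[4]]),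
  (9,0,74,[[2,6,10],[4],[0,8]]), (9,0,87,[[4],[2,6,10],[0,8]]), (12,0,96,[[4,2,6,10],[0,8]]),
  (14,0,70,[[2,8,0,6,10],[4]]), (15,0,96,[[4,6,2,10],[0,8]]), (19,0,39,[[0,8],[2],[4,6,10]]),
  (19,0,98,[[4,6,10],[0,8],[2]]), (24,0,12,[[0,8,4,6,10],[2]]), (25,0,102,[[4,10],[2,6,0,8]]),
  (29,0,24,[[0,8],[2],[4,6,10]]), (29,0,55,[[0,8],[2,6,10],[4]]), (29,0,77,[[2,6,10],[4],[0,8]]),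
  (29,0,88,[[4],[0,8],[2,6,10]]), (34,0,13,[[0,8,6,10],[2],[4]]), (39,0,14,[[0,8],[2],[4],[6,10]]),
  (39,0,58,[[2],[4],[0,8],[6,10]]), (45,0,13,[[0,6,10,8],[2],[4]]),
  (49,0,14,[[0,6,10],[2],[4],[8]]), (49,0,58,[[2],[4],[0,6,10],[8]]),
  (59,0,22,[[0,8],[2],[4,6,10]]), (59,0,31,[[0,8],[2,6,10],[4]]), (59,0,74,[[2,6,0,8],[4],[10]]),
  (59,0,87,[[4],[2,6,0,8],[10]]), (99,0,15,[[0,8],[2],[4,6,10]]), (99,0,23,[[0,8],[2],[4,6,10]]),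
  (99,0,45,[[0,8],[2,6,10],[4]]), (99,0,72,[[2,6,10],[4],[0,8]]), (99,0,85,[[4],[0,8],[2,6,10]]),
  (101,15,25,[[0],[2,8,6,12,10],[4]]), (101,40,45,[[0],[2],[4,6,8,12,10]]),
  (101,96,104,[[0],[8,10,6,4,2]]), (101,104,102,[[0],[6,4,10,8,2]]),
  (102,15,3,[[0],[2,8,12,10,6],[4]]), (102,40,43,[[0],[2],[4,6,10,12,8]]),
  (102,96,102,[[0],[6,10,8,4,2]]), (102,102,104,[[0],[8,4,10,6,2]]),
  (109,3,33,[[0],[2,6],[4],[8,12,10]]), (109,15,18,[[0],[2,8],[4],[10,12,6]]),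
  (109,15,27,[[0],[2,8,12,10],[4],[6]]), (109,23,24,[[0],[2,8],[6,12,10,4]]),
  (109,23,51,[[0],[2,8,12,10,4],[6]]), (109,25,17,[[0],[2,10,12,8],[4],[6]]),
  (109,73,74,[[0],[2,10],[6,12,8,4]]), (109,96,100,[[0],[6,10,8],[4,2]]),
  (109,102,95,[[0],[4],[8,10,6,2]]), (109,102,103,[[0],[6,2],[8,10,4]]),
  (112,3,25,[[0],[2,6,12,8,10],[4]]), (112,15,3,[[0],[2,8,10,12,6],[4]]),
  (112,96,102,[[0],[6,8,10,4,2]]), (112,102,96,[[0],[4,10,8,6,2]]),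
  (119,3,6,[[0],[2,6],[4],[10,12,8]]), (119,9,30,[[0],[2,6,12,10],[8,4]]),
  (119,15,32,[[0],[2,8],[4],[6,12,10]]), (119,21,39,[[0],[2,8],[10,12,6,4]]),
  (119,25,5,[[0],[2,10,12,6],[4],[8]]), (119,45,42,[[0],[2],[4,10,12,6],[8]]),
  (119,72,74,[[0],[2,10],[8,12,6,4]]), (119,72,77,[[0],[2,10,12,8],[6,4]]),
  (119,96,101,[[0],[6],[8,10,4,2]]), (119,102,93,[[0],[4,10,8],[6,2]]),
  (129,3,18,[[0],[2,6,12,8],[4],[10]]), (129,15,6,[[0],[2,8,12,6],[4],[10]]),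
  (129,21,24,[[0],[2,8],[10,12,6,4]]), (129,23,11,[[0],[2,8,12,6],[10,4]]),
  (129,68,69,[[0],[2,8],[10,12,6,4]]), (129,72,79,[[0],[2,10],[8,12,6,4]]),
  (129,96,98,[[0],[4,2],[6,10,8]]), (129,96,103,[[0],[6,10,4,2],[8]]),
  (129,102,94,[[0],[4,10,8],[6,2]]), (139,4,33,[[0],[2,8,14],[4],[10,6,12]]),
  (139,10,8,[[0],[2,6],[8,12],[10,4]]), (139,16,32,[[0],[2,10,14],[4],[8,6,12]]),
  (139,23,20,[[0],[2,8],[6,12],[10,4]]), (139,85,86,[[0,10],[6,2],[12,8,4]]),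
  (139,85,87,[[0,10],[8,4],[12,6,2]]), (139,91,95,[[0],[6,2,8,12],[10,4]]),
  (139,92,93,[[0],[6,2,10],[12,8,4]]), (139,92,94,[[0],[6,2,10,12],[8,4]]),
  (139,97,98,[[0],[6,2],[8,4,10,12]]), (190,6,15,[[0],[2,8,7,12,14,10],[4]]),
  (190,11,53,[[0],[2,6,4],[8,12,10]]), (190,14,45,[[0],[2,10,14,8,6],[4,12]]),
  (190,18,3,[[0],[2,10,14,12,6,8],[4]]), (190,31,3,[[0],[2,6],[4,10,12,8]]),
  (190,32,15,[[0],[2,8,6,12,14,10],[4]]), (190,33,15,[[0],[2,8,14,12,7,10],[4]]),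
  (190,36,53,[[0],[2,6,4],[8,12,10]]), (190,38,10,[[0],[2,6],[10,12,8,4]]),
  (190,39,23,[[0],[2,6,12,8],[10,4]]), (190,54,49,[[0],[2],[6,5,8,12,10]]),
  (190,66,83,[[0],[2,6,4],[8,12,10]]), (190,69,72,[[0],[2,8,12,10],[6,4]]),
  (190,74,68,[[0],[2,10,12,8],[6,4]]), (190,77,83,[[0],[2,6,4],[8,12,10]]),
  (190,79,73,[[0],[2,6,12,10],[8,4]]), (190,84,104,[[0,6,4],[10,12,8,2]]),
  (190,87,102,[[0,10,12,6,4],[8,2]]), (190,90,102,[[0,6,12,10,4],[8,2]]),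
  (190,90,104,[[0,6,12,8,2],[10,4]]), (190,93,102,[[0],[8,12,10,3,6,4]]),
  (190,98,104,[[0],[10,12,8,4,6,2]]), (190,99,102,[[0],[8,12,10,4,6,2]]),
  (190,100,102,[[0],[8,2,10,12,6,4]]), (190,101,96,[[0],[6,3,8,12,10,4]]),
  (191,6,15,[[0],[2,8,14,12,6,10],[4]]), (191,11,10,[[0],[2,6],[10,12,8,4]]),
  (191,14,40,[[0],[2,10,6],[4,12,14,8]]), (191,18,3,[[0],[2,10,7,12,14,8],[4]]),
  (191,24,49,[[0],[2,8,4],[6,12,10]]), (191,32,3,[[0],[2,10,14,12,7,8],[4]]),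
  (191,33,3,[[0],[2,10,6,12,14,8],[4]]), (191,36,23,[[0],[2,8],[10,12,6,4]]),
  (191,51,53,[[0],[2],[8,5,6,12,10]]), (191,61,82,[[0,8,4],[2],[6,12,10]]),
  (191,66,73,[[0],[2,6,12,10],[8,4]]), (191,69,82,[[0],[2,8,4],[6,12,10]]),
  (191,74,65,[[0],[2,10,12,6],[8,4]]), (191,86,96,[[0,10,12,8,4],[6,2]]),
  (191,86,102,[[0,10,12,6,2],[8,4]]), (191,90,96,[[0,8,2],[6,12,10,4]]),
  (191,94,104,[[0],[10,12,6,2,8,4]]), (191,95,96,[[0],[6,2,8,12,10,4]]),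
  (191,95,102,[[0],[8,3,6,12,10,4]]), (191,99,102,[[0],[8,5,10,12,6,2]]),
  (192,5,15,[[0],[2,8,14,12,7,10],[4]]), (192,14,3,[[0],[2,10,14,8],[4,12,6]]),
  (192,17,3,[[0],[2,10,14,12,7,8],[4]]), (192,24,10,[[0],[2,8,12,6],[10,4]]),
  (192,30,47,[[0],[2,10,4],[6,12,8]]), (192,32,15,[[0],[2,12,7,8,14,10],[4]]),
  (192,33,3,[[0],[2,12,7,10,14,8],[4]]), (192,38,9,[[0],[2,10,12,6],[8,4]]),
  (192,39,47,[[0],[2,10,4],[6,12,8]]), (192,54,49,[[0],[2],[6,12,8,4,10]]),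
  (192,57,60,[[0,6,12,8],[2],[10,4]]), (192,66,65,[[0],[2,6],[8,12,10,4]]),
  (192,69,68,[[0],[2,8],[6,12,10,4]]), (192,74,81,[[0],[2,10,4],[6,12,8]]),
  (192,77,73,[[0],[2,10],[8,12,6,4]]), (192,84,104,[[0,6,12,8,2],[10,4]]),
  (192,86,102,[[0,10,4],[8,12,6,2]]), (192,89,102,[[0,10,4],[8,12,6,2]]),
  (192,90,96,[[0,10,4],[6,12,8,2]]), (192,93,102,[[0],[8,12,6,2,10,4]]),
  (192,95,102,[[0],[8,12,6,2,10,4]]), (192,98,104,[[0],[10,5,8,12,6,2]]),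
  (192,101,96,[[0],[6,12,8,2,10,4]]), (193,2,1,[[0],[2,8],[4,12],[10,14,6]]),
  (193,6,4,[[0],[2,8],[4],[10,14,7,12]]), (193,7,53,[[0],[2,8,14,6],[10,4,12]]),
  (193,8,23,[[0],[2,8,14,5,10],[12,6]]), (193,18,16,[[0],[2,10],[4],[8,14,7,12]]),
  (193,19,23,[[0],[2,10],[12,5,8,14,6]]), (193,19,49,[[0],[2,10,14,6],[8,4,12]]),
  (193,20,10,[[0],[2,10,14,5,8],[12,6]]), (193,32,16,[[0],[2,14,10],[4],[8,6,12]]),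
  (193,33,4,[[0],[2,14,8],[4],[10,6,12]]), (193,34,10,[[0],[2,14,10,5,8],[12,6]]),
  (193,35,49,[[0],[2,14,10,6],[8,4,12]]), (193,58,72,[[0,10,14,6],[2,12],[8,4]]),
  (193,64,83,[[0],[2,8,14,6],[10,4,12]]), (193,67,82,[[0],[2,10,14,6],[8,4,12]]),
  (193,71,72,[[0],[2,12],[8,4,10,14,6]]), (193,71,73,[[0],[2,12],[10,5,8,14,6]]),
  (193,87,85,[[0,10],[6,12,4],[8,2]]), (193,88,85,[[0,12,10],[6,2],[8,4]]),
  (193,95,91,[[0],[6,2,12,8],[10,4]]), (193,98,97,[[0],[6,2],[8,4,12,10]]),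
  (193,101,91,[[0],[6,12,3,8],[10,4]]), (199,1,45,[[0],[2,8,14,10,6],[4,12]]),
  (199,2,14,[[0],[2,8,14,10],[4,12],[6]]), (199,3,4,[[0],[2,6],[4],[8,12,10]]),
  (199,4,15,[[0],[2,8,14,12,7,10],[4]]), (199,6,5,[[0],[2,8],[4],[10,14,12,6]]),
  (199,6,18,[[0],[2,8,14,10],[4],[12,6]]), (199,7,24,[[0],[2,8,14,12,5,10],[6]]),
  (199,7,30,[[0],[2,8,14,10,4,12],[6]]), (199,8,11,[[0],[2,8],[5,10,14,12,6]]),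
  (199,8,39,[[0],[2,8,14,10,4],[12,6]]), (199,8,54,[[0],[2,8,14,12,6],[10,4]]),
  (199,9,10,[[0],[2,6],[10,12,8,4]]), (199,10,9,[[0],[2,6],[8,12,10,4]]),
  (199,11,7,[[0],[2,6],[8,12,10],[4]]), (199,12,49,[[0],[2,6],[4,10,8]]),
  (199,13,40,[[0],[2,8],[4,10,12,6]]), (199,14,2,[[0],[2,10,14,8],[4,12],[6]]),
  (199,15,16,[[0],[2,8],[4],[6,12,10]]), (199,16,3,[[0],[2,10,14,12,7,8],[4]]),
  (199,16,25,[[0],[2,10,14,8,6,12],[4]]), (199,18,6,[[0],[2,10,14,8],[4],[12,6]]),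
  (199,18,17,[[0],[2,10],[4],[8,14,12,6]]), (199,19,11,[[0],[2,10,14,12,5,8],[6]]),
  (199,19,30,[[0],[2,10,14,8,4,12],[6]]), (199,20,39,[[0],[2,10,14,8,4],[12,6]]),
  (199,20,51,[[0],[2,10,14,12,6],[8,4]]), (199,21,23,[[0],[2,8],[10,12,6,4]]),
  (199,22,51,[[0],[2,8],[6,12,10,4]]), (199,23,10,[[0],[2,8,12,6],[10,4]]),
  (199,23,21,[[0],[2,8],[6,12,10,4]]), (199,24,19,[[0],[2,8],[6,12,10],[4]]),
  (199,25,26,[[0],[2,10],[4],[6,12,8]]), (199,26,3,[[0],[2,12,14,10,7,8],[4]]),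
  (199,28,11,[[0],[2,12,14,10,5,8],[6]]), (199,28,24,[[0],[2,12,14,8,4,10],[6]]),
  (199,29,9,[[0],[2,10,12,6],[8,4]]), (199,30,28,[[0],[2,10],[6,12,8],[4]]),
  (199,32,33,[[0],[2],[4],[10,14,8,6,12]]), (199,33,32,[[0],[2],[4],[8,14,10,6,12]]),
  (199,34,36,[[0],[2],[8,4,10,14,12,6]]), (199,34,38,[[0],[2],[10,5,8,14,12,6]]),
  (199,35,36,[[0],[2],[8,4,12,14,10,6]]), (199,36,37,[[0],[2],[6,4],[8,12,10]]),
  (199,37,38,[[0],[2],[10,6,12,14,8,4]]), (199,38,35,[[0],[2],[6,12,10],[8,4]]),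
  (199,39,34,[[0],[2],[6,12,8],[10,4]]), (199,40,41,[[0],[2],[4,6],[8,12,10]]),
  (199,41,45,[[0],[2],[4,8,14,10,6,12]]), (199,43,44,[[0],[2],[4,8],[6,12,10]]),
  (199,44,40,[[0],[2],[4,10,14,12,7,8]]), (199,45,46,[[0],[2],[4,10],[6,12,8]]),
  (199,46,40,[[0],[2],[4,12,14,10,7,8]]), (199,46,43,[[0],[2],[4,12,14,8,6,10]]),
  (199,47,49,[[0],[2],[6,4,8,12,10]]), (199,48,51,[[0],[2],[8,4,10,14,12,6]]),
  (199,48,54,[[0],[2],[10,5,8,14,12,6]]), (199,49,53,[[0],[2],[8,12,6,4,10]]),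
  (199,50,51,[[0],[2],[8,4,12,14,10,6]]), (199,50,55,[[0],[2],[12,5,8,14,10,6]]),
  (199,51,52,[[0],[2],[6,4],[8,12,10]]), (199,52,54,[[0],[2],[10,6,12,14,8,4]]),
  (199,52,55,[[0],[2],[12,7,10,14,8,4]]), (199,53,47,[[0],[2],[6,12,10,5,8]]),
  (199,53,49,[[0],[2],[6,12,8,4,10]]), (199,54,50,[[0],[2],[6,12,10],[8,4]]),
  (199,55,48,[[0],[2],[6,12,8],[10,4]]), (199,56,63,[[0,8,14,10,4,12],[2],[6]]),
  (199,57,56,[[0,6],[2],[8,12,10],[4]]), (199,58,61,[[0,10],[2,12,14,8,4],[6]]),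
  (199,58,74,[[0,10,14,8,4],[2,12],[6]]), (199,59,57,[[0,10,14,12,5,8],[2],[6]]),
  (199,59,63,[[0,10,14,8,4,12],[2],[6]]), (199,61,59,[[0,8],[2],[6,12,10],[4]]),
  (199,62,57,[[0,12,14,10,5,8],[2],[6]]), (199,63,62,[[0,10],[2],[6,12,8],[4]]),
  (199,64,69,[[0],[2,8,14,12,5,10],[6]]), (199,65,73,[[0],[2,6,12,10],[8,4]]),
  (199,66,64,[[0],[2,6],[8,12,10],[4]]), (199,67,66,[[0],[2,10,14,12,5,8],[6]]),
  (199,67,74,[[0],[2,10,14,8,4,12],[6]]), (199,68,72,[[0],[2,8,12,10],[6,4]]),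
  (199,69,67,[[0],[2,8],[6,12,10],[4]]), (199,70,65,[[0],[2,8,10,4],[6]]),
  (199,71,66,[[0],[2,12,14,10,5,8],[6]]), (199,71,69,[[0],[2,12,14,8,4,10],[6]]),
  (199,72,68,[[0],[2,10,12,8],[6,4]]), (199,72,73,[[0],[2,10],[8,12,6,4]]),
  (199,73,72,[[0],[2,10],[6,12,8,4]]), (199,74,71,[[0],[2,10],[6,12,8],[4]]),
  (199,75,79,[[0],[2],[10,5,8,14,12,6]]), (199,76,77,[[0],[2],[8,4,12,14,10,6]]),
  (199,76,80,[[0],[2],[12,5,8,14,10,6]]), (199,77,78,[[0],[2],[6,4],[8,12,10]]),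
  (199,78,79,[[0],[2],[10,6,12,14,8,4]]), (199,78,80,[[0],[2],[12,7,10,14,8,4]]),
  (199,79,76,[[0],[2],[6,12,10],[8,4]]), (199,80,75,[[0],[2],[6,12,8],[10,4]]),
  (199,81,83,[[0],[2],[8,5,6,12,10]]), (199,82,81,[[0],[2],[6,4,10,12,8]]),
  (199,82,83,[[0],[2],[8,12,6,4,10]]), (199,83,82,[[0],[2],[6,12,8,4,10]]),
  (199,85,96,[[0,10,12,8,4],[6,2]]), (199,85,102,[[0,10,12,6,2],[8,4]]),
  (199,86,87,[[0,10],[8,12,6,2],[4]]), (199,87,84,[[0,10,12,6],[8,2],[4]]),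
  (199,87,86,[[0,10],[6,12,8,2],[4]]), (199,88,89,[[0],[6,2],[10,12,8,4]]),
  (199,88,90,[[0],[8,4],[10,12,6,2]]), (199,90,88,[[0],[6,12,10,4],[8,2]]),
  (199,91,96,[[0],[6,2,8,12,10,4]]), (199,91,102,[[0],[8,3,6,12,10,4]]),
  (199,92,96,[[0],[6,2,10,12,8,4]]), (199,93,100,[[0],[8,12,6,2,10],[4]]),
  (199,94,95,[[0],[6,2],[10,12,8,4]]), (199,95,101,[[0],[8,12,6,2],[10,4]]),
  (199,96,97,[[0],[4,2],[6,10,8]]), (199,97,102,[[0],[8,4,10,12,6,2]]),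
  (199,97,104,[[0],[10,5,8,12,6,2]]), (199,98,99,[[0],[6,2],[10,12,8,4]]),
  (199,98,101,[[0],[8,4],[10,12,6,2]]), (199,99,103,[[0],[8,12,6,2],[10,4]]),
  (199,100,93,[[0],[6,12,8,2,10],[4]]), (199,101,95,[[0],[6,12,8,2],[10,4]]),
  (199,101,98,[[0],[6,12,10,4],[8,2]]), (199,102,92,[[0],[4,10,8],[6,2]]),
  (199,103,94,[[0],[6,12,10,4],[8,2]]), (199,103,99,[[0],[6,12,8,2],[10,4]]),
  (199,104,91,[[0],[4,10,6],[8,2]]), (204,25,15,[[0],[2,10,16,12,6,14,8],[4]]),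
  (204,102,104,[[0],[8,14,10,4,12,6,2]]), (205,25,15,[[0],[2,10,16,6,12,14,8],[4]]),
  (205,102,104,[[0],[8,14,4,10,12,6,2]]), (213,25,3,[[0],[2,10,16,14,8,12,6],[4]]),
  (213,96,104,[[0],[8,14,12,6,10,4,2]]), (215,40,45,[[0],[2],[4,6,12,14,8,16,10]]),
  (215,96,104,[[0],[8,14,6,12,10,4,2]]), (223,40,43,[[0],[2],[4,6,12,10,16,14,8]]),
  (223,102,96,[[0],[4,10,8,14,12,6,2]]), (224,43,40,[[0],[2],[4,8,14,10,16,12,6]]),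
  (224,96,102,[[0],[6,12,8,14,10,4,2]]), (239,3,33,[[0],[2,6,12],[4],[8,14,16,10]]),
  (239,4,5,[[0],[2,8],[4],[10,6,12,18,16,14]]), (239,4,6,[[0],[2,8],[4],[12,7,10,16,18,14]]),
  (239,10,8,[[0],[2,6],[8,14,16,12],[10,4]]), (239,16,32,[[0],[2,10,16,18,14],[4],[8,6,12]]),
  (239,72,69,[[0],[2,10,16,14,8],[12,6,4]]), (239,97,98,[[0],[6,2],[8,4,10,16,14,12]]),
  (249,4,33,[[0],[2,8,14,18,16],[4],[10,6,12]]), (249,16,18,[[0],[2,10],[4],[12,7,8,14,18,16]]),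
  (249,21,39,[[0],[2,8,14],[10,16,12,6,4]]), (249,23,20,[[0],[2,8],[6,12,16,14],[10,4]]),
  (249,92,94,[[0],[6,2,10,16,12,14],[8,4]]), (249,96,101,[[0],[6,12],[8,14,10,4,2]]),
  (249,97,98,[[0],[6,2],[8,4,10,16,12,14]]), (249,102,93,[[0],[4,10,14,8],[12,6,2]]),
  (259,3,18,[[0],[2,6,12,14,8],[4],[10,16]]), (259,4,33,[[0],[2,8,14,16,18],[4],[10,6,12]]),
  (259,10,8,[[0],[2,6],[8,14,12,16],[10,4]]), (259,16,32,[[0],[2,10,16,14,18],[4],[8,6,12]]),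
  (259,23,11,[[0],[2,8,14,12,6],[16,10,4]]), (259,92,93,[[0],[6,2,10],[16,12,14,8,4]]),
  (293,8,9,[[0],[2,8],[10,4,14,16,18,12,6]]), (293,11,53,[[0],[2,6,12,4],[8,14,16,10]]),
  (293,17,16,[[0],[2,10],[4],[8,6,14,16,18,12]]), (293,19,49,[[0],[2,10,16,18,14,6],[8,4,12]]),
  (293,20,21,[[0],[2,10],[8,4,14,16,18,12,6]]), (293,27,26,[[0],[2,12],[4],[8,6,14,18,16,10]]),
  (293,39,9,[[0],[2,12,6],[8,14,16,10,4]]), (293,66,83,[[0],[2,6,12,4],[8,14,16,10]]),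
  (293,71,72,[[0],[2,12],[8,4,10,16,18,14,6]]), (293,74,68,[[0],[2,10,16,14,8],[6,12,4]]),
  (293,76,82,[[0],[2,14,18,16,10,6],[8,4,12]]), (293,84,104,[[0,6,12,4],[10,16,14,8,2]]),
  (293,95,91,[[0],[6,2,12,16,14,8],[10,4]]), (293,98,97,[[0],[6,2],[8,4,12,14,16,10]]),
  (293,98,104,[[0],[10,16,14,8,4,12,6,2]]), (293,99,102,[[0],[8,14,16,10,4,12,6,2]]),
  (294,5,4,[[0],[2,8],[4],[10,6,16,14,18,12]]), (294,6,15,[[0],[2,8,14,18,12,6,16,10],[4]]),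
  (294,7,53,[[0],[2,8,14,18,16,6],[10,4,12]]), (294,8,23,[[0],[2,8,14,18,16,5,10],[12,6]]),
  (294,11,29,[[0],[2,6,12,16,10],[8,14,4]]), (294,17,16,[[0],[2,10],[4],[8,6,16,14,18,12]]),
  (294,34,47,[[0],[2,16,14,18,12,6],[8,4,10]]), (294,42,41,[[0],[2],[4,8],[10,6,16,14,18,12]]),
  (294,48,53,[[0],[2],[10,5,8,14,18,16,7,12]]), (294,51,53,[[0],[2],[8,14,5,6,12,16,10]]),
  (294,61,82,[[0,8,14,4],[2],[6,12,16,10]]), (294,69,82,[[0],[2,8,14,4],[6,12,16,10]]),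
  (294,71,81,[[0],[2,12,18,14,16,6],[8,4,10]]), (294,86,102,[[0,10,16,12,6,2],[8,14,4]]),
  (294,94,104,[[0],[10,16,12,6,2,14,8,4]]), (294,101,91,[[0],[6,12,16,14,3,8],[10,4]]),
  (294,103,92,[[0],[6,12,16,14,5,10],[8,2]]), (295,2,1,[[0],[2,8],[4,12],[10,16,14,18,6]]),
  (295,6,4,[[0],[2,8],[4],[10,16,14,18,7,12]]), (295,8,23,[[0],[2,8,14,16,18,5,10],[12,6]]),
  (295,18,16,[[0],[2,10],[4],[8,14,16,18,7,12]]), (295,19,49,[[0],[2,10,16,14,18,6],[8,4,12]]),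
  (295,32,16,[[0],[2,18,14,16,10],[4],[8,6,12]]), (295,39,47,[[0],[2,16,10,4],[6,12,14,8]]),
  (295,51,53,[[0],[2],[8,14,12,6,4,16,10]]), (295,71,72,[[0],[2,12],[8,4,10,16,14,18,6]]),
  (295,76,82,[[0],[2,18,14,16,10,6],[8,4,12]]), (295,86,102,[[0,10,16,4],[8,14,12,6,2]]),
  (295,87,85,[[0,10],[6,12,14,16,4],[8,2]]), (295,98,104,[[0],[10,16,5,8,14,12,6,2]]),
  (295,101,96,[[0],[6,12,14,8,2,16,10,4]]), (295,103,92,[[0],[6,12,14,16,5,10],[8,2]])]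

/-- Configurations all of whose paths can be joined to a single one by the links that close the
cyclic arrangement of slices. -/
def closings : List (ℕ × List ℕ) := [
  (1,[7,4,2,0]), (4,[5,6,2,0]), (10,[5,2,0]), (16,[1,6,2,4]), (41,[1,5,6,2]), (46,[1,6,4,2]),
  (49,[1,4,2]), (60,[5,0,2]), (73,[5,2,0]), (83,[3,4,0]), (102,[3,0])]


/-- Replaces the centre of a claw in a path of pieces by the path through the vertices of a
triangle; `n` is the number of fragments before the claw was added. -/
def expandPath (n : ℕ) : List ℕ → List ℕ
  | a :: d :: b :: l =>
    if d == 2 * (n + 3) then a :: (a + 6) :: (6 * n + 12 - a - b) :: (b + 6) :: b :: l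
    else a :: expandPath n (d :: b :: l)
  | l => l

/-- The configuration number `s`. -/
def configuration (s : ℕ) : List (ℕ × ℕ) := configs.getD s []

theorem transfers_ok : (transfers.all fun e =>
    stepOk e.1 (configuration e.2.1) (configuration e.2.2.1) e.2.2.2 &&
      (e.1 / 100 != 1 || e.1 / 10 % 10 == 3 || e.1 % 10 == 3 ||
        stepOk (e.1 + 100) (configuration e.2.1) (configuration e.2.2.1)
          (e.2.2.2.map (expandPath (configuration e.2.1).length)))) = true := by
  decide +kernel

theorem closings_ok : (closings.all fun e =>
    recipeOk (fun x y => closeCompatible x y || closeCompatible y x) (fun _ y => y == 0)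
      (configuration e.1) [(0, 0)] [e.2]) = true := by
  decide +kernel

end Transfers

section Coverage

/-- The configurations that can be reached by a slice with code `c` from a configuration in `M`;
sets of configurations are encoded as bit masks. -/
def stepMask (c M : ℕ) : ℕ :=
  transfers.foldl (fun acc e =>
    if e.1 == c && M.testBit e.2.1 then acc ||| 2 ^ e.2.2.1 else acc) 0

/-- The configurations from which a configuration in `M` is reached by a slice with code `c`. -/
def backMask (c M : ℕ) : ℕ :=
  transfers.foldl (fun acc e =>
    if e.1 == c && M.testBit e.2.2.1 then acc ||| 2 ^ e.2.1 else acc) 0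

/-- The configurations that can be closed. -/
def closeMask : ℕ := closings.foldl (fun acc e => acc ||| 2 ^ e.1) 0

/-- Evaluates `n` before it is passed to `f`. -/
def force (n : ℕ) (f : ℕ → Bool) : Bool :=
  match n with
  | 0 => f 0
  | m + 1 => f (m + 1)

theorem force_eq (n : ℕ) (f : ℕ → Bool) : force n f = f n := by
  cases n <;> rfl

/-- Passes the list `[M, f M, …, f^[n] M]` of evaluated masks to `K`. -/
def forceOrbit (f : ℕ → ℕ) : ℕ → ℕ → (List ℕ → Bool) → Bool
  | 0, M, K => force M fun M => K [M]
  | n + 1, M, K => force M fun M => forceOrbit f n (f M) fun L => K (M :: L)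

theorem forceOrbit_eq (f : ℕ → ℕ) (n M : ℕ) (K : List ℕ → Bool) :
    forceOrbit f n M K = K ((List.range (n + 1)).map fun i => f^[i] M) := by
  induction n generalizing M K with
  | zero => simp [forceOrbit, force_eq]
  | succ n ih =>
    rw [forceOrbit, force_eq, ih, List.range_succ_eq_map]
    simp [Function.comp_def]

/-- Passes the list of the evaluated masks to `K`. -/
def forceList : List ℕ → (List ℕ → Bool) → Bool
  | [], K => K []
  | M :: L, K => force M fun M => forceList L fun L => K (M :: L)

theorem forceList_eq (L : List ℕ) (K : List ℕ → Bool) : forceList L K = K L := by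
  induction L generalizing K with
  | nil => rfl
  | cons M L ih => rw [forceList, force_eq, ih]

/-- The configurations in front of slice number `i` when no vertex has been marked. -/
def startMask : ℕ → ℕ
  | 0 => 1
  | i + 1 => (stepMask 199)^[i] (stepMask 99 1)

/-- The configurations from which `m` unmarked slices lead to one that can be closed. -/
def endMask (m : ℕ) : ℕ := (backMask 199)^[m] closeMask

/-- The codes of a slice number `i` containing the vertex `u` only. -/
def firstCodes (i : ℕ) : List ℕ :=
  if i = 0 then [9, 19, 29, 39, 49, 59]
  else [109, 119, 129, 139] ++ if 2 ≤ i ∧ i ≤ 4 then [239, 249, 259] else []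

/-- The codes of a slice number `i` containing the vertex `v` only. -/
def secondCodes : List ℕ := [190, 191, 192, 193, 293, 294, 295]

/-- The codes of a slice number `i` containing both vertices `u` and `v`. -/
def pairCodes (i : ℕ) : List ℕ :=
  if i = 0 then [1, 2, 12, 15, 25, 5, 14, 24, 34, 45]
  else [101, 102, 112] ++ if 2 ≤ i ∧ i ≤ 4 then [204, 205, 213, 215, 223, 224] else []

/-- The combination of a slice number `i` with code `c`, a slice number `j = i + g + 1` with code
`d`, and `m` further slices need not be considered. -/
def isExcluded (i c g d m : ℕ) : Bool :=
  (i + g + m) % 2 == 0 || (decide (i < 5) && decide (g < 4) && decide (m < 4)) ||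
  (decide (293 ≤ d) && (decide (m < 4) || decide (i + g + 1 < 2) || decide (4 < i + g + 1))) ||
  (g == 0 && c / 10 % 10 == d % 10 && decide (d % 10 < 3)) ||
  (i == 0 && m == 0 && decide (d % 10 < 3) && twist (c / 10 % 10) == d % 10)

theorem pairCodes_cover : ((List.range 7).all fun i => (pairCodes i).all fun c =>
    (List.range 6).all fun m => (i + m) % 2 == 1 || (decide (i < 5) && decide (m < 4)) ||
      (decide (200 ≤ c) && decide (m < 4)) ||
      stepMask c (startMask i) &&& endMask m != 0) = true := by
  decide +kernel

theorem firstCodes_cover :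
    (forceOrbit (backMask 199) 5 closeMask fun Z =>
      forceList (secondCodes.flatMap fun d => Z.map (backMask d)) fun W =>
      (List.range 7).all fun i => (firstCodes i).all fun c =>
      forceOrbit (stepMask 199) 6 (stepMask c (startMask i)) fun X =>
        X.getD 4 0 &&& X.getD 6 0 == X.getD 4 0 &&
        (List.range 7).all fun e => (List.range 6).all fun g => (List.range 6).all fun m =>
          isExcluded i c g (secondCodes.getD e 0) m || X.getD g 0 &&& W.getD (6 * e + m) 0 != 0) =
      true := by
  decide +kernel

end Coverage

section Soundness

/-- Inclusion of sets encoded as bit masks. -/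
def MaskLE (M N : ℕ) : Prop := ∀ s, M.testBit s = true → N.testBit s = true

theorem maskLE_of_and_eq {M N : ℕ} (h : M &&& N = M) : MaskLE M N := by
  intro s hs
  rw [← h, Nat.testBit_and, Bool.and_eq_true] at hs
  exact hs.2

theorem endMask_mono : MaskLE ((backMask 199)^[4] closeMask) ((backMask 199)^[6] closeMask) :=
  maskLE_of_and_eq (by decide +kernel)

theorem startMask_mono :
    MaskLE ((stepMask 199)^[4] (stepMask 99 1)) ((stepMask 199)^[6] (stepMask 99 1)) :=
  maskLE_of_and_eq (by decide +kernel)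

theorem testBit_foldl {α : Type*} (p : α → Bool) (f : α → ℕ) (L : List α) (M s : ℕ) :
    (L.foldl (fun acc e => if p e then acc ||| 2 ^ f e else acc) M).testBit s = true ↔
      M.testBit s = true ∨ ∃ e ∈ L, p e = true ∧ f e = s := by
  induction L generalizing M with
  | nil => simp
  | cons e L ih =>
    rw [List.foldl_cons, ih]
    by_cases h : p e = true
    · simp [h, Nat.testBit_or, Nat.testBit_two_pow, or_assoc]
    · simp [h]

theorem testBit_stepMask {c M t : ℕ} : (stepMask c M).testBit t = true ↔
    ∃ e ∈ transfers, (e.1 = c ∧ M.testBit e.2.1 = true) ∧ e.2.2.1 = t := by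
  rw [stepMask, testBit_foldl
    (fun e : ℕ × ℕ × ℕ × List (List ℕ) => e.1 == c && M.testBit e.2.1) fun e => e.2.2.1]
  simp

theorem testBit_backMask {c M s : ℕ} : (backMask c M).testBit s = true ↔
    ∃ e ∈ transfers, (e.1 = c ∧ M.testBit e.2.2.1 = true) ∧ e.2.1 = s := by
  rw [backMask, testBit_foldl
    (fun e : ℕ × ℕ × ℕ × List (List ℕ) => e.1 == c && M.testBit e.2.2.1) fun e => e.2.1]
  simp

theorem testBit_closeMask {s : ℕ} : closeMask.testBit s = true ↔ ∃ e ∈ closings, e.1 = s := by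
  have h := testBit_foldl (fun _ : ℕ × List ℕ => true) (fun e => e.1) closings 0 s
  simp only [if_true, Nat.zero_testBit, Bool.false_eq_true, false_or, true_and] at h
  exact h

theorem stepMask_mono {c M N : ℕ} (h : MaskLE M N) : MaskLE (stepMask c M) (stepMask c N) := by
  intro s hs
  rw [testBit_stepMask] at hs ⊢
  obtain ⟨e, h1, h2, h3⟩ := hs
  exact ⟨e, h1, ⟨h2.1, h _ h2.2⟩, h3⟩

theorem backMask_mono {c M N : ℕ} (h : MaskLE M N) : MaskLE (backMask c M) (backMask c N) := by
  intro s hs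
  rw [testBit_backMask] at hs ⊢
  obtain ⟨e, h1, h2, h3⟩ := hs
  exact ⟨e, h1, ⟨h2.1, h _ h2.2⟩, h3⟩

/-- The number of at most `5` with the parity of `m` that represents `m`. -/
def reduced (m : ℕ) : ℕ := if m ≤ 5 then m else 4 + m % 2

theorem maskLE_iterate_reduced {f : ℕ → ℕ} (hf : ∀ M N, MaskLE M N → MaskLE (f M) (f N)) {M : ℕ}
    (h : MaskLE (f^[4] M) (f^[6] M)) (m : ℕ) : MaskLE (f^[reduced m] M) (f^[m] M) := by
  have step : ∀ m, MaskLE (f^[m + 4] M) (f^[m + 6] M) := by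
    intro m
    induction m with
    | zero => exact h
    | succ m ih =>
      have := hf _ _ ih
      rwa [← Function.iterate_succ_apply' f, ← Function.iterate_succ_apply' f] at this
  induction m using Nat.strong_induction_on with
  | _ m ih =>
    rcases Nat.lt_or_ge m 6 with hm | hm
    · rw [reduced, if_pos (by omega)]
      exact fun _ hs => hs
    · obtain ⟨m, rfl⟩ := Nat.exists_eq_add_of_le' hm
      have h1 : reduced (m + 6) = reduced (m + 4) := by
        unfold reduced
        split_ifs <;> omega
      rw [h1]
      exact fun s hs => step m s (ih (m + 4) (by omega) s hs)

variable {E : ℕ × ℕ → ℕ × ℕ → Prop} {τ : ℕ → ℕ} {k : ℕ} {u v : ℕ × ℕ}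

/-- There is a Hamiltonian path with respect to `E`. -/
def IsSpanned (E : ℕ × ℕ → ℕ × ℕ → Prop) (τ : ℕ → ℕ) (k : ℕ) : Prop :=
  ∃ l : List (ℕ × ℕ), l.IsChain E ∧ l.Perm (verts τ k)

/-- The relation `E` contains the edges of the arrangement of `k` slices of types `τ` and the edge
between `u` and `v`. -/
structure Spans (E : ℕ × ℕ → ℕ × ℕ → Prop) (τ : ℕ → ℕ) (k : ℕ) (u v : ℕ × ℕ) : Prop where
  symm : ∀ p q, E p q → E q p
  link : ∀ p q, Link τ k p q → E p q
  edge : E u v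
  root : τ 0 = 0
  type : ∀ i, 1 ≤ i → τ i = 1 ∨ (τ i = 2 ∧ 2 ≤ i ∧ i ≤ 4)

/-- The code `c` describes the slice number `i`. -/
def IsCode (τ : ℕ → ℕ) (u v : ℕ × ℕ) (i c : ℕ) : Prop :=
  (τ i = c / 100 ∨ (c / 100 = 1 ∧ τ i = 2 ∧ c / 10 % 10 ≠ 3 ∧ c % 10 ≠ 3)) ∧
    (c / 10 % 10 ≠ 9 → u = (i, c / 10 % 10)) ∧ (c % 10 ≠ 9 → v = (i, c % 10))

theorem Spans.realized_of_transfer (h : Spans E τ k u v) {i c : ℕ} (hc : IsCode τ u v i c)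
    {e : ℕ × ℕ × ℕ × List (List ℕ)} (he : e ∈ transfers) (hec : e.1 = c)
    (hs : Realized E τ u i (configuration e.2.1)) :
    Realized E τ u (i + 1) (configuration e.2.2.1) := by
  have h0 : ∀ i, τ i = 0 → i = 0 := by
    intro i hi
    by_contra h1
    have := h.type i (by omega)
    omega
  have hok := List.all_eq_true.1 transfers_ok e he
  simp only [Bool.and_eq_true, Bool.or_eq_true, bne_iff_ne, beq_iff_eq] at hok
  subst hec
  obtain ⟨h1 | ⟨h1, h2, h3, h4⟩, hu, hv⟩ := hc
  · exact hs.step_of_type h.symm h.link h.edge h0 h1.symm hu hv hok.1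
  · rcases hok.2 with ((h5 | h5) | h5) | h5
    · exact (h5 h1).elim
    · exact (h3 h5).elim
    · exact (h4 h5).elim
    · refine hs.step_of_type h.symm h.link h.edge h0 ?_ ?_ ?_ h5
      · omega
      · rwa [show (e.1 + 100) / 10 % 10 = e.1 / 10 % 10 by omega]
      · rwa [show (e.1 + 100) % 10 = e.1 % 10 by omega]

/-- All configurations in `M` are realized in front of slice number `i`. -/
def IsReached (E : ℕ × ℕ → ℕ × ℕ → Prop) (τ : ℕ → ℕ) (u : ℕ × ℕ) (i M : ℕ) : Prop :=
  ∀ s, M.testBit s = true → Realized E τ u i (configuration s)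

/-- All configurations in `M` that are realized in front of slice number `i` extend to a
Hamiltonian path. -/
def IsWinning (E : ℕ × ℕ → ℕ × ℕ → Prop) (τ : ℕ → ℕ) (k : ℕ) (u : ℕ × ℕ) (i M : ℕ) : Prop :=
  ∀ s, M.testBit s = true → Realized E τ u i (configuration s) → IsSpanned E τ k

theorem IsReached.mono {i M N : ℕ} (h : IsReached E τ u i N) (hM : MaskLE M N) :
    IsReached E τ u i M := fun s hs => h s (hM s hs)

theorem IsWinning.mono {i M N : ℕ} (h : IsWinning E τ k u i N) (hM : MaskLE M N) :
    IsWinning E τ k u i M := fun s hs => h s (hM s hs)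

theorem IsReached.isSpanned {i M N : ℕ} (hM : IsReached E τ u i M) (hN : IsWinning E τ k u i N)
    (h : M &&& N ≠ 0) : IsSpanned E τ k := by
  obtain ⟨s, hs⟩ := Nat.exists_testBit_of_ne_zero h
  rw [Nat.testBit_and, Bool.and_eq_true] at hs
  exact hN s hs.2 (hM s hs.1)

theorem isReached_one : IsReached E τ u 0 1 := by
  intro s hs
  obtain rfl : s = 0 := by simpa [Nat.testBit_one_eq_true_iff_self_eq_zero] using hs
  exact ⟨[], .nil, by simp [verts]⟩

theorem Spans.isReached_succ (h : Spans E τ k u v) {i c M : ℕ} (hc : IsCode τ u v i c)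
    (hM : IsReached E τ u i M) : IsReached E τ u (i + 1) (stepMask c M) := by
  intro s hs
  obtain ⟨e, he, ⟨h1, h2⟩, rfl⟩ := testBit_stepMask.1 hs
  exact h.realized_of_transfer hc he h1 (hM _ h2)

theorem Spans.isWinning_of_succ (h : Spans E τ k u v) {i c M : ℕ} (hc : IsCode τ u v i c)
    (hM : IsWinning E τ k u (i + 1) M) : IsWinning E τ k u i (backMask c M) := by
  intro s hs hr
  obtain ⟨e, he, ⟨h1, h2⟩, rfl⟩ := testBit_backMask.1 hs
  exact hM _ h2 (h.realized_of_transfer hc he h1 hr)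

theorem Spans.isCode_unmarked (h : Spans E τ k u v) {i : ℕ} (hi : 1 ≤ i) : IsCode τ u v i 199 := by
  refine ⟨?_, fun h => (h rfl).elim, fun h => (h rfl).elim⟩
  have := h.type i hi
  norm_num
  omega

theorem Spans.isReached_iterate (h : Spans E τ k u v) {i M : ℕ} (hi : 1 ≤ i)
    (hM : IsReached E τ u i M) (m : ℕ) : IsReached E τ u (i + m) ((stepMask 199)^[m] M) := by
  induction m with
  | zero => exact hM
  | succ m ih =>
    rw [Function.iterate_succ_apply', ← add_assoc]
    exact h.isReached_succ (h.isCode_unmarked (by omega)) ih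

theorem Spans.isWinning_closeMask (h : Spans E τ k u v) : IsWinning E τ k u k closeMask := by
  intro s hs hr
  obtain ⟨e, he, rfl⟩ := testBit_closeMask.1 hs
  exact hr.close h.symm h.link (List.all_eq_true.1 closings_ok e he)

theorem Spans.isWinning_endMask (h : Spans E τ k u v) {i m : ℕ} (hi : 1 ≤ i) (hk : i + m = k) :
    IsWinning E τ k u i (endMask (reduced m)) := by
  have h1 : IsWinning E τ k u i (endMask m) := by
    induction m generalizing i with
    | zero => subst hk; exact h.isWinning_closeMask
    | succ m ih =>
      rw [endMask, Function.iterate_succ_apply']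
      exact h.isWinning_of_succ (h.isCode_unmarked hi) (ih (by omega) (by omega))
  exact h1.mono (maskLE_iterate_reduced (fun _ _ => backMask_mono) endMask_mono m)

/-- The number of at most `6` that represents the slice number `i`. -/
def reducedIndex : ℕ → ℕ
  | 0 => 0
  | i + 1 => reduced i + 1

theorem Spans.isReached_startMask (h : Spans E τ k u v) (i : ℕ) :
    IsReached E τ u i (startMask (reducedIndex i)) := by
  cases i with
  | zero => exact isReached_one
  | succ i =>
    have h1 : IsReached E τ u 1 (stepMask 99 1) :=
      h.isReached_succ (i := 0) ⟨.inl h.root, fun h => (h rfl).elim, fun h => (h rfl).elim⟩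
        isReached_one
    have h2 := h.isReached_iterate le_rfl h1 i
    rw [add_comm] at h2
    exact h2.mono (maskLE_iterate_reduced (fun _ _ => stepMask_mono) startMask_mono i)

end Soundness

section Spanned

theorem twist_twist : ∀ j, twist (twist j) = j
  | 0 => rfl
  | 1 => rfl
  | 2 => rfl
  | _ + 3 => rfl

theorem getD_flatMap_map (L : List ℕ) (f : ℕ → ℕ) (h : ℕ → ℕ → ℕ) {e m : ℕ} (he : e < L.length)
    (hm : m < 6) :
    (L.flatMap fun d => ((List.range 6).map f).map (h d)).getD (6 * e + m) 0 =
      h (L.getD e 0) (f m) := by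
  induction L generalizing e with
  | nil => simp at he
  | cons d L ih =>
    cases e with
    | zero =>
      rw [List.flatMap_cons, List.getD_append _ _ _ _ (by simpa using hm)]
      simp [List.getD_eq_getElem?_getD, hm]
    | succ e =>
      rw [List.flatMap_cons, List.getD_append_right _ _ _ _ (by simp; omega)]
      rw [show 6 * (e + 1) + m - (List.map (h d) (List.map f (List.range 6))).length = 6 * e + m by
        simp; omega]
      simpa using ih (by simpa using he)

theorem getD_map_range (f : ℕ → ℕ) {n g : ℕ} (hg : g < n) :
    ((List.range n).map f).getD g 0 = f g := by
  simp [List.getD_eq_getElem?_getD, hg]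

theorem firstCodes_spec {i c : ℕ} (hi : i < 7) (hc : c ∈ firstCodes i) :
    MaskLE ((stepMask 199)^[4] (stepMask c (startMask i)))
        ((stepMask 199)^[6] (stepMask c (startMask i))) ∧
      ∀ d ∈ secondCodes, ∀ g < 6, ∀ m < 6, isExcluded i c g d m = false →
        (stepMask 199)^[g] (stepMask c (startMask i)) &&& backMask d (endMask m) ≠ 0 := by
  have h := firstCodes_cover
  rw [forceOrbit_eq, forceList_eq, List.all_eq_true] at h
  have h1 := List.all_eq_true.1 (h i (List.mem_range.2 hi)) c hc
  rw [forceOrbit_eq, Bool.and_eq_true, beq_iff_eq] at h1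
  rw [getD_map_range _ (by norm_num), getD_map_range _ (by norm_num)] at h1
  refine ⟨maskLE_of_and_eq h1.1, fun d hd g hg m hm hex => ?_⟩
  obtain ⟨e, he, rfl⟩ := List.getElem_of_mem hd
  have h2 := List.all_eq_true.1
    (List.all_eq_true.1 (List.all_eq_true.1 h1.2 e (List.mem_range.2 he))
    g (List.mem_range.2 hg)) m (List.mem_range.2 hm)
  rw [getD_map_range _ (by omega), getD_flatMap_map _ _ _ he hm, List.getD_eq_getElem _ _ he, hex,
    Bool.false_or, bne_iff_ne] at h2
  exact h2

theorem pairCodes_spec {i c m : ℕ} (hi : i < 7) (hc : c ∈ pairCodes i) (hm : m < 6)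
    (h1 : (i + m) % 2 = 0) (h2 : 5 ≤ i ∨ 4 ≤ m) (h3 : 200 ≤ c → 4 ≤ m) :
    stepMask c (startMask i) &&& endMask m ≠ 0 := by
  have h := List.all_eq_true.1 (List.all_eq_true.1 (List.all_eq_true.1 pairCodes_cover i
    (List.mem_range.2 hi)) c hc) m (List.mem_range.2 hm)
  simp only [Bool.or_eq_true, Bool.and_eq_true, decide_eq_true_eq, beq_iff_eq, bne_iff_ne] at h
  rcases h with ((h | h) | h) | h
  · omega
  · omega
  · omega
  · exact h

theorem reduced_spec (m : ℕ) : reduced m % 2 = m % 2 ∧ reduced m < 6 ∧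
    (reduced m = m ∨ (4 ≤ reduced m ∧ 6 ≤ m)) := by
  unfold reduced
  split_ifs <;> omega

theorem reducedIndex_spec (i : ℕ) : reducedIndex i % 2 = i % 2 ∧ reducedIndex i < 7 ∧
    (reducedIndex i = i ∨ (5 ≤ reducedIndex i ∧ 7 ≤ i)) ∧ (reducedIndex i = 0 ↔ i = 0) := by
  cases i with
  | zero => simp [reducedIndex]
  | succ i =>
    have := reduced_spec i
    simp only [reducedIndex]
    omega

variable {E : ℕ × ℕ → ℕ × ℕ → Prop} {τ : ℕ → ℕ} {k : ℕ} {u v : ℕ × ℕ}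

theorem exists_mem_firstCodes (h : Spans E τ k u v) {i j : ℕ} (hj : j < sliceSize (τ i)) :
    ∃ c ∈ firstCodes (reducedIndex i), c / 10 % 10 = j ∧ c % 10 = 9 ∧
      (τ i = c / 100 ∨ (c / 100 = 1 ∧ τ i = 2 ∧ c / 10 % 10 ≠ 3 ∧ c % 10 ≠ 3)) := by
  rcases Nat.eq_zero_or_pos i with rfl | hi
  · rw [h.root] at hj ⊢
    refine ⟨10 * j + 9, ?_, by simp [sliceSize] at hj; omega, by omega, .inl ?_⟩
    · simp only [sliceSize] at hj
      interval_cases j <;> decide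
    · simp only [sliceSize] at hj
      omega
  · have hr := reducedIndex_spec i
    rcases h.type i hi with ht | ⟨ht, h2, h3⟩
    · rw [ht] at hj ⊢
      simp only [sliceSize] at hj
      refine ⟨100 + (10 * j + 9), ?_, by omega, by omega, .inl (by omega)⟩
      rw [firstCodes, if_neg (by omega), List.mem_append]
      left
      interval_cases j <;> decide
    · rw [ht] at hj ⊢
      simp only [sliceSize] at hj
      by_cases hj3 : j < 3
      · refine ⟨100 + (10 * j + 9), ?_, by omega, by omega, .inr (by omega)⟩
        rw [firstCodes, if_neg (by omega), List.mem_append]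
        left
        interval_cases j <;> decide
      · refine ⟨200 + (10 * j + 9), ?_, by omega, by omega, .inl (by omega)⟩
        rw [firstCodes, if_neg (by omega), if_pos (by omega), List.mem_append]
        right
        interval_cases j <;> simp_all

theorem exists_mem_secondCodes (h : Spans E τ k u v) {i j : ℕ} (hi : 1 ≤ i)
    (hj : j < sliceSize (τ i)) :
    ∃ d ∈ secondCodes, d / 10 % 10 = 9 ∧ d % 10 = j ∧ (293 ≤ d → 2 ≤ i ∧ i ≤ 4) ∧
      (τ i = d / 100 ∨ (d / 100 = 1 ∧ τ i = 2 ∧ d / 10 % 10 ≠ 3 ∧ d % 10 ≠ 3)) := by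
  rcases h.type i hi with ht | ⟨ht, h2, h3⟩
  · rw [ht] at hj ⊢
    simp only [sliceSize] at hj
    refine ⟨190 + j, ?_, by omega, by omega, by omega, .inl (by omega)⟩
    interval_cases j <;> decide
  · rw [ht] at hj ⊢
    simp only [sliceSize] at hj
    by_cases hj3 : j < 3
    · refine ⟨190 + j, ?_, by omega, by omega, by omega, .inr (by omega)⟩
      interval_cases j <;> decide
    · refine ⟨290 + j, ?_, by omega, by omega, by omega, .inl (by omega)⟩
      interval_cases j <;> simp_all [secondCodes]

theorem exists_mem_pairCodes (h : Spans E τ k u v) {i a b : ℕ} (hab : a < b)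
    (hb : b < sliceSize (τ i)) (hn : (a, b) ∉ innerEdges (τ i)) :
    ∃ c ∈ pairCodes (reducedIndex i), c / 10 % 10 = a ∧ c % 10 = b ∧
      (200 ≤ c → i ≤ 4) ∧
      (τ i = c / 100 ∨ (c / 100 = 1 ∧ τ i = 2 ∧ c / 10 % 10 ≠ 3 ∧ c % 10 ≠ 3)) := by
  rcases Nat.eq_zero_or_pos i with rfl | hi
  · rw [h.root] at hb hn ⊢
    simp only [sliceSize] at hb
    refine ⟨10 * a + b, ?_, by omega, by omega, by omega, .inl (by omega)⟩
    interval_cases b <;> interval_cases a <;> revert hn <;> decide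
  · have hr := reducedIndex_spec i
    rcases h.type i hi with ht | ⟨ht, h2, h3⟩
    · rw [ht] at hb hn ⊢
      simp only [sliceSize] at hb
      refine ⟨100 + (10 * a + b), ?_, by omega, by omega, by omega, .inl (by omega)⟩
      rw [pairCodes, if_neg (by omega), List.mem_append]
      left
      interval_cases b <;> interval_cases a <;> revert hn <;> decide
    · rw [ht] at hb hn ⊢
      simp only [sliceSize] at hb
      by_cases hb3 : b < 3
      · refine ⟨100 + (10 * a + b), ?_, by omega, by omega, by omega, .inr (by omega)⟩
        rw [pairCodes, if_neg (by omega), List.mem_append]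
        left
        interval_cases b <;> interval_cases a <;> decide
      · refine ⟨200 + (10 * a + b), ?_, by omega, by omega, by omega, .inl (by omega)⟩
        rw [pairCodes, if_neg (by omega), if_pos (by omega), List.mem_append]
        right
        interval_cases b <;> interval_cases a <;> revert hn <;> decide

theorem Spans.isSpanned_of_same (h : Spans E τ k u v) (hk : k % 2 = 1) (hk13 : 13 ≤ k) {i a b : ℕ}
    (hu : u = (i, a)) (hv : v = (i, b)) (hi : i < k) (hab : a < b) (hb : b < sliceSize (τ i))
    (hn : (a, b) ∉ innerEdges (τ i)) : IsSpanned E τ k := by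
  obtain ⟨c, hc, h1, h2, h3, h4⟩ := exists_mem_pairCodes h hab hb hn
  obtain ⟨m, hm⟩ := Nat.exists_eq_add_of_le (show i + 1 ≤ k from hi)
  have r1 := reducedIndex_spec i
  have r2 := reduced_spec m
  have hcode : IsCode τ u v i c := ⟨h4, fun _ => h1 ▸ hu, fun _ => h2 ▸ hv⟩
  exact (h.isReached_succ hcode (h.isReached_startMask i)).isSpanned
    (h.isWinning_endMask (by omega) hm.symm)
    (pairCodes_spec (by omega) hc (by omega) (by omega) (by omega) (by omega))

theorem Spans.isSpanned_of_lt (h : Spans E τ k u v) (hk : k % 2 = 1) (hk13 : 13 ≤ k)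
    (hu : u.2 < sliceSize (τ u.1)) (hv : v.2 < sliceSize (τ v.1)) (hlt : u.1 < v.1) (hvk : v.1 < k)
    (hn : ¬ Link τ k u v) (hn' : ¬ Link τ k v u) : IsSpanned E τ k := by
  obtain ⟨c, hc, h1, h2, h3⟩ := exists_mem_firstCodes h hu
  obtain ⟨d, hd, h4, h5, h6, h7⟩ := exists_mem_secondCodes h (by omega) hv
  obtain ⟨g, hg⟩ := Nat.exists_eq_add_of_le (show u.1 + 1 ≤ v.1 from hlt)
  obtain ⟨m, hm⟩ := Nat.exists_eq_add_of_le (show v.1 + 1 ≤ k from hvk)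
  have r1 := reducedIndex_spec u.1
  have r2 := reduced_spec m
  have r3 := reduced_spec g
  obtain ⟨s1, s2⟩ := firstCodes_spec (by omega) hc
  have hcode : IsCode τ u v u.1 c := ⟨h3, fun _ => h1 ▸ rfl, fun h => (h h2).elim⟩
  have hcode' : IsCode τ u v v.1 d := ⟨h7, fun h => (h h4).elim, fun _ => h5 ▸ rfl⟩
  have p1 := h.isReached_iterate (by omega)
    (h.isReached_succ hcode (h.isReached_startMask u.1)) g
  rw [← hg] at p1
  have p2 := p1.mono (maskLE_iterate_reduced (fun _ _ => stepMask_mono) s1 g)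
  have p3 := h.isWinning_of_succ hcode' (h.isWinning_endMask (by omega) hm.symm)
  refine p2.isSpanned p3 (s2 d hd _ (by omega) _ (by omega) ?_)
  by_contra hex
  rw [Bool.not_eq_false, isExcluded, h1, h5] at hex
  simp only [Bool.or_eq_true, Bool.and_eq_true, decide_eq_true_eq, beq_iff_eq] at hex
  rcases hex with (((hex | hex) | hex) | hex) | hex
  · omega
  · omega
  · omega
  · exact hn (.inr (.inl ⟨by omega, by omega, by omega⟩))
  · have ht : u.2 = twist v.2 := by
      rw [← hex.2]
      exact (twist_twist _).symm
    exact hn' (.inr (.inr ⟨by omega, by omega, by omega, ht⟩))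

theorem Spans.symm_pair (h : Spans E τ k u v) : Spans E τ k v u :=
  ⟨h.symm, h.link, h.symm _ _ h.edge, h.root, h.type⟩

theorem Spans.isSpanned (h : Spans E τ k u v) (hk : k % 2 = 1) (hk13 : 13 ≤ k)
    (hu : u ∈ verts τ k) (hv : v ∈ verts τ k) (huv : u ≠ v)
    (hn : ¬ Link τ k u v) (hn' : ¬ Link τ k v u) : IsSpanned E τ k := by
  rw [mem_verts] at hu hv
  rcases Nat.lt_trichotomy u.1 v.1 with h1 | h1 | h1
  · exact h.isSpanned_of_lt hk hk13 hu.2 hv.2 h1 hv.1 hn hn'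
  · rcases Nat.lt_trichotomy u.2 v.2 with h2 | h2 | h2
    · refine h.isSpanned_of_same hk hk13 (i := u.1) (b := v.2) rfl (Prod.ext h1.symm rfl) hu.1 h2
        (h1 ▸ hv.2) fun h3 => hn (.inl ⟨h1, h3⟩)
    · exact (huv (Prod.ext h1 h2)).elim
    · refine h.symm_pair.isSpanned_of_same hk hk13 (i := v.1) (b := u.2) rfl
        (Prod.ext h1 rfl) hv.1 h2
        (h1 ▸ hu.2) fun h3 => hn' (.inl ⟨h1.symm, h3⟩)
  · exact h.symm_pair.isSpanned_of_lt hk hk13 hv.2 hu.2 h1 hu.1 hn' hn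

end Spanned

section Colouring

theorem exists_edge_colouring {V : Type*} [DecidableEq V] {R : V → V → Prop}
    (hR : ∀ x y, R x y → R y x) {L : List V}
    (hn : L.Nodup) (h3 : 3 ≤ L.length) (he : L.length % 2 = 0) (hc : L.IsChain R)
    (hcl : ∀ x ∈ L.getLast?, ∀ y ∈ L.head?, R x y) :
    ∃ col : V → V → Fin 3, (∀ x y, col x y = col y x) ∧
      ∀ x ∈ L, ∀ n₁ n₂ n₃, n₁ ≠ n₂ → n₁ ≠ n₃ → n₂ ≠ n₃ →
        (∀ y ∈ L, R x y → y = n₁ ∨ y = n₂ ∨ y = n₃) →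
          col x n₁ ≠ col x n₂ ∧ col x n₁ ≠ col x n₃ ∧ col x n₂ ≠ col x n₃ := by
  set N := L.length with hN
  let next (i j : ℕ) : Prop := (j = i + 1 ∧ j < N) ∨ (i + 1 = N ∧ j = 0)
  have hnext : ∀ i j (hi : i < N) (hj : j < N), next i j → R L[i] L[j] := by
    rintro i j hi hj (⟨rfl, _⟩ | ⟨h1, rfl⟩)
    · exact List.isChain_iff_getElem.1 hc i hj
    · refine hcl _ ?_ _ ?_
      · rw [List.getLast?_eq_getElem?, ← hN, show N - 1 = i by omega, List.getElem?_eq_getElem hi]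
        rfl
      · rw [List.head?_eq_getElem?, List.getElem?_eq_getElem hj]
        rfl
  let col (x y : V) : Fin 3 :=
    if next (L.idxOf x) (L.idxOf y) then (if L.idxOf x % 2 = 0 then 0 else 1)
    else if next (L.idxOf y) (L.idxOf x) then (if L.idxOf y % 2 = 0 then 0 else 1)
    else 2
  refine ⟨col, fun x y => ?_, fun x hx n₁ n₂ n₃ h₁₂ h₁₃ h₂₃ h => ?_⟩
  · simp only [col, next]
    split_ifs <;> first | rfl | omega
  · have hi : L.idxOf x < N := List.idxOf_lt_length_iff.2 hx
    have hxi : L[L.idxOf x] = x := List.getElem_idxOf hi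
    obtain ⟨s, hs, hs'⟩ : ∃ s, s < N ∧ next (L.idxOf x) s := by
      by_cases h : L.idxOf x + 1 = N
      · exact ⟨0, by omega, .inr ⟨h, rfl⟩⟩
      · exact ⟨L.idxOf x + 1, by omega, .inl ⟨rfl, by omega⟩⟩
    obtain ⟨p, hp, hp'⟩ : ∃ p, p < N ∧ next p (L.idxOf x) := by
      rcases Nat.eq_zero_or_pos (L.idxOf x) with h | h
      · exact ⟨N - 1, by omega, .inr ⟨by omega, h⟩⟩
      · exact ⟨L.idxOf x - 1, by omega, .inl ⟨by omega, by omega⟩⟩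
    have h1 := h L[s] (List.getElem_mem _) (by simpa [hxi] using hnext _ _ hi hs hs')
    have h2 := h L[p] (List.getElem_mem _) (hR _ _ (by simpa [hxi] using hnext _ _ hp hi hp'))
    have e1 : L.idxOf L[s] = s := hn.idxOf_getElem _ hs
    have e2 : L.idxOf L[p] = p := hn.idxOf_getElem _ hp
    have hsp : L[s] ≠ L[p] := by
      intro h
      rw [h, e2] at e1
      simp only [next] at hs' hp'
      omega
    have hne : col x L[s] ≠ col x L[p] := by
      simp only [col, next, e1, e2] at hs' hp' ⊢
      split_ifs <;> first | decide | (exfalso; omega)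
    have hs2 : col x L[s] ≠ 2 := by
      simp only [col, next, e1] at hs' ⊢
      split_ifs <;> decide
    have hp2 : col x L[p] ≠ 2 := by
      simp only [col, next, e2] at hp' ⊢
      split_ifs <;> decide
    have hw : ∀ w, w ≠ L[s] → w ≠ L[p] → col x w = 2 := by
      intro w h5 h6
      have h7 : L.idxOf w ≠ s := by
        rintro rfl
        exact h5 (List.getElem_idxOf hs).symm
      have h8 : L.idxOf w ≠ p := by
        rintro rfl
        exact h6 (List.getElem_idxOf hp).symm
      simp only [col, next] at hs' hp' ⊢
      split_ifs <;> first | rfl | omega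
    generalize L[s] = y at *
    generalize L[p] = z at *
    rcases h1 with rfl | rfl | rfl <;> rcases h2 with rfl | rfl | rfl
    · exact (hsp rfl).elim
    · rw [hw n₃ h₁₃.symm h₂₃.symm]; exact ⟨hne, hs2, hp2⟩
    · rw [hw n₂ h₁₂.symm h₂₃]; exact ⟨hs2, hne, hp2.symm⟩
    · rw [hw n₃ h₂₃.symm h₁₃.symm]; exact ⟨hne.symm, hp2, hs2⟩
    · exact (hsp rfl).elim
    · rw [hw n₁ h₁₂ h₁₃]; exact ⟨hs2.symm, hp2.symm, hne⟩
    · rw [hw n₂ h₂₃ h₁₂.symm]; exact ⟨hp2, hne.symm, hs2.symm⟩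
    · rw [hw n₁ h₁₃ h₁₂]; exact ⟨hp2.symm, hs2.symm, hne.symm⟩
    · exact (hsp rfl).elim

end Colouring

section Nontraceable

theorem eq_nil_or_eq_nil_of_leaf {V : Type*} {R : V → V → Prop} (hR : ∀ x y, R x y → R y x)
    {P Q : List V} {x a : V} (hc : (P ++ x :: Q).IsChain R) (hn : (P ++ x :: Q).Nodup)
    (hx : ∀ y, R x y → y = a) : P = [] ∨ Q = [] := by
  by_contra! h
  obtain ⟨P, y, rfl⟩ := List.eq_nil_or_concat' P |>.resolve_left h.1
  obtain ⟨z, Q, rfl⟩ := List.exists_cons_of_ne_nil h.2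
  have h1 : ([y] ++ [x, z]).IsChain R := by
    exact List.IsChain.right_of_append (l₁ := P)
      (List.IsChain.left_of_append (l₂ := Q) (by simpa using hc))
  simp only [List.cons_append, List.nil_append, List.isChain_cons_cons] at h1
  have h2 := hx y (hR _ _ h1.1)
  have h3 := hx z h1.2.1
  subst h2 h3
  simp [List.nodup_append] at hn

/-- Adjacency in the cyclic arrangement of slices. -/
def SliceAdj (τ : ℕ → ℕ) (k : ℕ) (p q : ℕ × ℕ) : Prop := Link τ k p q ∨ Link τ k q p

theorem SliceAdj.symm {τ : ℕ → ℕ} {k : ℕ} {p q : ℕ × ℕ} (h : SliceAdj τ k p q) : SliceAdj τ k q p :=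
  Or.symm h

/-- The first slice carries the leaves, and all others are of the two other types. -/
def IsArrangement (τ : ℕ → ℕ) : Prop := τ 0 = 0 ∧ ∀ i, 1 ≤ i → τ i = 1 ∨ τ i = 2

/-- The left neighbour of the vertex `j` of slice `i`. -/
def leftNbr (k i j : ℕ) : ℕ × ℕ := if i = 0 then (k - 1, twist j) else (i - 1, j)

/-- The right neighbour of the vertex `j` of slice `i`. -/
def rightNbr (k i j : ℕ) : ℕ × ℕ := if i + 1 = k then (0, twist j) else (i + 1, j)

/-- The neighbour of the vertex `j` of slice `i` in the same slice. -/
def innerNbr (τ : ℕ → ℕ) (i j : ℕ) : ℕ × ℕ := (i, if τ i = 2 then 3 + j else 3)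

theorem twist_lt {j : ℕ} (hj : j < 3) : twist j < 3 := by
  interval_cases j <;> decide

variable {τ : ℕ → ℕ} {k : ℕ}

theorem SliceAdj.eq_of_lt (hτ : IsArrangement τ) {i j : ℕ} {y : ℕ × ℕ} (hj : j < 3)
    (h : SliceAdj τ k (i, j) y) (hy : y.1 < k) (hy' : y ≠ (0, 4)) :
    y = leftNbr k i j ∨ y = rightNbr k i j ∨ y = innerNbr τ i j := by
  obtain ⟨y1, y2⟩ := y
  rcases h with h | h
  · rcases h with ⟨h1, h2⟩ | ⟨h1, h2, h3⟩ | ⟨h1, h2, h3, h4⟩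
    · simp only at h1 h2
      subst h1
      right; right
      unfold innerNbr
      rcases Nat.eq_zero_or_pos i with rfl | hi
      · rw [hτ.1] at h2 ⊢
        simp only [innerEdges] at h2
        interval_cases j <;> simp_all
      · rcases hτ.2 i hi with ht | ht
        · rw [ht] at h2 ⊢
          simp only [innerEdges] at h2
          interval_cases j <;> simp_all
        · rw [ht] at h2 ⊢
          simp only [innerEdges] at h2
          interval_cases j <;> simp_all
    · simp only at h1 h2 h3 hy
      right; left
      rw [rightNbr, if_neg (by omega), h1, h3]
    · simp only at h1 h2 h3 h4
      right; left
      rw [rightNbr, if_pos h1, h2, h4]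
  · rcases h with ⟨h1, h2⟩ | ⟨h1, h2, h3⟩ | ⟨h1, h2, h3, h4⟩
    · exfalso
      simp only at h1 h2
      subst h1
      rcases Nat.eq_zero_or_pos y1 with rfl | hi
      · rw [hτ.1] at h2
        simp only [innerEdges] at h2
        interval_cases j <;> simp_all
      · rcases hτ.2 y1 hi with ht | ht
        · rw [ht] at h2
          simp only [innerEdges] at h2
          interval_cases j <;> simp_all
        · rw [ht] at h2
          simp only [innerEdges] at h2
          interval_cases j <;> simp_all
    · simp only at h1 h2 h3
      left
      rw [leftNbr, if_neg (by omega), h3]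
      congr 1
      omega
    · simp only at h1 h2 h3 h4
      left
      rw [leftNbr, if_pos h2, h4, twist_twist]
      congr 1
      omega

theorem SliceAdj.inner_of_ge {i j : ℕ} {y : ℕ × ℕ} (hj : 3 ≤ j) (h : SliceAdj τ k (i, j) y) :
    y.1 = i ∧ ((j, y.2) ∈ innerEdges (τ i) ∨ (y.2, j) ∈ innerEdges (τ i)) := by
  obtain ⟨y1, y2⟩ := y
  rcases h with h | h
  · rcases h with ⟨h1, h2⟩ | ⟨h1, h2, h3⟩ | ⟨h1, h2, h3, h4⟩
    · exact ⟨h1.symm, .inl h2⟩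
    · simp only at h2
      omega
    · simp only at h3
      omega
  · rcases h with ⟨h1, h2⟩ | ⟨h1, h2, h3⟩ | ⟨h1, h2, h3, h4⟩
    · exact ⟨h1, .inr (by simp only at h1 h2; rwa [h1] at h2)⟩
    · simp only at h2 h3
      omega
    · simp only at h3 h4
      have := twist_lt h3
      omega

theorem SliceAdj.eq_of_centre (hτ : IsArrangement τ) {i : ℕ} {y : ℕ × ℕ} (ht : τ i ≠ 2)
    (h : SliceAdj τ k (i, 3) y) (hy : y ≠ (0, 5)) : y = (i, 0) ∨ y = (i, 1) ∨ y = (i, 2) := by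
  obtain ⟨y1, y2⟩ := y
  obtain ⟨h1, h2⟩ := h.inner_of_ge le_rfl
  simp only at h1 h2
  subst h1
  rcases Nat.eq_zero_or_pos y1 with rfl | hi
  · rw [hτ.1] at h2
    simp only [innerEdges] at h2
    simp_all
  · rw [(hτ.2 y1 hi).resolve_right ht] at h2
    simp only [innerEdges] at h2
    simp_all

theorem SliceAdj.eq_of_triangle {i j : ℕ} {y : ℕ × ℕ} (ht : τ i = 2) (hj : j < 3)
    (h : SliceAdj τ k (i, 3 + j) y) :
    y = (i, j) ∨ y = (i, 3 + (j + 1) % 3) ∨ y = (i, 3 + (j + 2) % 3) := by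
  obtain ⟨y1, y2⟩ := y
  obtain ⟨h1, h2⟩ := h.inner_of_ge (by omega)
  simp only at h1 h2
  subst h1
  rw [ht] at h2
  simp only [innerEdges] at h2
  interval_cases j <;> simp_all
  all_goals omega

/-- The kind of a triple of colours: the sign of a permutation of the colours, or the cyclic
orientation of the odd colour, the repeated colour and the missing colour. -/
def colourKind (x y z : Fin 3) : ℕ :=
  if x = y ∧ y = z then 4
  else if x = y then (if x = z + 1 then 2 else 3)
  else if x = z then (if x = y + 1 then 2 else 3)
  else if y = z then (if y = x + 1 then 2 else 3)
  else if y = x + 1 then 0 else 1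

theorem colourKind_step {x y z a b c x' y' z' : Fin 3} (h : a ≠ b ∧ a ≠ c ∧ b ≠ c)
    (hx : x ≠ a ∧ x' ≠ a ∧ x ≠ x') (hy : y ≠ b ∧ y' ≠ b ∧ y ≠ y') (hz : z ≠ c ∧ z' ≠ c ∧ z ≠ z') :
    colourKind x y z < 4 ∧ colourKind x' y' z' =
      if colourKind x y z < 2 then colourKind x y z else 5 - colourKind x y z := by
  have third : ∀ p q r : Fin 3, p ≠ q ∧ r ≠ q ∧ p ≠ r → r = -(p + q) := by decide
  have key : ∀ x y z a b : Fin 3, a ≠ b → x ≠ a ∧ y ≠ b ∧ z ≠ -(a + b) →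
      colourKind x y z < 4 ∧ colourKind (-(x + a)) (-(y + b)) (-(z + -(a + b))) =
        if colourKind x y z < 2 then colourKind x y z else 5 - colourKind x y z := by
    decide +kernel
  obtain rfl := third a b c ⟨h.1, h.2.2.symm, h.2.1⟩
  rw [third x a x' hx, third y b y' hy, third z _ z' hz]
  exact key x y z a b h.1 ⟨hx.1, hy.1, hz.1⟩

theorem colourKind_swap : ∀ x y z : Fin 3, colourKind x y z < 4 → colourKind x z y =
    if colourKind x y z < 2 then 1 - colourKind x y z else colourKind x y z := by
  decide +kernel

theorem triangle_colours : ∀ a b c x y z : Fin 3, (a ≠ z ∧ a ≠ y ∧ z ≠ y) →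
    (b ≠ x ∧ b ≠ z ∧ x ≠ z) → (c ≠ y ∧ c ≠ x ∧ y ≠ x) → a ≠ b ∧ a ≠ c ∧ b ≠ c := by
  decide +kernel

end Nontraceable

section NontraceableArrangement

variable {τ : ℕ → ℕ} {k : ℕ}

theorem nodup_verts (τ : ℕ → ℕ) (k : ℕ) : (verts τ k).Nodup := by
  rw [verts, List.nodup_flatMap]
  refine ⟨fun i _ => List.nodup_range.map (Prod.mk_right_injective i), ?_⟩
  refine List.nodup_range.imp fun {i j} hij => ?_
  simp only [Function.onFun, sliceVerts, List.disjoint_left, List.mem_map, List.mem_range]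
  rintro p ⟨a, _, rfl⟩ ⟨b, _, h⟩
  exact hij (Prod.mk.inj h).1.symm

theorem length_verts_succ (τ : ℕ → ℕ) (k : ℕ) :
    (verts τ (k + 1)).length = (verts τ k).length + sliceSize (τ k) := by
  simp [verts_succ, sliceVerts]

theorem length_verts_mod_two (τ : ℕ → ℕ) (k : ℕ) : (verts τ k).length % 2 = 0 := by
  induction k with
  | zero => rfl
  | succ k ih =>
    rw [length_verts_succ]
    unfold sliceSize
    split <;> omega

theorem three_lt_sliceSize (t : ℕ) : 3 < sliceSize t := by
  unfold sliceSize
  split <;> omega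

theorem leaf_four (hτ : IsArrangement τ) {y : ℕ × ℕ} (h : SliceAdj τ k (0, 4) y) : y = (0, 0) := by
  obtain ⟨y1, y2⟩ := y
  obtain ⟨h1, h2⟩ := h.inner_of_ge (by omega)
  simp only at h1 h2
  subst h1
  rw [hτ.1] at h2
  simpa [innerEdges] using h2

theorem leaf_five (hτ : IsArrangement τ) {y : ℕ × ℕ} (h : SliceAdj τ k (0, 5) y) : y = (0, 3) := by
  obtain ⟨y1, y2⟩ := y
  obtain ⟨h1, h2⟩ := h.inner_of_ge (by omega)
  simp only at h1 h2
  subst h1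
  rw [hτ.1] at h2
  simpa [innerEdges] using h2

theorem exists_path_between_leaves (hτ : IsArrangement τ) (hk : 0 < k) {l : List (ℕ × ℕ)}
    (hc : l.IsChain (SliceAdj τ k)) (hp : l.Perm (verts τ k)) :
    ∃ P, ((0, 4) :: (P ++ [(0, 5)])).IsChain (SliceAdj τ k) ∧
      ((0, 4) :: (P ++ [(0, 5)])).Perm (verts τ k) := by
  have hs : ∀ x y, SliceAdj τ k x y → SliceAdj τ k y x := fun _ _ h => h.symm
  have hmem : ∀ j < 6, (0, j) ∈ verts τ k := fun j hj => by
    rw [mem_verts, hτ.1]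
    exact ⟨hk, hj⟩
  have key : ∀ Q, ((0, 4) :: Q).IsChain (SliceAdj τ k) → ((0, 4) :: Q).Perm (verts τ k) →
      ∃ P, ((0, 4) :: (P ++ [(0, 5)])).IsChain (SliceAdj τ k) ∧
        ((0, 4) :: (P ++ [(0, 5)])).Perm (verts τ k) := by
    intro Q hc hp
    have h5 : (0, 5) ∈ Q := by simpa using hp.mem_iff.2 (hmem 5 (by omega))
    obtain ⟨P, Q, rfl⟩ := List.append_of_mem h5
    rcases eq_nil_or_eq_nil_of_leaf (P := (0, 4) :: P) hs hc
      (hp.nodup_iff.2 (nodup_verts τ k)) (fun y => leaf_five hτ) with h | rfl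
    · exact (List.cons_ne_nil _ _ h).elim
    · exact ⟨P, hc, hp⟩
  obtain ⟨P, Q, rfl⟩ := List.append_of_mem (hp.mem_iff.2 (hmem 4 (by omega)))
  rcases eq_nil_or_eq_nil_of_leaf hs hc (hp.nodup_iff.2 (nodup_verts τ k))
    (fun y => leaf_four hτ) with rfl | rfl
  · exact key Q hc hp
  · refine key P.reverse ?_ ?_
    · simpa using isChain_reverse_of_symm hs hc
    · refine List.Perm.trans ?_ hp
      rw [← List.reverse_concat]
      exact List.reverse_perm _

theorem exists_arrangement_colouring (hτ : IsArrangement τ) (hk : 0 < k) {l : List (ℕ × ℕ)}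
    (hc : l.IsChain (SliceAdj τ k)) (hp : l.Perm (verts τ k)) :
    ∃ col : ℕ × ℕ → ℕ × ℕ → Fin 3, (∀ x y, col x y = col y x) ∧
      ∀ x ∈ verts τ k, x ≠ (0, 4) → x ≠ (0, 5) → ∀ n₁ n₂ n₃, n₁ ≠ n₂ → n₁ ≠ n₃ → n₂ ≠ n₃ →
        (∀ y ∈ verts τ k, y ≠ (0, 4) → y ≠ (0, 5) → SliceAdj τ k x y →
          y = n₁ ∨ y = n₂ ∨ y = n₃) →
        col x n₁ ≠ col x n₂ ∧ col x n₁ ≠ col x n₃ ∧ col x n₂ ≠ col x n₃ := by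
  obtain ⟨P, hc, hp⟩ := exists_path_between_leaves hτ hk hc hp
  have hn := hp.nodup_iff.2 (nodup_verts τ k)
  have hmem : ∀ x, x ∈ P ↔ x ∈ verts τ k ∧ x ≠ (0, 4) ∧ x ≠ (0, 5) := by
    intro x
    rw [← hp.mem_iff]
    simp only [List.nodup_cons, List.nodup_append, List.mem_append, not_or,
      List.mem_cons] at hn ⊢
    constructor
    · intro h
      exact ⟨.inr (.inl h), fun h' => hn.1.1 (h' ▸ h), fun h' => hn.2.2.2 x h x (.inl h') rfl⟩
    · tauto
  have hlen : P.length + 2 = (verts τ k).length := by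
    simpa using hp.length_eq
  have hin : ∀ j < 4, (0, j) ∈ P := fun j hj => by
    rw [hmem, mem_verts, hτ.1]
    exact ⟨⟨hk, by simp only [sliceSize]; omega⟩, by simp; omega, by simp; omega⟩
  have h3 : 3 ≤ P.length := by
    have h : [((0 : ℕ), (0 : ℕ)), (0, 1), (0, 2)].Subperm P := by
      refine List.Nodup.subperm (by decide) ?_
      simp [hin]
    exact h.length_le
  have hhead : ∀ y ∈ P.head?, y = (0, 0) := by
    intro y hy
    cases P with
    | nil => simp at hy
    | cons z P =>
      simp only [List.head?_cons, Option.mem_def, Option.some.injEq] at hy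
      subst hy
      simp only [List.cons_append, List.isChain_cons_cons] at hc
      exact leaf_four hτ hc.1
  have hlast : ∀ y ∈ P.getLast?, y = (0, 3) := by
    intro y hy
    rw [← List.cons_append, List.isChain_append] at hc
    refine leaf_five hτ (hc.2.2 y ?_ (0, 5) (by simp)).symm
    rw [List.getLast?_cons]
    simp only [Option.mem_def] at hy
    simp [hy]
  have hcP : P.IsChain (SliceAdj τ k) :=
    List.IsChain.right_of_append (l₁ := [(0, 4)])
      (List.IsChain.left_of_append (l₂ := [(0, 5)]) (by simpa using hc))
  obtain ⟨col, h1, h2⟩ := exists_edge_colouring (fun _ _ h => h.symm) (hn.sublist (by simp)) h3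
    (by have := length_verts_mod_two τ k; omega) hcP (fun x hx y hy => by
      rw [hhead y hy, hlast x hx]
      exact .inr (.inl ⟨rfl, by rw [hτ.1]; simp [innerEdges]⟩))
  refine ⟨col, h1, fun x hx hx4 hx5 n₁ n₂ n₃ h12 h13 h23 h => ?_⟩
  refine h2 x ((hmem x).2 ⟨hx, hx4, hx5⟩) n₁ n₂ n₃ h12 h13 h23 fun y hy => ?_
  obtain ⟨h3, h4, h5⟩ := (hmem y).1 hy
  exact h y h3 h4 h5

theorem not_hamiltonian_arrangement (hτ : IsArrangement τ) (hk : k % 2 = 1) (hk3 : 3 ≤ k)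
    {l : List (ℕ × ℕ)} (hc : l.IsChain (SliceAdj τ k)) (hp : l.Perm (verts τ k)) : False := by
  obtain ⟨col, hsymm, hcol⟩ := exists_arrangement_colouring hτ (by omega) hc hp
  have hmem : ∀ i < k, ∀ j < 4, (i, j) ∈ verts τ k := fun i hi j hj =>
    mem_verts.2 ⟨hi, by have := three_lt_sliceSize (τ i); simp only; omega⟩
  have hport : ∀ i < k, ∀ j < 3,
      col (i, j) (leftNbr k i j) ≠ col (i, j) (innerNbr τ i j) ∧
      col (i, j) (rightNbr k i j) ≠ col (i, j) (innerNbr τ i j) ∧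
      col (i, j) (leftNbr k i j) ≠ col (i, j) (rightNbr k i j) := by
    intro i hi j hj
    obtain ⟨h1, h2, h3⟩ := hcol (i, j) (hmem i hi j (by omega)) (by simp; omega) (by simp; omega)
      (leftNbr k i j) (rightNbr k i j) (innerNbr τ i j)
      (by unfold leftNbr rightNbr; split_ifs <;> simp <;> omega)
      (by unfold leftNbr innerNbr; split_ifs <;> simp <;> omega)
      (by unfold rightNbr innerNbr; split_ifs <;> simp <;> omega)
      (fun y hy h4 _ h => h.eq_of_lt hτ hj (mem_verts.1 hy).1 h4)
    exact ⟨h2, h3, h1⟩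
  have hinner : ∀ i < k, col (i, 0) (innerNbr τ i 0) ≠ col (i, 1) (innerNbr τ i 1) ∧
      col (i, 0) (innerNbr τ i 0) ≠ col (i, 2) (innerNbr τ i 2) ∧
      col (i, 1) (innerNbr τ i 1) ≠ col (i, 2) (innerNbr τ i 2) := by
    intro i hi
    by_cases ht : τ i = 2
    · have hi0 : i ≠ 0 := by
        rintro rfl
        rw [hτ.1] at ht
        omega
      have h : ∀ j < 3, _ := fun j hj => hcol (i, 3 + j)
        (mem_verts.2 ⟨hi, by simp only [ht, sliceSize]; omega⟩) (by simp [hi0]) (by simp [hi0])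
        (i, j) (i, 3 + (j + 1) % 3) (i, 3 + (j + 2) % 3) (by simp; omega) (by simp; omega)
        (by simp; omega) (fun y _ _ _ h => h.eq_of_triangle ht hj)
      have h0 := h 0 (by omega)
      have h1 := h 1 (by omega)
      have h2 := h 2 (by omega)
      simp only [innerNbr, ht, if_true]
      norm_num at h0 h1 h2 ⊢
      rw [hsymm (i, 0), hsymm (i, 1), hsymm (i, 2)]
      rw [hsymm (i, 4) (i, 3)] at h1
      rw [hsymm (i, 5) (i, 3), hsymm (i, 5) (i, 4)] at h2
      exact triangle_colours _ _ _ _ _ _ h0 h1 h2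
    · have h := hcol (i, 3) (hmem i hi 3 (by omega)) (by simp) (by simp) (i, 0) (i, 1) (i, 2)
        (by simp) (by simp) (by simp) (fun y _ _ h5 h => h.eq_of_centre hτ ht h5)
      simp only [innerNbr, ht, if_false]
      rw [hsymm (i, 0), hsymm (i, 1), hsymm (i, 2)]
      exact h
  let K (i : ℕ) := colourKind (col (i, 0) (leftNbr k i 0)) (col (i, 1) (leftNbr k i 1))
    (col (i, 2) (leftNbr k i 2))
  have hstep : ∀ i < k, K i < 4 ∧ colourKind (col (i, 0) (rightNbr k i 0))
      (col (i, 1) (rightNbr k i 1)) (col (i, 2) (rightNbr k i 2)) =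
        if K i < 2 then K i else 5 - K i := fun i hi =>
    colourKind_step (hinner i hi) (hport i hi 0 (by omega)) (hport i hi 1 (by omega))
      (hport i hi 2 (by omega))
  have hright : ∀ i, i + 1 < k → K (i + 1) = if K i < 2 then K i else 5 - K i := by
    intro i hi
    rw [← (hstep i (by omega)).2]
    simp only [K, leftNbr, rightNbr, if_neg (Nat.succ_ne_zero i), if_neg (show i + 1 ≠ k by omega),
      Nat.add_sub_cancel]
    rw [hsymm (i + 1, 0), hsymm (i + 1, 1), hsymm (i + 1, 2)]
  have hK : ∀ i < k, K i = if K 0 < 2 then K 0 else if i % 2 = 0 then K 0 else 5 - K 0 := by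
    intro i hi
    have h0 := (hstep 0 (by omega)).1
    induction i with
    | zero => simp
    | succ i ih =>
      rw [hright i hi, ih (by omega)]
      split_ifs <;> omega
  have h0 := (hstep 0 (by omega)).1
  have hlast := (hstep (k - 1) (by omega)).2
  have hswap := colourKind_swap _ _ _ h0
  rw [hK (k - 1) (by omega)] at hlast
  have hclose : colourKind (col (k - 1, 0) (rightNbr k (k - 1) 0))
      (col (k - 1, 1) (rightNbr k (k - 1) 1)) (col (k - 1, 2) (rightNbr k (k - 1) 2)) =
      colourKind (col (0, 0) (leftNbr k 0 0)) (col (0, 2) (leftNbr k 0 2))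
        (col (0, 1) (leftNbr k 0 1)) := by
    simp only [leftNbr, rightNbr, if_pos (show k - 1 + 1 = k by omega), if_true, twist]
    rw [hsymm (k - 1, 0), hsymm (k - 1, 1), hsymm (k - 1, 2)]
  rw [hclose, hswap] at hlast
  change (if K 0 < 2 then 1 - K 0 else K 0) = _ at hlast
  split_ifs at hlast <;> omega

end NontraceableArrangement

section Transport

theorem Traceable.map {V W : Type*} {G : SimpleGraph V} {H : SimpleGraph W} (f : V → W)
    (hf : f.Bijective) (hGH : ∀ a b, G.Adj a b → H.Adj (f a) (f b)) (h : Traceable G) :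
    Traceable H := by
  obtain ⟨u, v, p, hp, hm⟩ := h
  let φ : G →g H := ⟨f, fun {a b} => hGH a b⟩
  refine ⟨_, _, p.map φ, hp.map hf.1, fun w => ?_⟩
  obtain ⟨a, rfl⟩ := hf.2 w
  rw [Walk.support_map]
  exact List.mem_map_of_mem (hm a)

theorem MaxNontraceable.of_iso {V W : Type*} {G : SimpleGraph V} {H : SimpleGraph W} (f : G ≃g H)
    (h : MaxNontraceable G) : MaxNontraceable H := by
  refine ⟨fun hH => h.1 (hH.map f.symm f.symm.bijective fun a b => f.symm.map_adj_iff.2),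
    fun u v huv hn => ?_⟩
  have h1 := h.2 (f.symm u) (f.symm v) (fun h => huv (f.symm.injective h))
    (fun h => hn (f.symm.map_adj_iff.1 h))
  refine h1.map f f.bijective fun a b hab => ?_
  rw [sup_adj, edge_adj] at hab ⊢
  rw [f.map_adj_iff, ← f.injective.ne_iff (x := a)] at *
  simp only [RelIso.eq_symm_apply] at hab
  exact hab

theorem exists_max_nontraceable_fin {V : Type*} [Finite V] {G : SimpleGraph V}
    (h : MaxNontraceable G) {n m : ℕ} (hn : Nat.card V = n) (hm : Nat.card G.edgeSet ≤ m) :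
    ∃ H : SimpleGraph (Fin n), MaxNontraceable H ∧ Nat.card H.edgeSet ≤ m := by
  let e : V ≃ Fin n := Finite.equivFinOfCardEq hn
  let f : G ≃g G.map e.toEmbedding := Iso.map e G
  exact ⟨_, h.of_iso f, (Nat.card_congr f.mapEdgeSet).symm.trans_le hm⟩

end Transport

section Lists

variable {α : Type*} {R : α → α → Prop}

theorem exists_chain_insert (hR : ∀ a b, R a b → R b a) {l : List α} {u v w : α}
    (hc : l.IsChain R) (hn : l.Nodup) (hu : u ∈ l) (hvu : R v u) (hvw : R v w)
    (h : ∀ y z, y ∈ l → z ∈ l → R u y → R u z → y ≠ z → y = w ∨ z = w) :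
    ∃ l' : List α, l'.IsChain R ∧ l'.Perm (v :: l) := by
  obtain ⟨P, Q, rfl⟩ := List.append_of_mem hu
  rcases List.eq_nil_or_concat' P with rfl | ⟨P, y, rfl⟩
  · exact ⟨v :: u :: Q, by simpa using ⟨hvu, hc⟩, List.Perm.refl _⟩
  rcases Q with _ | ⟨z, Q⟩
  · refine ⟨(v :: (P ++ [y] ++ [u]).reverse), ?_, (List.reverse_perm _).cons v⟩
    have := isChain_reverse_of_symm hR hc
    simp only [List.reverse_append, List.reverse_cons, List.reverse_nil, List.nil_append,
      List.cons_append] at this ⊢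
    exact List.isChain_cons_cons.2 ⟨hvu, this⟩
  have h1 : (P ++ [y]).IsChain R ∧ R y u ∧ R u z ∧ (z :: Q).IsChain R := by
    rw [List.isChain_append] at hc
    simpa [and_assoc, and_left_comm, and_comm] using hc
  have hyz : y ≠ z := by
    rintro rfl
    simp [List.nodup_append] at hn
  rcases h y z (by simp) (by simp) (hR _ _ h1.2.1) h1.2.2.1 hyz with rfl | rfl
  · refine ⟨P ++ [y] ++ v :: u :: z :: Q, ?_, List.perm_middle⟩
    rw [List.isChain_append]
    simpa using ⟨h1.1, ⟨hvu, h1.2.2⟩, hR _ _ hvw⟩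
  · refine ⟨P ++ [y] ++ u :: v :: z :: Q, ?_, ?_⟩
    · rw [List.isChain_append]
      simpa using ⟨h1.1, ⟨hR _ _ hvu, hvw, h1.2.2.2⟩, h1.2.1⟩
    · refine (List.Perm.append_left _ (List.Perm.swap v u _)).trans List.perm_middle

theorem List.IsChain.erase_middle (hR : ∀ a b, R a b → R b a) {P Q : List α} {u v w : α}
    (hc : (P ++ v :: Q).IsChain R) (hn : (P ++ v :: Q).Nodup) (huw : R u w)
    (h : ∀ y, R v y → y = u ∨ y = w) : (P ++ Q).IsChain R := by
  rcases List.eq_nil_or_concat' P with rfl | ⟨P, y, rfl⟩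
  · exact hc.tail
  rcases Q with _ | ⟨z, Q⟩
  · simpa using hc.left_of_append
  have h1 : (P ++ [y]).IsChain R ∧ R y v ∧ R v z ∧ (z :: Q).IsChain R := by
    rw [List.isChain_append] at hc
    simpa [and_assoc, and_left_comm, and_comm] using hc
  have hyz : y ≠ z := by
    rintro rfl
    simp [List.nodup_append] at hn
  rw [List.isChain_append]
  refine ⟨h1.1, h1.2.2.2, ?_⟩
  simp only [List.getLast?_append, List.getLast?_singleton, List.head?_cons, Option.mem_def]
  simp only [Option.some_or, Option.some.injEq]
  rintro _ rfl _ rfl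
  rcases h y (hR _ _ h1.2.1) with rfl | rfl <;> rcases h z h1.2.2.1 with rfl | rfl
  · exact (hyz rfl).elim
  · exact huw
  · exact hR _ _ huw
  · exact (hyz rfl).elim

end Lists

section PendantTriangle

variable {V : Type*} {G : SimpleGraph V} {u v w : V}

/-- The graph obtained by removing the vertex `v`. -/
abbrev SimpleGraph.removeVertex (G : SimpleGraph V) (v : V) : SimpleGraph {a // a ≠ v} :=
  G.comap Subtype.val

theorem traceable_removeVertex_iff [Nonempty {a // a ≠ v}] :
    Traceable (G.removeVertex v) ↔
      ∃ l : List V, l.IsChain G.Adj ∧ l.Nodup ∧ ∀ a, a ∈ l ↔ a ≠ v := by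
  rw [traceable_iff_exists_list]
  constructor
  · rintro ⟨l, hc, hn, hm⟩
    refine ⟨l.map Subtype.val, (List.isChain_map _).2 hc, hn.map Subtype.val_injective, ?_⟩
    intro a
    constructor
    · rintro h
      obtain ⟨b, _, rfl⟩ := List.mem_map.1 h
      exact b.2
    · exact fun h => List.mem_map.2 ⟨⟨a, h⟩, hm _, rfl⟩
  · rintro ⟨l, hc, hn, hm⟩
    lift l to List {a // a ≠ v} using fun a ha => (hm a).1 ha
    refine ⟨l, (List.isChain_map Subtype.val).1 hc, hn.of_map _, fun a => ?_⟩
    exact (List.mem_map_of_injective Subtype.val_injective).1 ((hm a).2 a.2)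

theorem removeVertex_sup_edge (G : SimpleGraph V) {v : V} (a b : {a // a ≠ v}) :
    (G ⊔ edge a.1 b.1).removeVertex v = G.removeVertex v ⊔ edge a b := by
  ext x y
  simp [edge_adj, Subtype.ext_iff]

theorem maxNontraceable_removeVertex_iff (hv : ∀ a, G.Adj v a ↔ a = u ∨ a = w)
    (hu : ∀ a, G.Adj u a ↔ a = v ∨ a = w) :
    MaxNontraceable (G.removeVertex v) ↔ MaxNontraceable G := by
  have hvu : G.Adj v u := (hv u).2 (.inl rfl)
  have hvw : G.Adj v w := (hv w).2 (.inr rfl)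
  have huw : G.Adj u w := (hu w).2 (.inr rfl)
  have : Nonempty {a // a ≠ v} := ⟨⟨u, hvu.ne'⟩⟩
  have : Nonempty V := ⟨u⟩
  have iff : ∀ H : SimpleGraph V, G ≤ H → (∀ a, H.Adj v a ↔ a = u ∨ a = w) →
      (∀ y z, H.Adj u y → H.Adj u z → y ≠ v → z ≠ v → y ≠ z → y = w ∨ z = w) →
      (Traceable (H.removeVertex v) ↔ Traceable H) := by
    intro H hGH hv' hu'
    rw [traceable_removeVertex_iff, traceable_iff_exists_list]
    constructor
    · rintro ⟨l, hc, hn, hm⟩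
      obtain ⟨l', h1, h2⟩ := exists_chain_insert (fun _ _ h => H.adj_symm h) hc hn
        ((hm u).2 hvu.ne') (hGH hvu) (hGH hvw)
        (fun y z hy hz h1 h2 => hu' y z h1 h2 ((hm y).1 hy) ((hm z).1 hz))
      refine ⟨l', h1, h2.nodup_iff.2 (List.nodup_cons.2 ⟨fun h => (hm v).1 h rfl, hn⟩), ?_⟩
      intro a
      rw [h2.mem_iff, List.mem_cons, hm]
      tauto
    · rintro ⟨l, hc, hn, hm⟩
      obtain ⟨P, Q, rfl⟩ := List.append_of_mem (hm v)
      refine ⟨P ++ Q, hc.erase_middle (fun _ _ h => H.adj_symm h) hn (hGH huw)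
        fun y hy => (hv' y).1 hy, ?_, fun a => ?_⟩
      · exact hn.sublist (by simp)
      · have h1 := hm a
        rw [List.nodup_middle, List.nodup_cons] at hn
        simp only [List.mem_append, List.mem_cons] at h1 ⊢
        constructor
        · rintro h rfl
          exact hn.1 (List.mem_append.2 h)
        · tauto
  have key : ∀ a b : {a // a ≠ v}, a ≠ b → ¬ G.Adj a b →
      (Traceable (G.removeVertex v ⊔ edge a b) ↔ Traceable (G ⊔ edge a.1 b.1)) := by
    intro a b hab hn
    rw [← removeVertex_sup_edge]
    have ha := a.2
    have hb := b.2
    refine iff _ le_sup_left (fun c => ?_) fun y z hy hz hyv hzv hyz => ?_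
    · rw [sup_adj, hv, edge_adj]
      tauto
    · rw [sup_adj, hu, edge_adj] at hy hz
      grind
  have h0 := iff G le_rfl hv fun y z hy hz hyv hzv hyz => by
    rw [hu] at hy hz
    tauto
  refine ⟨fun h => ⟨fun h' => h.1 (h0.2 h'), ?_⟩, fun h => ⟨fun h' => h.1 (h0.1 h'), ?_⟩⟩
  · have one : ∀ b, b ≠ v → ¬ G.Adj v b → Traceable (G ⊔ edge v b) := by
      intro b hb hn
      rw [hv] at hn
      push Not at hn
      obtain ⟨A, B, hc1, hc2, hn', hm⟩ := h.exists_isPathPair (u := ⟨u, hvu.ne'⟩) (v := ⟨b, hb⟩)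
        (fun h => hn.1 (Subtype.ext_iff.1 h).symm)
        (fun h' => ((hu b).1 h').elim hb hn.2)
      have hp : IsPathPair G v b (u :: A.map Subtype.val) (B.map Subtype.val) := by
        refine ⟨?_, (List.isChain_map (f := Subtype.val) (l := ⟨b, hb⟩ :: B)).2 hc2, ?_, ?_⟩
        · rw [List.isChain_cons_cons]
          exact ⟨hvu, (List.isChain_map (f := Subtype.val) (l := ⟨u, hvu.ne'⟩ :: A)).2 hc1⟩
        · have := hn'.map Subtype.val_injective
          simp only [List.map_append, List.map_cons] at this
          refine List.nodup_cons.2 ⟨?_, this⟩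
          simp [hvu.ne, hb.symm]
        · intro c
          by_cases hcv : c = v
          · simp [hcv]
          · have := List.mem_map_of_mem (f := Subtype.val) (hm ⟨c, hcv⟩)
            simp only [List.map_append, List.map_cons] at this
            exact List.mem_cons_of_mem _ this
      exact hp.traceable
    intro a b hab hn
    by_cases ha : a = v
    · subst ha
      exact one b hab.symm hn
    by_cases hb : b = v
    · subst hb
      rw [edge_comm]
      exact one a ha fun h => hn h.symm
    exact (key ⟨a, ha⟩ ⟨b, hb⟩ (by simpa using hab) hn).1 (h.2 _ _ (by simpa using hab) hn)
  · intro a b hab hn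
    exact (key a b hab hn).2 (h.2 _ _ (Subtype.val_injective.ne hab) hn)

end PendantTriangle

section SliceGraph

variable {τ : ℕ → ℕ} {k : ℕ}

/-- The graph formed by `k` cyclically arranged slices. -/
def sliceGraph (τ : ℕ → ℕ) (k : ℕ) : SimpleGraph {p // p ∈ verts τ k} :=
  SimpleGraph.fromRel fun p q => Link τ k p q

theorem sliceGraph_adj_iff (hk : 1 < k) {p q : {p // p ∈ verts τ k}} :
    (sliceGraph τ k).Adj p q ↔ SliceAdj τ k p q := by
  rw [sliceGraph, fromRel_adj, SliceAdj, and_iff_right_iff_imp]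
  rintro h rfl
  have h' : Link τ k p p := h.elim id id
  rcases h' with ⟨-, h⟩ | ⟨h, -⟩ | ⟨h, h', -⟩
  · generalize τ p.1.1 = t at h
    unfold innerEdges at h
    split at h <;> simp at h <;> omega
  · omega
  · omega

theorem card_verts (τ : ℕ → ℕ) (k : ℕ) : Nat.card {p // p ∈ verts τ k} = (verts τ k).length := by
  classical
  rw [← List.toFinset_card_of_nodup (nodup_verts τ k), ← Nat.card_eq_finsetCard]
  exact Nat.card_congr (Equiv.subtypeEquivRight fun p => by simp)

theorem sliceGraph_not_traceable (hτ : IsArrangement τ) (hk : k % 2 = 1) (hk3 : 3 ≤ k) :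
    ¬ Traceable (sliceGraph τ k) := by
  have : Nonempty {p // p ∈ verts τ k} :=
    ⟨(0, 0), mem_verts.2 ⟨by omega, by have := three_lt_sliceSize (τ 0); simp only; omega⟩⟩
  rw [traceable_iff_exists_list]
  rintro ⟨l, hc, hn, hm⟩
  refine not_hamiltonian_arrangement hτ hk hk3 (l := l.map Subtype.val) ?_ ?_
  · exact (List.isChain_map _).2 (hc.imp fun _ _ => (sliceGraph_adj_iff (by omega)).1)
  · rw [List.perm_ext_iff_of_nodup (hn.map Subtype.val_injective) (nodup_verts τ k)]
    intro p
    constructor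
    · intro h
      obtain ⟨q, _, rfl⟩ := List.mem_map.1 h
      exact q.2
    · exact fun h => List.mem_map.2 ⟨⟨p, h⟩, hm _, rfl⟩

theorem sliceGraph_maxNontraceable (hτ : τ 0 = 0)
    (hτ' : ∀ i, 1 ≤ i → τ i = 1 ∨ (τ i = 2 ∧ 2 ≤ i ∧ i ≤ 4)) (hk : k % 2 = 1) (hk13 : 13 ≤ k) :
    MaxNontraceable (sliceGraph τ k) := by
  refine ⟨sliceGraph_not_traceable ⟨hτ, fun i hi => (hτ' i hi).imp_right And.left⟩ hk (by omega),
    fun u v huv hn => ?_⟩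
  have : Nonempty {p // p ∈ verts τ k} := ⟨u⟩
  rw [sliceGraph_adj_iff (by omega), SliceAdj, not_or] at hn
  let E (p q : ℕ × ℕ) : Prop :=
    SliceAdj τ k p q ∨ (p = u.1 ∧ q = v.1) ∨ (p = v.1 ∧ q = u.1)
  have hS : Spans E τ k u v := by
    refine ⟨fun p q h => ?_, fun p q h => .inl (.inl h), .inr (.inl ⟨rfl, rfl⟩), hτ, hτ'⟩
    rcases h with h | h | h
    · exact .inl h.symm
    · exact .inr (.inr ⟨h.2, h.1⟩)
    · exact .inr (.inl ⟨h.2, h.1⟩)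
  obtain ⟨l, hc, hp⟩ := hS.isSpanned hk hk13 u.2 v.2 (Subtype.val_injective.ne huv) hn.1 hn.2
  lift l to List {p // p ∈ verts τ k} using fun p hp' => hp.mem_iff.1 hp'
  refine traceable_iff_exists_list.2 ⟨l, ?_, (hp.nodup_iff.2 (nodup_verts τ k)).of_map _,
    fun p => (List.mem_map_of_injective Subtype.val_injective).1 (hp.mem_iff.2 p.2)⟩
  refine ((List.isChain_map Subtype.val).1 hc).imp fun p q h => ?_
  rw [sup_adj, sliceGraph_adj_iff (by omega), edge_adj]
  rcases h with h | ⟨h1, h2⟩ | ⟨h1, h2⟩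
  · exact .inl h
  · rw [Subtype.ext h1, Subtype.ext h2]
    exact .inr ⟨.inl ⟨rfl, rfl⟩, huv⟩
  · rw [Subtype.ext h1, Subtype.ext h2]
    exact .inr ⟨.inr ⟨rfl, rfl⟩, huv.symm⟩

/-- The edges inside slice `i` and from it to the next slice. -/
def sliceEdges (τ : ℕ → ℕ) (k i : ℕ) : List (Sym2 (ℕ × ℕ)) :=
  ((innerEdges (τ i)).map fun e => s((i, e.1), (i, e.2))) ++
    (List.range 3).map fun j => s((i, j), rightNbr k i j)

theorem mem_sliceEdges_of_link {p q : ℕ × ℕ} (hq : q.1 < k) (h : Link τ k p q) :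
    s(p, q) ∈ sliceEdges τ k p.1 := by
  obtain ⟨i, a⟩ := p
  obtain ⟨j, b⟩ := q
  rw [sliceEdges, List.mem_append]
  rcases h with ⟨h1, h2⟩ | ⟨h1, h2, h3⟩ | ⟨h1, h2, h3, h4⟩
  · simp only at h1 h2
    subst h1
    exact .inl (List.mem_map.2 ⟨_, h2, rfl⟩)
  · simp only at h1 h2 h3 hq
    subst h1 h3
    refine .inr (List.mem_map.2 ⟨b, List.mem_range.2 h2, ?_⟩)
    rw [rightNbr, if_neg (by omega)]
  · simp only at h1 h2 h3 h4
    subst h2 h4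
    refine .inr (List.mem_map.2 ⟨a, List.mem_range.2 h3, ?_⟩)
    rw [rightNbr, if_pos h1]

theorem card_edgeSet_sliceGraph_le (τ : ℕ → ℕ) (k : ℕ) :
    Nat.card (sliceGraph τ k).edgeSet ≤
      ((List.range k).map fun i => (innerEdges (τ i)).length + 3).sum := by
  classical
  set L := (List.range k).flatMap (sliceEdges τ k) with hL
  have hlen : L.length = ((List.range k).map fun i => (innerEdges (τ i)).length + 3).sum := by
    simp [hL, List.length_flatMap, sliceEdges]
  rw [← hlen]
  refine le_trans ?_ L.toFinset_card_le
  rw [Nat.card_coe_set_eq, ← Set.ncard_coe_finset]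
  refine Set.ncard_le_ncard_of_injOn (Sym2.map Subtype.val) ?_
    (Sym2.map.injective Subtype.val_injective).injOn (Finset.finite_toSet _)
  intro e he
  induction e with | _ p q
  rw [mem_edgeSet, sliceGraph, fromRel_adj] at he
  rw [Sym2.map_mk, Finset.mem_coe, List.mem_toFinset, hL, List.mem_flatMap]
  rcases he.2 with h | h
  · exact ⟨_, List.mem_range.2 (mem_verts.1 p.2).1, mem_sliceEdges_of_link (mem_verts.1 q.2).1 h⟩
  · rw [Sym2.eq_swap]
    exact ⟨_, List.mem_range.2 (mem_verts.1 q.2).1, mem_sliceEdges_of_link (mem_verts.1 p.2).1 h⟩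

/-- The arrangement with `t` triangle slices. -/
def arrangement (t i : ℕ) : ℕ := if i = 0 then 0 else if 2 ≤ i ∧ i ≤ t + 1 then 2 else 1

theorem length_verts_arrangement {t k : ℕ} (ht : t ≤ 3) (hk : 5 ≤ k) :
    (verts (arrangement t) k).length = 4 * k + 2 * t + 2 := by
  induction k, hk using Nat.le_induction with
  | base => interval_cases t <;> rfl
  | succ k hk ih =>
    rw [length_verts_succ, ih, arrangement, if_neg (by omega), if_neg (by omega), sliceSize]
    ring

theorem size_arrangement {t k : ℕ} (ht : t ≤ 3) (hk : 5 ≤ k) :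
    ((List.range k).map fun i => (innerEdges (arrangement t i)).length + 3).sum =
      6 * k + 3 * t + 2 := by
  induction k, hk using Nat.le_induction with
  | base => interval_cases t <;> rfl
  | succ k hk ih =>
    have h : arrangement t k = 1 := by
      rw [arrangement, if_neg (by omega), if_neg (by omega)]
    rw [List.range_succ, List.map_append, List.sum_append, ih]
    simp only [List.map_cons, List.map_nil, List.sum_singleton, h, innerEdges, List.length_cons,
      List.length_nil]
    ring

theorem exists_sliceGraph {n : ℕ} (hn : 54 ≤ n) (he : n % 2 = 0) :
    ∃ t k, t ≤ 3 ∧ 13 ≤ k ∧ k % 2 = 1 ∧ n = 4 * k + 2 * t + 2 := by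
  refine ⟨(n - 6) % 8 / 2, (n - 2 - 2 * ((n - 6) % 8 / 2)) / 4, ?_, ?_, ?_, ?_⟩ <;> omega

/-- A graph with a new vertex adjacent to `u` and `w`. -/
def withTwin {V : Type*} (G : SimpleGraph V) (u w : V) : SimpleGraph (Option V) :=
  G.map Function.Embedding.some ⊔ edge none (some u) ⊔ edge none (some w)

theorem withTwin_adj_some {V : Type*} {G : SimpleGraph V} {u w a b : V} :
    (withTwin G u w).Adj (some a) (some b) ↔ G.Adj a b := by
  simpa [withTwin, edge_adj, SimpleGraph.map_adj'] using Adj.ne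

theorem withTwin_adj_none {V : Type*} {G : SimpleGraph V} {u w a : V} :
    (withTwin G u w).Adj none (some a) ↔ a = u ∨ a = w := by
  simp [withTwin, edge_adj, SimpleGraph.map_adj']

theorem withTwin_maxNontraceable {V : Type*} {G : SimpleGraph V} (hG : MaxNontraceable G) {u w : V}
    (hu : ∀ a, G.Adj u a ↔ a = w) : MaxNontraceable (withTwin G u w) := by
  rw [← maxNontraceable_removeVertex_iff (v := none) (u := some u) (w := some w)]
  · let e : V ≃ {a : Option V // a ≠ none} := Equiv.ofBijective (fun a => ⟨some a, by simp⟩)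
      ⟨fun a b h => by simpa using h, fun ⟨a, ha⟩ => by
        obtain ⟨b, rfl⟩ := Option.ne_none_iff_exists'.1 ha
        exact ⟨b, rfl⟩⟩
    exact hG.of_iso (f := ⟨e, withTwin_adj_some⟩)
  · rintro (_ | a)
    · simp
    · simp [withTwin_adj_none]
  · rintro (_ | a)
    · simp [adj_comm _ _ none, withTwin_adj_none]
    · simp [withTwin_adj_some, hu]

theorem card_edgeSet_withTwin_le {V : Type*} [Finite V] (G : SimpleGraph V) (u w : V) :
    Nat.card (withTwin G u w).edgeSet ≤ Nat.card G.edgeSet + 2 := by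
  rw [Nat.card_coe_set_eq, Nat.card_coe_set_eq, withTwin, edgeSet_sup, edgeSet_sup, edgeSet_map]
  have h : ∀ a : V, (edge none (some a)).edgeSet.ncard = 1 := fun a => by
    rw [edgeSet_edge_of_ne (by simp), Set.ncard_singleton]
  refine (Set.ncard_union_le _ _).trans ?_
  rw [h]
  refine Nat.succ_le_succ ((Set.ncard_union_le _ _).trans ?_)
  rw [h]
  exact Nat.succ_le_succ (Set.ncard_image_le (Set.toFinite _))

theorem exists_maxNontraceable_card_edgeSet_le {n : ℕ} (hn : 54 ≤ n) :
    ∃ G : SimpleGraph (Fin n), MaxNontraceable G ∧ Nat.card G.edgeSet ≤ (3 * n - 1) / 2 := by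
  obtain ⟨t, k, ht, hk13, hk, h⟩ := exists_sliceGraph (n := n - n % 2) (by omega) (by omega)
  have hG : MaxNontraceable (sliceGraph (arrangement t) k) :=
    sliceGraph_maxNontraceable rfl (fun i hi => by
      unfold arrangement
      split_ifs <;> omega) hk hk13
  have hE := card_edgeSet_sliceGraph_le (arrangement t) k
  have hV := card_verts (arrangement t) k
  rw [size_arrangement ht (by omega)] at hE
  rw [length_verts_arrangement ht (by omega)] at hV
  rcases Nat.mod_two_eq_zero_or_one n with h2 | h2
  · exact exists_max_nontraceable_fin hG (by omega) (by omega)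
  · have hm : ∀ j < 6, (0, j) ∈ verts (arrangement t) k := fun j hj =>
      mem_verts.2 ⟨by simp only; omega, hj⟩
    refine exists_max_nontraceable_fin
      (withTwin_maxNontraceable hG (u := ⟨(0, 4), hm 4 (by omega)⟩)
        (w := ⟨(0, 0), hm 0 (by omega)⟩) fun a => ?_)
      (by rw [Finite.card_option]; omega)
      ((card_edgeSet_withTwin_le _ _ _).trans (by omega))
    rw [sliceGraph_adj_iff (by omega), Subtype.ext_iff]
    refine ⟨leaf_four ⟨rfl, fun i hi => ?_⟩, ?_⟩
    · unfold arrangement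
      split_ifs <;> omega
    · rintro h
      rw [h]
      exact .inr (.inl ⟨rfl, by simp [arrangement, innerEdges]⟩)

end SliceGraph

section PathLists

variable {α : Type*} {R : α → α → Prop}

theorem exists_eq_append_pair {l : List α} {a x : α} (hc : (a :: l).IsChain R) (hx : x ∈ l) :
    ∃ P y Q, a :: l = P ++ y :: x :: Q ∧ R y x := by
  obtain ⟨P, Q, rfl⟩ := List.append_of_mem hx
  rw [← List.cons_append] at hc ⊢
  obtain ⟨P', y, h⟩ := List.eq_nil_or_concat' (a :: P) |>.resolve_left (List.cons_ne_nil _ _)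
  rw [h] at hc ⊢
  refine ⟨P', y, Q, by simp, ?_⟩
  rw [List.isChain_append] at hc
  exact hc.2.2 y (by simp) x (by simp)

theorem exists_eq_append_last (hR : ∀ a b, R a b → R b a) {l : List α} {a x w : α}
    (hc : (a :: l).IsChain R) (hn : (a :: l).Nodup) (hx : x ∈ l)
    (h : ∀ y ∈ a :: l, R x y → y = w) : ∃ P, a :: l = P ++ [w, x] := by
  obtain ⟨P, y, Q, h1, h2⟩ := exists_eq_append_pair hc hx
  rw [h1] at hc hn h ⊢
  obtain rfl := h y (by simp) (hR _ _ h2)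
  rcases Q with _ | ⟨z, Q⟩
  · exact ⟨P, rfl⟩
  · have h3 : R x z := by
      rw [List.isChain_append] at hc
      exact (List.isChain_cons_cons.1 (List.isChain_cons_cons.1 hc.2.1).2).1
    obtain rfl := h z (by simp) h3
    simp [List.nodup_append] at hn

theorem eq_nil_of_cons_eq_append {l P Q : List α} {a : α} (hn : (a :: l).Nodup)
    (h : a :: l = P ++ a :: Q) : P = [] ∧ l = Q := by
  rcases P with _ | ⟨b, P⟩
  · exact ⟨rfl, (List.cons.inj h).2⟩
  · obtain ⟨rfl, rfl⟩ := List.cons.inj h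
    simp at hn

theorem eq_of_append_pair_eq {P P' Q Q' : List α} {y x x' : α} (hn : (P ++ y :: x :: Q).Nodup)
    (h : P ++ y :: x :: Q = P' ++ y :: x' :: Q') : x = x' := by
  induction P generalizing P' with
  | nil =>
    have := eq_nil_of_cons_eq_append hn h
    exact (List.cons.inj this.2).1
  | cons a P ih =>
    rcases P' with _ | ⟨b, P'⟩
    · obtain ⟨rfl, -⟩ := List.cons.inj h
      simp at hn
    · exact ih (List.nodup_cons.1 hn).2 (List.cons.inj h).2

theorem eq_of_append_last_eq {P P' : List α} {y y' x x' : α} (h : P ++ [y, x] = P' ++ [y', x']) :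
    P = P' ∧ y = y' ∧ x = x' := by
  simpa [and_assoc] using List.append_inj' h rfl

end PathLists

section PathPairs

variable {V : Type*} {G : SimpleGraph V} {u v x y w : V} {A B : List V}

theorem IsPathPair.not_perm (hG : MaxNontraceable G) (h : IsPathPair G u v A B) {l : List V}
    (hc : l.IsChain G.Adj) (hp : l.Perm (u :: A ++ v :: B)) : False := by
  refine hG.not_hamiltonian ?_ hc (hp.nodup_iff.2 h.2.2.1) fun w => hp.mem_iff.2 (h.2.2.2 w)
  rintro rfl
  simpa using hp.length_eq

theorem IsPathPair.nodup_left (h : IsPathPair G u v A B) : (u :: A).Nodup :=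
  (List.nodup_append.1 h.2.2.1).1

theorem IsPathPair.ne (h : IsPathPair G u v A B) (hx : x ∈ u :: A) (hy : y ∈ v :: B) : x ≠ y :=
  (List.nodup_append.1 h.2.2.1).2.2 x hx y hy

theorem IsPathPair.mem_or (h : IsPathPair G u v A B) (hu : x ≠ u) (hv : x ≠ v) : x ∈ A ∨ x ∈ B := by
  have := h.2.2.2 x
  simp only [List.mem_append, List.mem_cons, hu, hv, false_or] at this
  exact this

theorem IsPathPair.exists_pred (h : IsPathPair G u v A B) (hu : x ≠ u) (hv : x ≠ v) :
    ∃ P y Q, u :: A ++ v :: B = P ++ y :: x :: Q ∧ G.Adj y x := by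
  rcases h.mem_or hu hv with hx | hx
  · obtain ⟨P, y, Q, h1, h2⟩ := exists_eq_append_pair h.1 hx
    exact ⟨P, y, Q ++ v :: B, by rw [h1]; simp, h2⟩
  · obtain ⟨P, y, Q, h1, h2⟩ := exists_eq_append_pair h.2.1 hx
    exact ⟨u :: A ++ P, y, Q, by rw [h1]; simp, h2⟩

theorem IsPathPair.exists_last_left (h : IsPathPair G u v A B) (hx : x ∈ A)
    (hw : ∀ y ∈ u :: A, G.Adj x y → y = w) : ∃ P, u :: A = P ++ [w, x] :=
  exists_eq_append_last (fun _ _ h => G.adj_symm h) h.1 h.nodup_left hx hw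

theorem IsPathPair.exists_last_of_leaf (h : IsPathPair G u v A B) (hx : ∀ a, G.Adj x a ↔ a = w)
    (hu : x ≠ u) (hv : x ≠ v) : (∃ P, u :: A = P ++ [w, x]) ∨ ∃ P, v :: B = P ++ [w, x] := by
  rcases h.mem_or hu hv with h1 | h1
  · exact .inl (h.exists_last_left h1 fun y _ hy => (hx y).1 hy)
  · exact .inr (h.symm.exists_last_left h1 fun y _ hy => (hx y).1 hy)

theorem IsPathPair.eq_singleton_of_leaf (h : IsPathPair G u v A B) (hx : ∀ a, G.Adj x a ↔ a = u)
    (hv : x ≠ v) : A = [x] := by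
  have hu : x ≠ u := ((hx u).2 rfl).ne
  rcases h.exists_last_of_leaf hx hu hv with ⟨P, hP⟩ | ⟨P, hP⟩
  · exact (eq_nil_of_cons_eq_append h.nodup_left hP).2
  · exact (h.ne (x := u) (y := u) (by simp) (by simp [hP]) rfl).elim

theorem SimpleGraph.isChain_reverse_append {a b : V} (h1 : (a :: A).IsChain G.Adj)
    (h2 : (b :: B).IsChain G.Adj) (hab : G.Adj a b) :
    ((a :: A).reverse ++ b :: B).IsChain G.Adj := by
  refine List.IsChain.append (SimpleGraph.isChain_reverse.2 h1) h2 ?_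
  simpa using hab

end PathPairs

section LocalStructure

variable {V : Type*} {G : SimpleGraph V} {u v w x y z : V}

theorem MaxNontraceable.adj_of_degree_two (hG : MaxNontraceable G)
    (hv : ∀ a, G.Adj v a ↔ a = u ∨ a = w) (huw : u ≠ w) : G.Adj u w := by
  by_contra hn
  obtain ⟨A, B, h⟩ := hG.exists_isPathPair huw hn
  have hvu : G.Adj v u := (hv u).2 (.inl rfl)
  have hvw : G.Adj v w := (hv w).2 (.inr rfl)
  have key : ∀ {u w A B}, IsPathPair G u w A B → G.Adj v u → G.Adj v w →
      (∀ a, G.Adj v a → a = u ∨ a = w) → v ∈ A → False := by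
    intro u w A B h hu hw hv hm
    obtain ⟨P, hP⟩ := h.exists_last_left hm fun y hy hvy =>
      (hv y hvy).resolve_right (h.ne hy (by simp))
    obtain ⟨-, rfl⟩ := eq_nil_of_cons_eq_append h.nodup_left hP
    refine h.not_perm hG (l := u :: v :: w :: B) ?_ (List.Perm.refl _)
    simpa using ⟨hu.symm, hw, h.2.1⟩
  rcases h.mem_or hvu.ne hvw.ne with h1 | h1
  · exact key h hvu hvw (fun a => (hv a).1) h1
  · exact key h.symm hvw hvu (fun a ha => ((hv a).1 ha).symm) h1

theorem MaxNontraceable.not_degree_three (hG : MaxNontraceable G)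
    (hv : ∀ a, G.Adj v a ↔ a = u ∨ a = w) (hu : ∀ a, G.Adj u a ↔ a = v ∨ a = w ∨ a = z)
    (hvz : v ≠ z) (hwz : w ≠ z) : False := by
  have hvu : G.Adj v u := (hv u).2 (.inl rfl)
  have hvw : G.Adj v w := (hv w).2 (.inr rfl)
  have huw : G.Adj u w := (hu w).2 (.inr (.inl rfl))
  have huz : G.Adj u z := (hu z).2 (.inr (.inr rfl))
  obtain ⟨A, B, h⟩ := hG.exists_isPathPair hvz fun h =>
    ((hv z).1 h).elim huz.ne' hwz.symm
  have hzA : z ∉ v :: A := fun hz => h.ne hz (by simp) rfl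
  have hvB : v ∉ z :: B := fun hv => h.ne (by simp) hv rfl
  rcases A with _ | ⟨a, A⟩
  · have huB : u ∈ z :: B := List.mem_cons_of_mem _
      ((h.mem_or hvu.ne' huz.ne).resolve_left (by simp))
    obtain ⟨l, h1, h2⟩ :=
      exists_chain_insert (fun _ _ h => G.adj_symm h) h.2.1 h.symm.nodup_left huB
      hvu hvw (fun b d hb hd hub hud hbd => by
        rw [hu] at hub hud
        grind)
    exact h.not_perm hG h1 h2
  have hva : G.Adj v a := (List.isChain_cons_cons.1 h.1).1
  rcases (hv a).1 hva with rfl | rfl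
  · rcases A with _ | ⟨b, A⟩
    · refine h.not_perm hG (isChain_reverse_append h.2.1 (B := [v]) ?_ huz.symm) ?_
      · simpa using hvu.symm
      · exact List.perm_append_comm.trans ((List.Perm.swap _ _ _).append (List.reverse_perm _))
    · have hab : G.Adj a b := (List.isChain_cons_cons.1 (List.isChain_cons_cons.1 h.1).2).1
      have hbA : (b :: A).IsChain G.Adj :=
        (List.isChain_cons_cons.1 (List.isChain_cons_cons.1 h.1).2).2
      have hbw : b = w := by
        rcases (hu b).1 hab with rfl | rfl | rfl
        · exact absurd h.nodup_left (by simp)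
        · rfl
        · exact absurd hzA (by simp)
      subst hbw
      refine h.not_perm hG (isChain_reverse_append h.2.1 (B := v :: b :: A) ?_ huz.symm) ?_
      · simpa using ⟨hvu.symm, hvw, hbA⟩
      · exact List.perm_append_comm.trans ((List.Perm.swap _ _ _).append (List.reverse_perm _))
  · rcases h.mem_or hvu.ne' huz.ne with hm | hm
    · have hn := h.nodup_left
      obtain ⟨P, hP⟩ := exists_eq_append_last (fun _ _ h => G.adj_symm h)
        (List.isChain_cons_cons.1 h.1).2 (List.nodup_cons.1 hn).2
        ((List.mem_cons.1 hm).resolve_left huw.ne) (w := a) fun y hy huy => by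
          rcases (hu y).1 huy with rfl | rfl | rfl
          · exact ((List.nodup_cons.1 hn).1 hy).elim
          · rfl
          · exact (hzA (List.mem_cons_of_mem _ hy)).elim
      obtain ⟨-, rfl⟩ := eq_nil_of_cons_eq_append (List.nodup_cons.1 hn).2 hP
      refine h.not_perm hG (isChain_reverse_append h.2.1 (B := [v, a]) ?_ huz.symm) ?_
      · simpa using ⟨hvu.symm, hvw⟩
      · refine List.perm_append_comm.trans (List.Perm.append ?_ (List.reverse_perm _))
        exact (List.Perm.swap _ _ _).trans ((List.Perm.swap _ _ _).cons v)
    · obtain ⟨P, hP⟩ := h.symm.exists_last_left hm (w := z) fun y hy huy => by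
        rcases (hu y).1 huy with rfl | rfl | rfl
        · exact (hvB hy).elim
        · exact (h.ne (by simp) hy rfl).elim
        · rfl
      obtain ⟨-, rfl⟩ := eq_nil_of_cons_eq_append h.symm.nodup_left hP
      refine h.not_perm hG (l := z :: u :: v :: a :: A) ?_ (List.perm_append_comm (l₁ := [z, u]))
      exact List.isChain_cons_cons.2 ⟨huz.symm, List.isChain_cons_cons.2 ⟨hvu.symm, h.1⟩⟩

theorem MaxNontraceable.not_three_common (hG : MaxNontraceable G) {v₁ v₂ v₃ : V}
    (h₁ : ∀ a, G.Adj v₁ a → a = u ∨ a = z) (h₂ : ∀ a, G.Adj v₂ a → a = u ∨ a = z)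
    (h₃ : ∀ a, G.Adj v₃ a → a = u ∨ a = z) (h12 : v₁ ≠ v₂) (h13 : v₁ ≠ v₃) (h23 : v₂ ≠ v₃)
    (hu : G.Adj u v₁ ∧ G.Adj u v₂ ∧ G.Adj u v₃) (hx : u ≠ x) (hux : ¬ G.Adj u x) : False := by
  obtain ⟨A, B, h⟩ := hG.exists_isPathPair hx hux
  have key : ∀ v, G.Adj u v → (∀ a, G.Adj v a → a = u ∨ a = z) →
      ∃ P y Q, u :: A ++ x :: B = P ++ y :: v :: Q ∧ (y = u ∨ y = z) := by
    intro v huv hv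
    obtain ⟨P, y, Q, h1, h2⟩ := h.exists_pred (x := v) huv.ne' (by rintro rfl; exact hux huv)
    exact ⟨P, y, Q, h1, hv y h2.symm⟩
  have uniq : ∀ {P Q P' Q' y v v'}, u :: A ++ x :: B = P ++ y :: v :: Q →
      u :: A ++ x :: B = P' ++ y :: v' :: Q' → v = v' := by
    intro P Q P' Q' y v v' h1 h2
    exact eq_of_append_pair_eq (h1 ▸ h.2.2.1) (h1.symm.trans h2)
  obtain ⟨P₁, y₁, Q₁, a₁, b₁⟩ := key v₁ hu.1 h₁
  obtain ⟨P₂, y₂, Q₂, a₂, b₂⟩ := key v₂ hu.2.1 h₂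
  obtain ⟨P₃, y₃, Q₃, a₃, b₃⟩ := key v₃ hu.2.2 h₃
  have n12 : y₁ ≠ y₂ := by rintro rfl; exact h12 (uniq a₁ a₂)
  have n13 : y₁ ≠ y₃ := by rintro rfl; exact h13 (uniq a₁ a₃)
  have n23 : y₂ ≠ y₃ := by rintro rfl; exact h23 (uniq a₂ a₃)
  grind

theorem MaxNontraceable.adj_of_isolated (hG : MaxNontraceable G) (hx : ∀ a, ¬ G.Adj x a)
    (hu : u ≠ x) (hv : v ≠ x) (huv : u ≠ v) : G.Adj u v := by
  by_contra hn
  obtain ⟨A, B, h⟩ := hG.exists_isPathPair huv hn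
  obtain ⟨P, y, Q, -, h2⟩ := h.exists_pred hu.symm hv.symm
  exact hx y h2.symm

theorem MaxNontraceable.adj_of_three_leaves (hG : MaxNontraceable G) {x₁ x₂ x₃ y₁ y₂ y₃ : V}
    (h₁ : ∀ a, G.Adj x₁ a ↔ a = y₁) (h₂ : ∀ a, G.Adj x₂ a ↔ a = y₂)
    (h₃ : ∀ a, G.Adj x₃ a ↔ a = y₃) (h12 : x₁ ≠ x₂) (h13 : x₁ ≠ x₃) (h23 : x₂ ≠ x₃)
    (hu : u ≠ x₁ ∧ u ≠ x₂ ∧ u ≠ x₃) (hv : v ≠ x₁ ∧ v ≠ x₂ ∧ v ≠ x₃) (huv : u ≠ v) :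
    G.Adj u v := by
  by_contra hn
  obtain ⟨A, B, h⟩ := hG.exists_isPathPair huv hn
  have uniq : ∀ {l P P' : List V} {y y' x x'}, l = P ++ [y, x] → l = P' ++ [y', x'] → x = x' :=
    fun h1 h2 => (eq_of_append_last_eq (h1.symm.trans h2)).2.2
  rcases h.exists_last_of_leaf h₁ hu.1.symm hv.1.symm with ⟨P₁, a₁⟩ | ⟨P₁, a₁⟩ <;>
  rcases h.exists_last_of_leaf h₂ hu.2.1.symm hv.2.1.symm with ⟨P₂, a₂⟩ | ⟨P₂, a₂⟩ <;>
  rcases h.exists_last_of_leaf h₃ hu.2.2.symm hv.2.2.symm with ⟨P₃, a₃⟩ | ⟨P₃, a₃⟩ <;>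
  first
    | exact h12 (uniq a₁ a₂)
    | exact h13 (uniq a₁ a₃)
    | exact h23 (uniq a₂ a₃)

end LocalStructure

section TwoLeaves

variable {V : Type*} {G : SimpleGraph V} {u v w x₁ x₂ y₁ y₂ z q r a b : V}

theorem IsPathPair.exists_pred_last {A B P : List V} (h : IsPathPair G u v A B)
    (hP : u :: A = P ++ [y₁, x₁]) (hy : u ≠ y₁) :
    ∃ Q p, u :: A = Q ++ [p, y₁, x₁] ∧ G.Adj y₁ p := by
  rcases List.eq_nil_or_concat' P with rfl | ⟨P, p, rfl⟩
  · exact (hy (List.cons.inj hP).1).elim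
  · refine ⟨P, p, by simpa using hP, ?_⟩
    have := h.1
    rw [hP, List.append_assoc, List.isChain_append] at this
    exact (List.isChain_cons_cons.1 this.2.1).1.symm

theorem MaxNontraceable.adj_of_two_leaves (hG : MaxNontraceable G)
    (h₁ : ∀ a, G.Adj x₁ a ↔ a = y₁) (h₂ : ∀ a, G.Adj x₂ a ↔ a = y₂) (hx : x₁ ≠ x₂)
    (hy : y₁ = y₂ ∨ y₁ = x₂) (hu : u ≠ x₁ ∧ u ≠ x₂) (hv : v ≠ x₁ ∧ v ≠ x₂) (huv : u ≠ v) :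
    G.Adj u v := by
  by_contra hn
  obtain ⟨A, B, h⟩ := hG.exists_isPathPair huv hn
  rcases hy with rfl | rfl
  · obtain ⟨P₁, y, Q₁, a₁, b₁⟩ := h.exists_pred hu.1.symm hv.1.symm
    obtain ⟨P₂, y', Q₂, a₂, b₂⟩ := h.exists_pred hu.2.symm hv.2.symm
    obtain rfl := (h₁ y).1 b₁.symm
    obtain rfl := (h₂ y').1 b₂.symm
    exact hx (eq_of_append_pair_eq (a₁ ▸ h.2.2.1) (a₁.symm.trans a₂))
  · obtain rfl := (h₂ x₁).1 ((h₁ y₁).2 rfl).symm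
    rcases h.exists_last_of_leaf h₁ hu.1.symm hv.1.symm with ⟨P₁, a₁⟩ | ⟨P₁, a₁⟩ <;>
    rcases h.exists_last_of_leaf h₂ hu.2.symm hv.2.symm with ⟨P₂, a₂⟩ | ⟨P₂, a₂⟩
    · exact hx (eq_of_append_last_eq (a₁.symm.trans a₂)).2.2
    · exact h.ne (x := x₁) (y := x₁) (by simp [a₁]) (by simp [a₂]) rfl
    · exact h.ne (x := x₁) (y := x₁) (by simp [a₂]) (by simp [a₁]) rfl
    · exact hx (eq_of_append_last_eq (a₁.symm.trans a₂)).2.2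

theorem MaxNontraceable.adj_leaf_neighbours (hG : MaxNontraceable G)
    (h₁ : ∀ a, G.Adj x₁ a ↔ a = y₁) (h₂ : ∀ a, G.Adj x₂ a ↔ a = y₂) (hy : y₁ ≠ y₂)
    (hyx : y₁ ≠ x₂) (hq : q ≠ x₁ ∧ q ≠ x₂ ∧ q ≠ y₁ ∧ q ≠ y₂) : G.Adj y₁ y₂ := by
  by_contra hn
  obtain ⟨A, B, h⟩ := hG.exists_isPathPair hy hn
  have hyx' : x₁ ≠ y₂ := by
    rintro rfl
    exact hyx ((h₁ x₂).1 ((h₂ x₁).2 rfl).symm).symm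
  obtain rfl := h.eq_singleton_of_leaf h₁ hyx'
  obtain rfl := h.symm.eq_singleton_of_leaf h₂ hyx.symm
  have := h.2.2.2 q
  simp at this
  tauto

theorem MaxNontraceable.adj_of_neighbour_of_leaf (hG : MaxNontraceable G)
    (h₁ : ∀ a, G.Adj x₁ a ↔ a = y₁) (h₂ : ∀ a, G.Adj x₂ a ↔ a = y₂) (hx : x₁ ≠ x₂)
    (hyx : y₁ ≠ x₂) (hv : ∀ a, G.Adj v a ↔ a = y₁ ∨ a = w) (hw : w ≠ y₁) (hq : q ≠ y₁)
    (hqx : q ≠ x₂) : G.Adj y₁ q := by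
  by_contra hn
  obtain ⟨A, B, h⟩ := hG.exists_isPathPair hq.symm hn
  have hvy : G.Adj v y₁ := (hv y₁).2 (.inl rfl)
  have hvw : G.Adj v w := (hv w).2 (.inr rfl)
  have hxq : x₁ ≠ q := by
    rintro rfl
    exact hn ((h₁ y₁).2 rfl).symm
  obtain rfl := h.eq_singleton_of_leaf h₁ hxq
  have hvq : v ≠ q := by
    rintro rfl
    exact hn hvy.symm
  have hvB : v ∈ B := by
    refine (h.mem_or hvy.ne hvq).resolve_left fun hm => ?_
    rw [List.mem_singleton.1 hm] at hvw
    exact hw ((h₁ w).1 hvw)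
  obtain ⟨P, hP⟩ := h.symm.exists_last_left hvB (w := w) fun y hym hy =>
    ((hv y).1 hy).resolve_left fun h' => h.ne (x := y₁) (by simp) hym h'.symm
  rcases h.exists_last_of_leaf h₂ hyx.symm hqx.symm with ⟨P', hP'⟩ | ⟨P', hP'⟩
  · exact hx (eq_of_append_last_eq (P := []) hP').2.2
  · obtain ⟨-, -, rfl⟩ := eq_of_append_last_eq (hP.symm.trans hP')
    exact hw (((h₂ w).1 hvw).trans ((h₂ y₁).1 hvy).symm)

theorem MaxNontraceable.adj_third_neighbour (hG : MaxNontraceable G)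
    (h₁ : ∀ a, G.Adj x₁ a ↔ a = y₁) (h₂ : ∀ a, G.Adj x₂ a ↔ a = y₂)
    (hyx : y₁ ≠ x₂) (hy₁ : ∀ a, G.Adj y₁ a ↔ a = x₁ ∨ a = y₂ ∨ a = z) (hzx : z ≠ x₁)
    (hzy : z ≠ y₂) (hq : q ≠ x₁ ∧ q ≠ x₂ ∧ q ≠ y₁ ∧ q ≠ y₂ ∧ q ≠ z) : G.Adj y₂ z := by
  by_contra hn
  have hyy : G.Adj y₁ y₂ := (hy₁ y₂).2 (.inr (.inl rfl))
  have hyz : G.Adj y₁ z := (hy₁ z).2 (.inr (.inr rfl))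
  have hxy : G.Adj x₁ y₁ := (h₁ y₁).2 rfl
  obtain ⟨A, B, h⟩ := hG.exists_isPathPair hzy.symm hn
  have hzx₂ : x₂ ≠ z := by
    rintro rfl
    exact hyy.ne ((h₂ y₁).1 hyz.symm)
  have hxy₂ : x₁ ≠ y₂ := by
    rintro rfl
    exact hyx ((h₁ x₂).1 ((h₂ x₁).2 rfl).symm).symm
  obtain rfl := h.eq_singleton_of_leaf h₂ hzx₂
  rcases h.exists_last_of_leaf h₁ hxy₂ hzx.symm with ⟨P, hP⟩ | ⟨P, hP⟩
  · exact hyy.ne (eq_of_append_last_eq (P := []) hP).2.1.symm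
  · obtain ⟨Q, p, h3, hp⟩ := h.symm.exists_pred_last hP hyz.ne'
    have hn' := h.symm.nodup_left
    rcases (hy₁ p).1 hp with rfl | rfl | rfl
    · rw [h3] at hn'
      simp [List.nodup_append] at hn'
    · exact h.ne (x := p) (y := p) (by simp) (by simp [h3]) rfl
    · obtain ⟨-, rfl⟩ := eq_nil_of_cons_eq_append hn' h3
      have := h.2.2.2 q
      simp at this
      tauto

theorem MaxNontraceable.adj_of_common_neighbour (hG : MaxNontraceable G)
    (h₁ : ∀ a, G.Adj x₁ a ↔ a = y₁) (h₂ : ∀ a, G.Adj x₂ a ↔ a = y₂)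
    (hy₁ : ∀ a, G.Adj y₁ a ↔ a = x₁ ∨ a = y₂ ∨ a = z)
    (hy₂ : ∀ a, G.Adj y₂ a ↔ a = x₂ ∨ a = y₁ ∨ a = z)
    (ha : a ≠ x₁ ∧ a ≠ x₂ ∧ a ≠ y₁ ∧ a ≠ y₂) (hb : b ≠ x₁ ∧ b ≠ x₂ ∧ b ≠ y₁ ∧ b ≠ y₂)
    (hab : a ≠ b) : G.Adj a b := by
  by_contra hn
  obtain ⟨A, B, h⟩ := hG.exists_isPathPair hab hn
  have hyy : G.Adj y₁ y₂ := (hy₁ y₂).2 (.inr (.inl rfl))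
  have hxx : x₁ ≠ x₂ := by
    rintro rfl
    exact hyy.ne ((h₂ y₁).1 ((h₁ y₁).2 rfl))
  have key : ∀ {a b A B P P'}, IsPathPair G a b A B → a ≠ y₁ → b ≠ y₂ →
      a :: A = P ++ [y₁, x₁] → b :: B = P' ++ [y₂, x₂] → False := by
    intro a b A B P P' h ha hb h1 h2
    obtain ⟨Q, p, h3, hp⟩ := h.exists_pred_last h1 ha
    obtain ⟨Q', p', h4, hp'⟩ := h.symm.exists_pred_last h2 hb
    have n1 := h.nodup_left
    have n2 := h.symm.nodup_left
    have hm := fun w => h.ne (x := w) (y := w)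
    rw [h3] at n1 hm
    rw [h4] at n2 hm
    rcases (hy₁ p).1 hp with rfl | rfl | rfl
    · simp [List.nodup_append] at n1
    · exact hm p (by simp) (by simp) rfl
    · rcases (hy₂ p').1 hp' with rfl | rfl | rfl
      · simp [List.nodup_append] at n2
      · exact hm p' (by simp) (by simp) rfl
      · exact hm p' (by simp) (by simp) rfl
  rcases h.exists_last_of_leaf h₁ ha.1.symm hb.1.symm with ⟨P, hP⟩ | ⟨P, hP⟩ <;>
  rcases h.exists_last_of_leaf h₂ ha.2.1.symm hb.2.1.symm with ⟨P', hP'⟩ | ⟨P', hP'⟩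
  · exact hxx (eq_of_append_last_eq (hP.symm.trans hP')).2.2
  · exact key h ha.2.2.1 hb.2.2.2 hP hP'
  · exact key h.symm hb.2.2.1 ha.2.2.2 hP hP'
  · exact hxx (eq_of_append_last_eq (hP.symm.trans hP')).2.2

theorem MaxNontraceable.not_degrees_three_four (hG : MaxNontraceable G)
    (h₁ : ∀ a, G.Adj x₁ a ↔ a = y₁) (h₂ : ∀ a, G.Adj x₂ a ↔ a = y₂) (hyx : y₁ ≠ x₂)
    (hy₁ : ∀ a, G.Adj y₁ a ↔ a = x₁ ∨ a = y₂ ∨ a = z)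
    (hy₂ : ∀ a, G.Adj y₂ a ↔ a = x₂ ∨ a = y₁ ∨ a = z ∨ a = q)
    (hq : q ≠ x₁ ∧ q ≠ x₂ ∧ q ≠ z ∧ q ≠ y₁)
    (hr : r ≠ x₁ ∧ r ≠ x₂ ∧ r ≠ y₁ ∧ r ≠ y₂ ∧ r ≠ q) : False := by
  have hyy : G.Adj y₁ y₂ := (hy₁ y₂).2 (.inr (.inl rfl))
  have hyz : G.Adj y₁ z := (hy₁ z).2 (.inr (.inr rfl))
  have hyq : G.Adj y₂ q := (hy₂ q).2 (.inr (.inr (.inr rfl)))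
  have hn : ¬ G.Adj y₁ q := fun h => ((hy₁ q).1 h).elim hq.1 (Or.rec hyq.ne' hq.2.2.1)
  obtain ⟨A, B, h⟩ := hG.exists_isPathPair hq.2.2.2.symm hn
  obtain rfl := h.eq_singleton_of_leaf h₁ hq.1.symm
  rcases h.exists_last_of_leaf h₂ hyx.symm hq.2.1.symm with ⟨P, hP⟩ | ⟨P, hP⟩
  · exact hyy.ne ((h₁ y₂).1 (by
      obtain ⟨-, -, rfl⟩ := eq_of_append_last_eq (P := []) hP
      exact (h₂ y₂).2 rfl)).symm
  · obtain ⟨Q, p, h3, hp⟩ := h.symm.exists_pred_last hP hyq.ne'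
    have n2 := h.symm.nodup_left
    have hm := fun w => h.ne (x := w) (y := w)
    rcases (hy₂ p).1 hp with rfl | rfl | rfl | rfl
    · rw [h3] at n2
      simp [List.nodup_append] at n2
    · exact hm p (by simp) (by simp [h3]) rfl
    · rcases Q with _ | ⟨c, Q⟩
      · exact hq.2.2.1 (List.cons.inj h3).1
      · obtain ⟨rfl, rfl⟩ := List.cons.inj h3
        have hc := List.isChain_append.1 (show ((q :: (Q ++ [p])) ++ [y₂, x₂]).IsChain G.Adj by
          simpa using h.2.1)
        have hc' := SimpleGraph.isChain_reverse_append hc.1 hc.2.1 hyq.symm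
        refine h.not_perm hG (l := x₁ :: y₁ :: ((q :: (Q ++ [p])).reverse ++ [y₂, x₂])) ?_ ?_
        · refine List.isChain_cons_cons.2 ⟨(h₁ y₁).2 rfl, ?_⟩
          simp only [List.reverse_cons, List.reverse_append, List.reverse_nil, List.nil_append,
            List.cons_append] at hc' ⊢
          exact List.isChain_cons_cons.2 ⟨hyz, hc'⟩
        · refine (List.Perm.swap _ _ _).trans (List.Perm.cons _ (List.Perm.cons _ ?_))
          refine ((List.reverse_perm _).append_right _).trans ?_
          simp
    · obtain ⟨-, rfl⟩ := eq_nil_of_cons_eq_append n2 h3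
      have := h.2.2.2 r
      simp at this
      tauto

end TwoLeaves

section Counting

variable {V : Type*} [Fintype V] {G : SimpleGraph V} [DecidableRel G.Adj]
  {u v w x y z x₁ x₂ y₁ y₂ : V}

theorem SimpleGraph.exists_adj_iff_of_degree_one (h : G.degree v = 1) :
    ∃ y, ∀ a, G.Adj v a ↔ a = y := by
  obtain ⟨y, hy⟩ := Finset.card_eq_one.1 h
  exact ⟨y, fun a => by rw [← mem_neighborFinset, hy, Finset.mem_singleton]⟩

theorem SimpleGraph.exists_adj_iff_of_degree_two (h : G.degree v = 2) (hx : G.Adj v x) :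
    ∃ y, y ≠ x ∧ ∀ a, G.Adj v a ↔ a = x ∨ a = y := by
  classical
  have hx' : x ∈ G.neighborFinset v := by simpa
  have h1 : ((G.neighborFinset v).erase x).card = 1 := by
    rw [Finset.card_erase_of_mem hx', card_neighborFinset_eq_degree, h]
  obtain ⟨y, hy⟩ := Finset.card_eq_one.1 h1
  have key : ∀ a, a ≠ x ∧ G.Adj v a ↔ a = y := fun a => by
    rw [← Finset.mem_singleton, ← hy, Finset.mem_erase, mem_neighborFinset]
  refine ⟨y, ((key y).2 rfl).1, fun a => ?_⟩
  rw [← key]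
  grind

theorem SimpleGraph.exists_adj_iff_of_degree_three (h : G.degree v = 3) (hx : G.Adj v x)
    (hy : G.Adj v y) (hxy : x ≠ y) :
    ∃ z, z ≠ x ∧ z ≠ y ∧ ∀ a, G.Adj v a ↔ a = x ∨ a = y ∨ a = z := by
  classical
  have h1 : (((G.neighborFinset v).erase x).erase y).card = 1 := by
    rw [Finset.card_erase_of_mem (by simp [hy, hxy.symm]), Finset.card_erase_of_mem (by simpa),
      card_neighborFinset_eq_degree, h]
  obtain ⟨z, hz⟩ := Finset.card_eq_one.1 h1
  have key : ∀ a, a ≠ y ∧ a ≠ x ∧ G.Adj v a ↔ a = z := fun a => by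
    rw [← Finset.mem_singleton, ← hz, Finset.mem_erase, Finset.mem_erase, mem_neighborFinset]
  refine ⟨z, ((key z).2 rfl).2.1, ((key z).2 rfl).1, fun a => ?_⟩
  rw [← key]
  grind

theorem SimpleGraph.exists_adj_iff_of_degree_four (h : G.degree v = 4) (hx : G.Adj v x)
    (hy : G.Adj v y) (hz : G.Adj v z) (hxy : x ≠ y) (hxz : x ≠ z) (hyz : y ≠ z) :
    ∃ q, q ≠ x ∧ q ≠ y ∧ q ≠ z ∧ ∀ a, G.Adj v a ↔ a = x ∨ a = y ∨ a = z ∨ a = q := by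
  classical
  have h1 : ((((G.neighborFinset v).erase x).erase y).erase z).card = 1 := by
    rw [Finset.card_erase_of_mem (by simp [hz, hxz.symm, hyz.symm]),
      Finset.card_erase_of_mem (by simp [hy, hxy.symm]), Finset.card_erase_of_mem (by simpa),
      card_neighborFinset_eq_degree, h]
  obtain ⟨q, hq⟩ := Finset.card_eq_one.1 h1
  have key : ∀ a, a ≠ z ∧ a ≠ y ∧ a ≠ x ∧ G.Adj v a ↔ a = q := fun a => by
    rw [← Finset.mem_singleton, ← hq, Finset.mem_erase, Finset.mem_erase, Finset.mem_erase,
      mem_neighborFinset]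
  obtain ⟨q1, q2, q3, -⟩ := (key q).2 rfl
  refine ⟨q, q3, q2, q1, fun a => ?_⟩
  rw [← key]
  grind

theorem exists_notMem_of_card_lt {T : Finset V} (h : T.card < Fintype.card V) : ∃ a, a ∉ T := by
  obtain ⟨a, -, ha⟩ := Finset.exists_mem_notMem_of_card_lt_card (t := Finset.univ) h
  exact ⟨a, ha⟩

theorem SimpleGraph.le_degree_of_adj {T : Finset V} (hT : ∀ a ∉ T, G.Adj v a) :
    Fintype.card V - T.card ≤ G.degree v := by
  classical
  rw [← Finset.card_compl]
  exact Finset.card_le_card fun a ha => by simpa using hT a (Finset.mem_compl.1 ha)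

/-- A graph on at least twelve vertices in which all but four vertices form a clique is dense. -/
theorem SimpleGraph.three_mul_card_le_of_clique_compl (hV : 12 ≤ Fintype.card V) {T : Finset V}
    (hT : T.card ≤ 4) (h : ∀ a b, a ∉ T → b ∉ T → a ≠ b → G.Adj a b) :
    3 * Fintype.card V ≤ ∑ v, G.degree v + 2 := by
  classical
  have h1 : ∀ a ∈ Tᶜ, 7 ≤ G.degree a := fun a ha => by
    have := le_degree_of_adj (G := G) (v := a) (T := insert a T) fun b hb => by
      simp only [Finset.mem_insert, not_or] at hb
      exact h a b (Finset.mem_compl.1 ha) hb.2 (Ne.symm hb.1)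
    have := Finset.card_insert_le a T
    omega
  have h2 := Finset.card_nsmul_le_sum Tᶜ (fun a => G.degree a) 7 h1
  have h3 : ∑ a ∈ Tᶜ, G.degree a ≤ ∑ a, G.degree a :=
    Finset.sum_le_sum_of_subset (Finset.subset_univ _)
  rw [Finset.card_compl, smul_eq_mul] at h2
  omega

/-- The number of neighbours of degree two. -/
def SimpleGraph.degreeTwoCount (G : SimpleGraph V) [DecidableRel G.Adj] (v : V) : ℕ :=
  ((G.neighborFinset v).filter fun a => G.degree a = 2).card

theorem SimpleGraph.sum_degreeTwoCount :
    ∑ v, G.degreeTwoCount v = ∑ v, if G.degree v = 2 then 2 else 0 := by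
  have h1 : ∀ v, G.degreeTwoCount v = ∑ a, if G.Adj v a ∧ G.degree a = 2 then 1 else 0 := by
    intro v
    rw [Finset.sum_boole, degreeTwoCount]
    congr 1
    ext a
    simp
  simp_rw [h1]
  rw [Finset.sum_comm]
  refine Finset.sum_congr rfl fun a _ => ?_
  split_ifs with h
  · simp only [h, and_true, Finset.sum_boole]
    rw [← h, ← card_neighborFinset_eq_degree]
    norm_cast
    congr 1
    ext b
    simp [G.adj_comm]
  · simp [h]

theorem SimpleGraph.degreeTwoCount_le_degree (v : V) : G.degreeTwoCount v ≤ G.degree v :=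
  Finset.card_filter_le _ _

theorem SimpleGraph.degreeTwoCount_eq_zero (h : ∀ a, G.Adj v a → G.degree a ≠ 2) :
    G.degreeTwoCount v = 0 := by
  simpa [degreeTwoCount, Finset.filter_eq_empty_iff] using h

/-- Twice the excess of the degree over three, after each vertex of degree two
has been given one unit by each of its neighbours. -/
def SimpleGraph.charge (G : SimpleGraph V) [DecidableRel G.Adj] (v : V) : ℤ :=
  2 * G.degree v - 6 - G.degreeTwoCount v + if G.degree v = 2 then 2 else 0

theorem SimpleGraph.sum_charge :
    ∑ v, G.charge v = 2 * ((∑ v, G.degree v : ℕ) : ℤ) - 6 * Fintype.card V := by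
  have h : ((∑ v, G.degreeTwoCount v : ℕ) : ℤ) =
      ((∑ v, if G.degree v = 2 then 2 else 0 : ℕ) : ℤ) := by
    rw [sum_degreeTwoCount]
  push_cast at h
  simp only [charge, Finset.sum_add_distrib, Finset.sum_sub_distrib, h, ← Finset.mul_sum]
  simp
  ring

theorem MaxNontraceable.degree_ne_two_of_adj_leaf (hG : MaxNontraceable G)
    (h : ∀ a, G.Adj x a ↔ a = y) : G.degree y ≠ 2 := fun hy => by
  obtain ⟨w, hw, h'⟩ := exists_adj_iff_of_degree_two hy ((h y).2 rfl).symm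
  have := (h w).1 (hG.adj_of_degree_two h' hw.symm)
  exact ((h' w).2 (.inr rfl)).ne this.symm

theorem MaxNontraceable.charge_leaf (hG : MaxNontraceable G) (h : G.degree x = 1) :
    G.charge x = -4 := by
  obtain ⟨y, hy⟩ := exists_adj_iff_of_degree_one h
  have h1 : G.degreeTwoCount x = 0 := degreeTwoCount_eq_zero fun a ha => by
    rw [(hy a).1 ha]
    exact hG.degree_ne_two_of_adj_leaf hy
  simp [charge, h, h1]

theorem MaxNontraceable.charge_nonneg (hG : MaxNontraceable G) (hV : 12 ≤ Fintype.card V)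
    (h2 : ∀ u v, G.Adj u v → G.degree u = 2 → G.degree v ≠ 2) (hv : 2 ≤ G.degree v) :
    0 ≤ G.charge v := by
  classical
  have hle := G.degreeTwoCount_le_degree v
  have third : ∀ a, G.Adj v a → G.degree a = 2 →
      ∃ w, (∀ b, G.Adj a b ↔ b = v ∨ b = w) ∧ G.Adj v w ∧ G.degree w ≠ 2 := by
    intro a ha ha2
    obtain ⟨w, hw, h⟩ := exists_adj_iff_of_degree_two ha2 ha.symm
    exact ⟨w, h, hG.adj_of_degree_two h hw.symm, h2 a w ((h w).2 (.inr rfl)) ha2⟩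
  obtain h | h | h | h | h : G.degree v = 2 ∨ G.degree v = 3 ∨ G.degree v = 4 ∨ G.degree v = 5 ∨
    6 ≤ G.degree v := by omega
  · have := degreeTwoCount_eq_zero fun a ha => h2 v a ha h
    simp [charge, h, this]
  · have : G.degreeTwoCount v = 0 := degreeTwoCount_eq_zero fun a ha ha2 => by
      obtain ⟨w, h', hw, -⟩ := third a ha ha2
      have haw : G.Adj a w := (h' w).2 (.inr rfl)
      obtain ⟨z, hza, hzw, h3⟩ := exists_adj_iff_of_degree_three h ha hw haw.ne
      exact hG.not_degree_three h' h3 hza.symm hzw.symm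
    simp [charge, h, this]
  · have : G.degreeTwoCount v ≤ 2 := by
      by_contra! hlt
      obtain ⟨a, b, c, ha, hb, hc, hab, hac, hbc⟩ := Finset.two_lt_card_iff.1 hlt
      simp only [Finset.mem_filter, mem_neighborFinset] at ha hb hc
      obtain ⟨q, -, -, -, hq⟩ := exists_adj_iff_of_degree_four h ha.1 hb.1 hc.1 hab hac hbc
      have common : ∀ d, G.Adj v d ∧ G.degree d = 2 → ∀ e, G.Adj d e → e = v ∨ e = q := by
        intro d hd e he
        obtain ⟨w, h', hw, hw2⟩ := third d hd.1 hd.2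
        have : w = q := by
          rcases (hq w).1 hw with rfl | rfl | rfl | h
          exacts [(hw2 ha.2).elim, (hw2 hb.2).elim, (hw2 hc.2).elim, h]
        exact this ▸ (h' e).1 he
      obtain ⟨x, hx⟩ := exists_notMem_of_card_lt (T := insert v (G.neighborFinset v)) (by
        have := Finset.card_insert_le v (G.neighborFinset v)
        rw [card_neighborFinset_eq_degree] at this
        omega)
      simp only [Finset.mem_insert, mem_neighborFinset, not_or] at hx
      exact hG.not_three_common (common a ha) (common b hb) (common c hc) hab hac hbc
        ⟨ha.1, hb.1, hc.1⟩ (Ne.symm hx.1) hx.2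
    simp only [charge, h]
    norm_num
    omega
  · have : G.degreeTwoCount v ≠ 5 := fun h5 => by
      have hall := Finset.card_filter_eq_iff.1 (h5.trans h.symm)
      simp only [mem_neighborFinset] at hall
      obtain ⟨a, ha⟩ := Finset.card_pos.1 (h ▸ Nat.succ_pos 4 : 0 < G.degree v)
      rw [mem_neighborFinset] at ha
      obtain ⟨w, -, hw, hw2⟩ := third a ha (hall a ha)
      exact hw2 (hall w hw)
    simp only [charge, h]
    norm_num
    omega
  · rw [charge, if_neg (by omega)]
    omega

/-- Two leaves whose neighbours have degrees at least three. -/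
theorem MaxNontraceable.five_le_degree (hG : MaxNontraceable G) (hV : 12 ≤ Fintype.card V)
    (hs : ∀ T : Finset V, T.card ≤ 4 → ∃ a b, a ∉ T ∧ b ∉ T ∧ a ≠ b ∧ ¬ G.Adj a b)
    (h₁ : ∀ a, G.Adj x₁ a ↔ a = y₁) (h₂ : ∀ a, G.Adj x₂ a ↔ a = y₂)
    (hyx : y₁ ≠ x₂) (hxy : x₁ ≠ y₂) (hyy : G.Adj y₁ y₂) (hd₁ : G.degree y₁ = 3)
    (hd₂ : 3 ≤ G.degree y₂) : 5 ≤ G.degree y₂ := by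
  classical
  have hx₁ : G.Adj x₁ y₁ := (h₁ y₁).2 rfl
  have hx₂ : G.Adj x₂ y₂ := (h₂ y₂).2 rfl
  obtain ⟨z, hzx, hzy, hy₁⟩ := exists_adj_iff_of_degree_three hd₁ hx₁.symm hyy hxy
  have hyz : G.Adj y₁ z := (hy₁ z).2 (.inr (.inr rfl))
  have hzx₂ : z ≠ x₂ := by
    rintro rfl
    exact hyy.ne ((h₂ y₁).1 hyz.symm)
  obtain ⟨r, hr⟩ := exists_notMem_of_card_lt (T := {x₁, x₂, y₁, y₂, z})
    (lt_of_le_of_lt Finset.card_le_five (by omega))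
  simp only [Finset.mem_insert, Finset.mem_singleton, not_or] at hr
  have hzy₂ := hG.adj_third_neighbour h₁ h₂ hyx hy₁ hzx hzy hr
  by_contra! hlt
  obtain h | h : G.degree y₂ = 3 ∨ G.degree y₂ = 4 := by omega
  · obtain ⟨q, hqx, hqy, hy₂⟩ := exists_adj_iff_of_degree_three h hx₂.symm hyy.symm hyx.symm
    obtain rfl : z = q := by
      rcases (hy₂ z).1 hzy₂ with h | h | h
      exacts [(hzx₂ h).elim, (hyz.ne' h).elim, h]
    obtain ⟨a, b, ha, hb, hab, hn⟩ := hs {x₁, x₂, y₁, y₂} Finset.card_le_four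
    simp only [Finset.mem_insert, Finset.mem_singleton, not_or] at ha hb
    exact hn (hG.adj_of_common_neighbour h₁ h₂ hy₁ hy₂ ha hb hab)
  · obtain ⟨q, hqx, hqy, hqz, hy₂⟩ := exists_adj_iff_of_degree_four h hx₂.symm hyy.symm hzy₂
      hyx.symm hzx₂.symm hyz.ne
    obtain ⟨r, hr⟩ := exists_notMem_of_card_lt (T := {x₁, x₂, y₁, y₂, q})
      (lt_of_le_of_lt Finset.card_le_five (by omega))
    simp only [Finset.mem_insert, Finset.mem_singleton, not_or] at hr
    refine hG.not_degrees_three_four h₁ h₂ hyx hy₁ hy₂ ⟨?_, hqx, hqz, hqy⟩ hr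
    rintro rfl
    exact hyy.ne' ((h₁ y₂).1 ((hy₂ q).2 (by simp)).symm)

theorem MaxNontraceable.four_le_charge_add (hG : MaxNontraceable G) (hV : 12 ≤ Fintype.card V)
    (hs : ∀ T : Finset V, T.card ≤ 4 → ∃ a b, a ∉ T ∧ b ∉ T ∧ a ≠ b ∧ ¬ G.Adj a b)
    (h2 : ∀ u v, G.Adj u v → G.degree u = 2 → G.degree v ≠ 2)
    (h₁ : ∀ a, G.Adj x₁ a ↔ a = y₁) (h₂ : ∀ a, G.Adj x₂ a ↔ a = y₂) (hx : x₁ ≠ x₂) :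
    y₁ ≠ y₂ ∧ 2 ≤ G.degree y₁ ∧ 2 ≤ G.degree y₂ ∧ 4 ≤ G.charge y₁ + G.charge y₂ := by
  classical
  have hx₁ : G.Adj x₁ y₁ := (h₁ y₁).2 rfl
  have hx₂ : G.Adj x₂ y₂ := (h₂ y₂).2 rfl
  obtain ⟨hy, hyx⟩ : y₁ ≠ y₂ ∧ y₁ ≠ x₂ := by
    rw [← not_or]
    intro hy
    obtain ⟨a, b, ha, hb, hab, hn⟩ := hs {x₁, x₂} (Finset.card_le_two.trans (by norm_num))
    simp only [Finset.mem_insert, Finset.mem_singleton, not_or] at ha hb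
    exact hn (hG.adj_of_two_leaves h₁ h₂ hx hy ha hb hab)
  have hxy : x₁ ≠ y₂ := by
    rintro rfl
    exact hyx ((h₁ x₂).1 hx₂.symm).symm
  obtain ⟨q, hq⟩ := exists_notMem_of_card_lt (T := {x₁, x₂, y₁, y₂})
    (lt_of_le_of_lt Finset.card_le_four (by omega))
  simp only [Finset.mem_insert, Finset.mem_singleton, not_or] at hq
  have hyy := hG.adj_leaf_neighbours h₁ h₂ hy hyx hq
  have two : ∀ {v a b}, G.Adj v a → G.Adj v b → a ≠ b → 2 ≤ G.degree v := by
    intro v a b ha hb hab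
    rw [← Finset.card_pair hab]
    exact Finset.card_le_card (by simp [Finset.insert_subset_iff, ha, hb])
  have hd₁ := two hx₁.symm hyy hxy
  have hd₂ := two hx₂.symm hyy.symm hyx.symm
  have c₁ := hG.charge_nonneg hV h2 hd₁
  have c₂ := hG.charge_nonneg hV h2 hd₂
  have e₁ := hG.degree_ne_two_of_adj_leaf h₁
  have e₂ := hG.degree_ne_two_of_adj_leaf h₂
  refine ⟨hy, hd₁, hd₂, ?_⟩
  have key : ∀ {x₁ x₂ y₁ y₂}, (∀ a, G.Adj x₁ a ↔ a = y₁) → (∀ a, G.Adj x₂ a ↔ a = y₂) →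
      x₁ ≠ x₂ → y₁ ≠ x₂ → G.degreeTwoCount y₁ ≠ 0 → 4 ≤ G.charge y₁ := by
    intro x₁ x₂ y₁ y₂ h₁ h₂ hx hyx h0
    have : ∃ v, G.Adj y₁ v ∧ G.degree v = 2 := by
      by_contra! h
      exact h0 (degreeTwoCount_eq_zero h)
    obtain ⟨v, hv, hv2⟩ := this
    obtain ⟨w, hw, h'⟩ := exists_adj_iff_of_degree_two hv2 hv.symm
    have hd := le_degree_of_adj (G := G) (v := y₁) (T := {y₁, x₂}) fun a ha => by
      simp only [Finset.mem_insert, Finset.mem_singleton, not_or] at ha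
      exact hG.adj_of_neighbour_of_leaf h₁ h₂ hx hyx h' hw ha.1 ha.2
    have := G.degreeTwoCount_le_degree y₁
    rw [Finset.card_pair hyx] at hd
    rw [charge, if_neg (by omega)]
    omega
  by_cases t₁ : G.degreeTwoCount y₁ = 0
  · by_cases t₂ : G.degreeTwoCount y₂ = 0
    · have k₁ := hG.five_le_degree hV hs h₁ h₂ hyx hxy hyy
      have k₂ := hG.five_le_degree hV hs h₂ h₁ hxy.symm hyx.symm hyy.symm
      rw [charge, charge, if_neg e₁, if_neg e₂, t₁, t₂]
      omega
    · have := key h₂ h₁ hx.symm hxy.symm t₂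
      omega
  · have := key h₁ h₂ hx hyx t₁
    omega

theorem MaxNontraceable.three_mul_card_le_of_not_adj (hG : MaxNontraceable G)
    (hV : 12 ≤ Fintype.card V)
    (h2 : ∀ u v, G.Adj u v → G.degree u = 2 → G.degree v ≠ 2) :
    3 * Fintype.card V ≤ ∑ v, G.degree v + 2 := by
  classical
  by_contra hlt
  have hs : ∀ T : Finset V, T.card ≤ 4 → ∃ a b, a ∉ T ∧ b ∉ T ∧ a ≠ b ∧ ¬ G.Adj a b := by
    intro T hT
    by_contra! h
    exact hlt (three_mul_card_le_of_clique_compl hV hT h)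
  have h0 : ∀ v, G.degree v ≠ 0 := by
    intro v hv
    obtain ⟨a, b, ha, hb, hab, hn⟩ := hs {v} (by simp)
    rw [Finset.mem_singleton] at ha hb
    refine hn (hG.adj_of_isolated (x := v) (fun c hc => ?_) ha hb hab)
    have : c ∈ G.neighborFinset v := by simpa
    rw [Finset.card_eq_zero.1 hv] at this
    simp at this
  have hsum := G.sum_charge
  set L := Finset.univ.filter fun v => G.degree v = 1 with hL
  have hmem : ∀ v, v ∈ L ↔ G.degree v = 1 := by simp [hL]
  have hsL : ∑ v ∈ L, G.charge v = -4 * L.card := by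
    rw [Finset.sum_congr rfl fun v hv => hG.charge_leaf ((hmem v).1 hv)]
    simp [mul_comm]
  have hnn : ∀ v ∈ Lᶜ, 0 ≤ G.charge v := fun v hv => by
    refine hG.charge_nonneg hV h2 ?_
    have := h0 v
    rw [Finset.mem_compl, hmem] at hv
    omega
  rw [← Finset.sum_add_sum_compl L, hsL] at hsum
  obtain h | h | h : L.card ≤ 1 ∨ L.card = 2 ∨ 2 < L.card := by omega
  · have := Finset.sum_nonneg hnn
    omega
  · obtain ⟨x₁, x₂, hx, hLx⟩ := Finset.card_eq_two.1 h
    obtain ⟨y₁, h₁⟩ := exists_adj_iff_of_degree_one ((hmem x₁).1 (by simp [hLx]))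
    obtain ⟨y₂, h₂⟩ := exists_adj_iff_of_degree_one ((hmem x₂).1 (by simp [hLx]))
    obtain ⟨hy, hd₁, hd₂, hc⟩ := hG.four_le_charge_add hV hs h2 h₁ h₂ hx
    have hsub : ({y₁, y₂} : Finset V) ⊆ Lᶜ := by
      intro y hy
      rw [Finset.mem_compl, hmem]
      simp only [Finset.mem_insert, Finset.mem_singleton] at hy
      rcases hy with rfl | rfl <;> omega
    have := Finset.sum_le_sum_of_subset_of_nonneg hsub fun v hv _ => hnn v hv
    rw [Finset.sum_pair hy] at this
    omega
  · obtain ⟨x₁, x₂, x₃, m₁, m₂, m₃, h12, h13, h23⟩ := Finset.two_lt_card_iff.1 h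
    obtain ⟨y₁, h₁⟩ := exists_adj_iff_of_degree_one ((hmem x₁).1 m₁)
    obtain ⟨y₂, h₂⟩ := exists_adj_iff_of_degree_one ((hmem x₂).1 m₂)
    obtain ⟨y₃, h₃⟩ := exists_adj_iff_of_degree_one ((hmem x₃).1 m₃)
    obtain ⟨a, b, ha, hb, hab, hn⟩ := hs {x₁, x₂, x₃} (Finset.card_le_three.trans (by norm_num))
    simp only [Finset.mem_insert, Finset.mem_singleton, not_or] at ha hb
    exact hn (hG.adj_of_three_leaves h₁ h₂ h₃ h12 h13 h23 ha hb hab)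

end Counting

theorem SimpleGraph.degree_removeVertex_add {V : Type*} [Fintype V] [DecidableEq V]
    (G : SimpleGraph V) [DecidableRel G.Adj] (v : V) (a : {a // a ≠ v}) :
    (G.removeVertex v).degree a + (if G.Adj v a then 1 else 0) = G.degree a := by
  have h : ((G.removeVertex v).neighborFinset a).map (.subtype _) =
      (G.neighborFinset a).erase v := by
    ext b
    simp [and_comm]
  rw [← card_neighborFinset_eq_degree, ← Finset.card_map (.subtype _), h]
  split_ifs with hv
  · exact Finset.card_erase_add_one (by simpa using hv.symm)
  · rw [Finset.erase_eq_of_notMem (by simpa [G.adj_comm] using hv), add_zero,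
      card_neighborFinset_eq_degree]

theorem SimpleGraph.sum_degree_removeVertex_add {V : Type*} [Fintype V] [DecidableEq V]
    (G : SimpleGraph V) [DecidableRel G.Adj] (v : V) :
    ∑ a, (G.removeVertex v).degree a + 2 * G.degree v = ∑ a, G.degree a := by
  have h : ∑ a, (if G.Adj v a then 1 else 0) = G.degree v := by
    rw [Finset.sum_boole, ← card_neighborFinset_eq_degree, neighborFinset_eq_filter, Nat.cast_id]
  rw [Fintype.sum_eq_add_sum_subtype_ne _ v] at h ⊢
  simp_rw [← degree_removeVertex_add, Finset.sum_add_distrib]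
  rw [if_neg (G.irrefl)] at h
  omega

/-- The invariant on the number of vertices of degree two is preserved when one of two adjacent
vertices of degree two is removed. -/
theorem MaxNontraceable.three_mul_card_le {V : Type*} [Fintype V] {G : SimpleGraph V}
    [DecidableRel G.Adj] (hG : MaxNontraceable G)
    (hV : 24 + (Finset.univ.filter fun v => G.degree v = 2).card ≤ 2 * Fintype.card V) :
    3 * Fintype.card V ≤ ∑ v, G.degree v + 2 := by
  classical
  induction hm : Fintype.card V generalizing V with
  | zero => omega
  | succ m ih =>
    by_cases h2 : ∀ u v, G.Adj u v → G.degree u = 2 → G.degree v ≠ 2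
    · rw [← hm]
      exact hG.three_mul_card_le_of_not_adj (by omega) h2
    · push Not at h2
      obtain ⟨u, v, huv, hu, hv⟩ := h2
      obtain ⟨w, hwu, hv'⟩ := exists_adj_iff_of_degree_two hv huv.symm
      obtain ⟨w', -, hu'⟩ := exists_adj_iff_of_degree_two hu huv
      have huw := hG.adj_of_degree_two hv' hwu.symm
      have hvw : G.Adj v w := (hv' w).2 (.inr rfl)
      obtain rfl : w = w' := ((hu' w).1 huw).resolve_left hvw.ne'
      have hw : G.degree w ≠ 3 := fun hw => by
        obtain ⟨z, hzv, hzu, hw'⟩ := exists_adj_iff_of_degree_three hw hvw.symm huw.symm huv.ne'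
        exact hG.not_degree_three (fun a => (hv' a).trans or_comm) hw' hzv.symm hzu.symm
      have hH := (maxNontraceable_removeVertex_iff hv' hu').2 hG
      have hcard : Fintype.card {a // a ≠ v} = m := by
        rw [Fintype.card_subtype_compl, hm]
        simp
      have hsub : (Finset.univ.filter fun a => (G.removeVertex v).degree a = 2).map
          (.subtype _) ⊆ ((Finset.univ.filter fun a => G.degree a = 2).erase u).erase v := by
        intro a ha
        simp only [Finset.mem_map, Finset.mem_filter, Finset.mem_univ, true_and] at ha
        obtain ⟨⟨a, hav⟩, ha2, rfl⟩ := ha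
        have hd := G.degree_removeVertex_add v ⟨a, hav⟩
        rw [ha2] at hd
        simp only [Function.Embedding.subtype_apply, Finset.mem_erase, Finset.mem_filter,
          Finset.mem_univ, true_and]
        have hau : a ≠ u := by
          rintro rfl
          simp [huv.symm, hu] at hd
        refine ⟨hav, hau, ?_⟩
        rw [if_neg] at hd
        · exact hd.symm
        · intro hva
          obtain rfl := ((hv' a).1 hva).resolve_left hau
          simp only [hva, if_true] at hd
          exact hw hd.symm
      have hle := Finset.card_le_card hsub
      rw [Finset.card_map, Finset.card_erase_of_mem (by simp [hv, huv.ne']),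
        Finset.card_erase_of_mem (by simp [hu])] at hle
      have hsum := G.sum_degree_removeVertex_add v
      have hpos : 0 < ((Finset.univ.filter fun a => G.degree a = 2).erase u).card :=
        Finset.card_pos.2 ⟨v, by simp [hv, huv.ne']⟩
      rw [Finset.card_erase_of_mem (by simp [hu])] at hpos
      have := ih hH (by omega) hcard
      omega

theorem MaxNontraceable.three_mul_le_card_edgeSet {n : ℕ} (hn : 54 ≤ n) {G : SimpleGraph (Fin n)}
    (hG : MaxNontraceable G) : 3 * n ≤ 2 * Nat.card G.edgeSet + 2 := by
  classical
  have h := hG.three_mul_card_le (by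
    have := Finset.card_filter_le Finset.univ fun v => G.degree v = 2
    rw [Finset.card_univ, Fintype.card_fin] at this
    rw [Fintype.card_fin]
    omega)
  rw [sum_degrees_eq_twice_card_edges, Fintype.card_fin] at h
  rwa [Nat.card_eq_fintype_card, ← edgeFinset_card]

theorem ceil_three_mul_sub_two_div_two (n : ℕ) :
    ⌈(3 * (n : ℚ) - 2) / 2⌉ = (3 * (n : ℤ) - 1) / 2 := by
  rw [Int.ceil_eq_iff]
  obtain h | h : 3 * (n : ℤ) - 1 = 2 * ((3 * (n : ℤ) - 1) / 2) ∨
    3 * (n : ℤ) - 1 = 2 * ((3 * (n : ℤ) - 1) / 2) + 1 := by omega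
  all_goals
    have h' := congrArg (Int.cast : ℤ → ℚ) h
    push_cast at h' ⊢
    constructor <;> linarith

/-- For every n ≥ 54 the minimum size of a MNT graph of order n is ⌈(3n − 2)/2⌉. -/
theorem stmt_13 (n : ℕ) (hn : 54 ≤ n) :
    (∀ G : SimpleGraph (Fin n), MaxNontraceable G →
      ⌈(3 * (n : ℚ) - 2) / 2⌉ ≤ (Nat.card G.edgeSet : ℤ)) ∧
    (∃ G : SimpleGraph (Fin n), MaxNontraceable G ∧
      (Nat.card G.edgeSet : ℤ) = ⌈(3 * (n : ℚ) - 2) / 2⌉) := by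
  rw [ceil_three_mul_sub_two_div_two]
  refine ⟨fun G hG => ?_, ?_⟩
  · have := hG.three_mul_le_card_edgeSet hn
    omega
  · obtain ⟨G, hG, hm⟩ := exists_maxNontraceable_card_edgeSet_le hn
    have := hG.three_mul_le_card_edgeSet hn
    exact ⟨G, hG, by omega⟩
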